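/- Let k be a global field of characteristic p > 0 (a finite extension of F_p(t)). Let e and f be positive integers prime to p, and assume k contains a primitive e-th root of unity. Let Γ be a finite group whose p-Sylow subgroup P is normal, with quotient Γ/P isomorphic to the direct product (ℤ/eℤ) × (ℤ/fℤ). Let S be any finite set of pairwise inequivalent nontrivial discrete valuations (places) of k. Then there exists a finite Galois extension K of k with Gal(K/k) ≅ Γ such that for each v ∈ S, the valuation v has a unique extension to K (equivalently, K ⊗_k k_v is a field, so that Gal(K_v/k_v) ≅ Γ where K_v is the completion of K at the unique extension of v). -/

import Mathlib

/-- An absolute value (rank-1 valuation) is nonarchimedean if it satisfies the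
ultrametric inequality. -/
def AbsoluteValue.IsNonarch {k : Type} [Field k] (v : AbsoluteValue k ℝ) : Prop :=
  ∀ x y : k, v (x + y) ≤ max (v x) (v y)

/-- Two absolute values on `k` are equivalent (induce the same topology) iff one is a
positive real power of the other. -/
def AbsoluteValue.IsEquivalent {k : Type} [Field k] (v w : AbsoluteValue k ℝ) : Prop :=
  ∃ r : ℝ, 0 < r ∧ ∀ x : k, w x = v x ^ r

/-- A discrete valuation on `k`, encoded as a nonarchimedean absolute value which is
nontrivial and whose value group `v(kˣ)` is the infinite cyclic group `cᶻ` generated by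
some real number `0 < c < 1` (so the value group is isomorphic to `ℤ`). -/
def AbsoluteValue.IsDiscrete {k : Type} [Field k] (v : AbsoluteValue k ℝ) : Prop :=
  v.IsNonarch ∧ ∃ c : ℝ, 0 < c ∧ c < 1 ∧ (∃ x : k, v x = c) ∧
    ∀ x : k, x ≠ 0 → ∃ n : ℤ, v x = c ^ n

/-- An absolute value extending `v` to a Galois extension, pulled back from the separable closure
of a completion, has the property that elements fixed by its decomposition group lie in the
closure of the base field. -/
theorem AbsoluteValue.exists_extension_of_complete {k Ω K : Type*} [Field k] [Field Ω] [Algebra k Ω]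
    [IsGalois k Ω] [NontriviallyNormedField K] [CompleteSpace K] [IsUltrametricDist K]
    (i : k →+* K) (hi : DenseRange i) :
    ∃ w : AbsoluteValue Ω ℝ, IsNonarchimedean w ∧ (∀ a, w (algebraMap k Ω a) = ‖i a‖) ∧
      ∀ x : Ω, (∀ σ : Ω ≃ₐ[k] Ω, (∀ y, w (σ y) = w y) → σ x = x) →
        ∀ ε > 0, ∃ a : k, w (x - algebraMap k Ω a) < ε := by
  let : Algebra k K := i.toAlgebra
  let C := SeparableClosure K
  let : Algebra k C := ((algebraMap K C).comp i).toAlgebra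
  have : IsScalarTower k K C := IsScalarTower.of_algebraMap_eq' rfl
  let ι : Ω →ₐ[k] C := IsSepClosed.lift
  let N : MulAlgebraNorm K C := spectralMulAlgNorm K C
  have hNna : IsNonarchimedean N := isNonarchimedean_spectralNorm
  have hNext : ∀ a : K, N (algebraMap K C a) = ‖a‖ := fun a => spectralNorm_extends a
  let w : AbsoluteValue Ω ℝ :=
    { toFun := fun x => N (ι x)
      map_mul' := fun x y => by simp [map_mul]
      nonneg' := fun x => apply_nonneg _ _
      eq_zero' := fun x => by simp
      add_le' := fun x y => by rw [map_add]; exact map_add_le_add _ _ _ }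
  have hw : ∀ x, w x = N (ι x) := fun _ => rfl
  have hιk : ∀ a, ι (algebraMap k Ω a) = algebraMap K C (i a) := fun a => by
    rw [ι.commutes, IsScalarTower.algebraMap_apply k K C]; rfl
  refine ⟨w, fun x y => ?_, fun a => ?_, fun x hx ε hε => ?_⟩
  · simp only [hw, map_add]; exact hNna _ _
  · rw [hw, hιk, hNext]
  have hfix : ι x ∈ Set.range (algebraMap K C) := by
    rw [InfiniteGalois.mem_range_algebraMap_iff_fixed]
    intro τ
    let : Algebra Ω C := ι.toRingHom.toAlgebra
    have : IsScalarTower k Ω C := IsScalarTower.of_algebraMap_eq fun a => (ι.commutes a).symm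
    let σ : Ω ≃ₐ[k] Ω := (τ.restrictScalars k : C ≃ₐ[k] C).restrictNormal Ω
    have hσ : ∀ y, ι (σ y) = τ (ι y) := fun y =>
      AlgEquiv.restrictNormal_commutes (τ.restrictScalars k : C ≃ₐ[k] C) Ω y
    have : σ x = x := hx σ fun y => by
      rw [hw, hw, hσ]
      exact (spectralNorm_eq_of_equiv τ (ι y)).symm
    rw [← hσ, this]
  obtain ⟨a, ha⟩ := hfix
  obtain ⟨b, hb⟩ := hi.exists_dist_lt a hε
  refine ⟨b, ?_⟩
  rwa [hw, map_sub, hιk, ← ha, ← map_sub, hNext, ← dist_eq_norm]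

/-- Every nontrivial nonarchimedean absolute value extends to a Galois extension in such a way
that elements fixed by the decomposition group lie in the closure of the base field. -/
theorem AbsoluteValue.exists_extension_fixed_mem_closure {k Ω : Type*} [Field k] [Field Ω]
    [Algebra k Ω] [IsGalois k Ω] (v : AbsoluteValue k ℝ) (hv : IsNonarchimedean v)
    (hnt : v.IsNontrivial) :
    ∃ w : AbsoluteValue Ω ℝ, IsNonarchimedean w ∧ (∀ a, w (algebraMap k Ω a) = v a) ∧
      ∀ x : Ω, (∀ σ : Ω ≃ₐ[k] Ω, (∀ y, w (σ y) = w y) → σ x = x) →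
        ∀ ε > 0, ∃ a : k, w (x - algebraMap k Ω a) < ε := by
  let K := v.Completion
  have key : ∀ x : WithAbs v, ‖(x : K)‖ = v x.ofAbs := UniformSpace.Completion.norm_coe
  let : NontriviallyNormedField K :=
    { (inferInstance : NormedField K) with
      non_trivial := by
        obtain ⟨x, hx⟩ := hnt.exists_abv_gt_one
        exact ⟨((WithAbs.toAbs v x : WithAbs v) : K), (key _).symm ▸ hx⟩ }
  have : IsUltrametricDist K := by
    refine IsUltrametricDist.isUltrametricDist_of_isNonarchimedean_norm fun x y => ?_
    induction x, y using UniformSpace.Completion.induction_on₂ with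
    | hp => exact isClosed_le (by fun_prop) (by fun_prop)
    | ih x y =>
      rw [← UniformSpace.Completion.coe_add, key, key, key]
      exact hv _ _
  let i : k →+* K :=
    (UniformSpace.Completion.coeRingHom (α := WithAbs v)).comp (WithAbs.equiv v).symm.toRingHom
  have hi : DenseRange i :=
    (UniformSpace.Completion.denseRange_coe (α := WithAbs v)).comp
      (WithAbs.equiv v).symm.surjective.denseRange (UniformSpace.Completion.continuous_coe _)
  obtain ⟨w, h1, h2, h3⟩ := AbsoluteValue.exists_extension_of_complete (Ω := Ω) i hi
  exact ⟨w, h1, fun a => (h2 a).trans (key _), h3⟩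

open Polynomial in
theorem ValuationSubring.finite_residueField_of_mem {p : ℕ} [Fact p.Prime] {k : Type*} [Field k]
    (j : (ZMod p)[X] →+* k) (hj : Function.Injective j) (N : ℕ)
    (hN : ∀ x : k, ∃ P : (ZMod p)[X][X], P ≠ 0 ∧ P.natDegree ≤ N ∧ P.eval₂ j x = 0)
    (O : ValuationSubring k) (hO : O ≠ ⊤) (hX : j X ∈ O) :
    Finite (IsLocalRing.ResidueField O) := by
  have hmem : ∀ a, j a ∈ O := by
    intro a
    induction a using Polynomial.induction_on' with
    | add a b ha hb => rw [map_add]; exact O.add_mem _ _ ha hb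
    | monomial n a =>
      rw [← C_mul_X_pow_eq_monomial, map_mul, map_pow]
      refine O.mul_mem _ _ ?_ (O.toSubring.pow_mem hX n)
      obtain ⟨m, rfl⟩ := ZMod.natCast_zmod_surjective a
      rw [map_natCast, map_natCast]
      exact natCast_mem O m
  let h : (ZMod p)[X] →+* O := j.codRestrict O hmem
  let g : (ZMod p)[X] →+* IsLocalRing.ResidueField O := (IsLocalRing.residue O).comp h
  have hker : ∃ c : (ZMod p)[X], c ≠ 0 ∧ g c = 0 := by
    obtain ⟨x, hx⟩ : ∃ x, x ∉ O := by
      by_contra! hx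
      exact hO (_root_.eq_top_iff.mpr fun x _ => hx x)
    have hx0 : x ≠ 0 := fun h0 => hx (h0 ▸ O.zero_mem)
    have hy : x⁻¹ ∈ O := (O.mem_or_inv_mem x).resolve_left hx
    let : Algebra (ZMod p)[X] k := j.toAlgebra
    obtain ⟨P, hP, -, hPx⟩ := hN x⁻¹
    have halg : IsAlgebraic (ZMod p)[X] x⁻¹ := ⟨P, hP, hPx⟩
    obtain ⟨Q, hQ0, hQ⟩ := halg.exists_nonzero_coeff_and_aeval_eq_zero
      (mem_nonZeroDivisors_of_ne_zero (inv_ne_zero hx0))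
    refine ⟨Q.coeff 0, hQ0, ?_⟩
    have hQ' : Q.eval₂ h ⟨x⁻¹, hy⟩ = 0 := by
      apply Subtype.val_injective
      change O.subtype _ = O.subtype 0
      rw [hom_eval₂, map_zero]
      exact hQ
    rw [← Q.divX_mul_X_add, eval₂_add, eval₂_mul, eval₂_X, eval₂_C] at hQ'
    have hm : (IsLocalRing.residue O) ⟨x⁻¹, hy⟩ = 0 := by
      rw [IsLocalRing.residue_eq_zero_iff, IsLocalRing.mem_maximalIdeal, _root_.mem_nonunits_iff]
      intro hu
      apply hx
      obtain ⟨b, hb⟩ := hu.exists_right_inv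
      have : x⁻¹ * (b : k) = 1 := congrArg Subtype.val hb
      have : (b : k) = x := by
        field_simp at this
        exact this
      exact this ▸ b.2
    have := congrArg (IsLocalRing.residue O) hQ'
    rw [map_add, map_mul, hm, mul_zero, zero_add, map_zero] at this
    exact this
  have hfin : Finite g.range := by
    obtain ⟨c, hc, hgc⟩ := hker
    have : Module.Finite (ZMod p) (AdjoinRoot c) := (AdjoinRoot.powerBasis hc).finite
    have : Finite (AdjoinRoot c) := Module.finite_of_finite (ZMod p)
    let l : AdjoinRoot c →+* IsLocalRing.ResidueField O := Ideal.Quotient.lift _ g (by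
      intro a ha
      obtain ⟨b, rfl⟩ := Ideal.mem_span_singleton.mp ha
      rw [map_mul, hgc, zero_mul])
    have : (Set.range l).Finite := Set.finite_range l
    refine (this.subset ?_ : (g.range : Set _).Finite)
    rintro _ ⟨a, rfl⟩
    exact ⟨AdjoinRoot.mk c a, Ideal.Quotient.lift_mk _ _ _⟩
  have hprim : ∀ P : (ZMod p)[X][X], P.IsPrimitive → P.map g ≠ 0 := by
    intro P hP h0
    obtain ⟨π, hπ⟩ := (IsPrincipalIdealRing.principal (RingHom.ker g)).principal
    have hdvd : C π ∣ P := by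
      rw [C_dvd_iff_dvd_coeff]
      intro i
      rw [← Ideal.mem_span_singleton, ← Ideal.submodule_span_eq, ← hπ, RingHom.mem_ker,
        ← coeff_map, h0, coeff_zero]
    have hu := hP _ hdvd
    have : g π = 0 := by
      rw [← RingHom.mem_ker, hπ]
      exact Ideal.mem_span_singleton_self π
    exact (this ▸ hu.map g).ne_zero rfl
  have hcover : (Set.univ : Set (IsLocalRing.ResidueField O)) ⊆
      ⋃ u : Fin (N + 1) → g.range,
        {x | x ∈ (∑ i, C ((u i : g.range) : IsLocalRing.ResidueField O) * X ^ (i : ℕ)).roots} := by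
    intro x _
    obtain ⟨x, rfl⟩ := IsLocalRing.residue_surjective x
    obtain ⟨P, hP, hPN, hPx⟩ := hN x
    have hPx' : P.primPart.eval₂ j x = 0 := by
      rw [P.eq_C_content_mul_primPart, eval₂_mul, eval₂_C] at hPx
      refine (mul_eq_zero.mp hPx).resolve_left fun h0 => hP ?_
      rw [map_eq_zero_iff j hj, content_eq_zero_iff] at h0
      exact h0
    have hPx'' : (P.primPart.map g).eval (IsLocalRing.residue O x) = 0 := by
      rw [eval_map, ← hom_eval₂]
      have : P.primPart.eval₂ h x = 0 := by
        apply Subtype.val_injective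
        change O.subtype _ = O.subtype 0
        rw [hom_eval₂, map_zero]
        exact hPx'
      rw [this, map_zero]
    rw [Set.mem_iUnion]
    refine ⟨fun i => ⟨g (P.primPart.coeff i), ⟨_, rfl⟩⟩, ?_⟩
    have hsum : (∑ i : Fin (N + 1), C (g (P.primPart.coeff i)) * X ^ (i : ℕ)) =
        P.primPart.map g := by
      rw [Fin.sum_univ_eq_sum_range (fun i => C (g (P.primPart.coeff i)) * X ^ i),
        as_sum_range_C_mul_X_pow' (P.primPart.map g) (n := N + 1)]
      · simp only [coeff_map]
      · have := natDegree_map_le (f := g) (p := P.primPart)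
        rw [natDegree_primPart] at this
        omega
    change _ ∈ (∑ i : Fin (N + 1), C (g (P.primPart.coeff i)) * X ^ (i : ℕ)).roots
    rw [hsum, mem_roots (hprim _ P.isPrimitive_primPart)]
    exact hPx''
  refine Set.finite_univ_iff.mp ((Set.finite_iUnion fun u => ?_).subset hcover)
  classical
  exact (Multiset.toFinset _).finite_toSet.subset fun x hx => Multiset.mem_toFinset.mpr hx

open Polynomial in
theorem ValuationSubring.finite_residueField (p : ℕ) [Fact p.Prime] (k : Type*) [Field k]
    [Algebra (RatFunc (ZMod p)) k] [FiniteDimensional (RatFunc (ZMod p)) k]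
    (O : ValuationSubring k) (hO : O ≠ ⊤) :
    Finite (IsLocalRing.ResidueField O) := by
  let F := RatFunc (ZMod p)
  let j : (ZMod p)[X] →+* k := (algebraMap F k).comp (algebraMap (ZMod p)[X] F)
  have hj : Function.Injective j :=
    (algebraMap F k).injective.comp (IsFractionRing.injective (ZMod p)[X] F)
  have hN : ∀ x : k, ∃ P : (ZMod p)[X][X], P ≠ 0 ∧ P.natDegree ≤ Module.finrank F k ∧
      P.eval₂ j x = 0 := by
    intro x
    refine ⟨IsLocalization.integerNormalization (nonZeroDivisors (ZMod p)[X]) (minpoly F x),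
      ?_, ?_, ?_⟩
    · rw [Ne, IsFractionRing.integerNormalization_eq_zero_iff]
      exact minpoly.ne_zero (Algebra.IsIntegral.isIntegral x)
    · refine le_trans ?_ (minpoly.natDegree_le x)
      rw [natDegree_le_iff_coeff_eq_zero]
      intro n hn
      obtain ⟨b, -, hb⟩ := IsLocalization.integerNormalization_spec
        (nonZeroDivisors (ZMod p)[X]) (minpoly F x)
      apply IsFractionRing.injective (ZMod p)[X] F
      rw [← coeff_map, hb, coeff_smul, coeff_eq_zero_of_natDegree_lt hn, smul_zero, map_zero]
    · exact IsLocalization.integerNormalization_eval₂_eq_zero _ _ _ (minpoly.aeval F x)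
  by_cases hX : j X ∈ O
  · exact finite_residueField_of_mem j hj _ hN O hO hX
  · have hX0 : j X ≠ 0 := by rw [Ne, map_eq_zero_iff j hj]; exact X_ne_zero
    have hXu : (j X)⁻¹ ∈ O := (O.mem_or_inv_mem _).resolve_left hX
    let j' : (ZMod p)[X] →+* k := eval₂RingHom (j.comp C) (j X)⁻¹
    have hkey : ∀ (a : (ZMod p)[X]) (M : ℕ), a.natDegree ≤ M →
        j' (reflect M a) * j X ^ M = j a := by
      intro a M hM
      let := invertibleOfNonzero hX0
      have := eval₂_reflect_mul_pow (j.comp C) (j X) M a hM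
      rw [invOf_eq_inv] at this
      rw [coe_eval₂RingHom, this, ← hom_eval₂, eval₂_C_X]
    refine finite_residueField_of_mem j' ?_ (Module.finrank F k) ?_ O hO ?_
    · rw [injective_iff_map_eq_zero]
      intro a ha
      have := hkey (reflect a.natDegree a) a.natDegree (by
        simpa using natDegree_reflect_le (N := a.natDegree) (p := a))
      rw [reflect_reflect, ha, zero_mul, eq_comm, map_eq_zero_iff j hj] at this
      exact (reflect_eq_zero_iff).mp this
    · intro x
      obtain ⟨P, hP, hPN, hPx⟩ := hN x
      let M := P.support.sup fun i => (P.coeff i).natDegree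
      have hM : ∀ i, (P.coeff i).natDegree ≤ M := by
        intro i
        by_cases hi : i ∈ P.support
        · exact Finset.le_sup (f := fun i => (P.coeff i).natDegree) hi
        · rw [notMem_support_iff.mp hi, natDegree_zero]
          exact Nat.zero_le _
      let Q : (ZMod p)[X][X] :=
        ∑ i ∈ Finset.range (P.natDegree + 1), monomial i (reflect M (P.coeff i))
      have hQ : ∀ i ≤ P.natDegree, Q.coeff i = reflect M (P.coeff i) := by
        intro i hi
        simp only [Q, finsetSum_coeff, coeff_monomial]
        rw [Finset.sum_ite_eq', if_pos (Finset.mem_range.mpr (by omega))]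
      refine ⟨Q, ?_, ?_, ?_⟩
      · intro h0
        have := hQ _ le_rfl
        rw [h0, coeff_zero, eq_comm, reflect_eq_zero_iff] at this
        exact hP (leadingCoeff_eq_zero.mp this)
      · refine le_trans (natDegree_sum_le_of_forall_le _ _ fun i hi => ?_) hPN
        exact (natDegree_monomial_le _).trans (by rw [Finset.mem_range] at hi; omega)
      · have : Q.eval₂ j' x * j X ^ M = P.eval₂ j x := by
          rw [eval₂_finsetSum, Finset.sum_mul, eval₂_eq_sum_range]
          refine Finset.sum_congr rfl fun i _ => ?_
          rw [eval₂_monomial, mul_right_comm, hkey _ _ (hM i)]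
        rw [hPx] at this
        exact (mul_eq_zero.mp this).resolve_right (pow_ne_zero _ hX0)
    · simpa [j'] using hXu

/-- A nontrivial absolute value with values in `b ^ ℤ` is discrete. -/
theorem AbsoluteValue.isDiscrete_of_forall_exists_zpow {k : Type} [Field k]
    (v : AbsoluteValue k ℝ) (hna : v.IsNonarch) (b : ℝ) (hb : 1 < b)
    (hv : ∀ x, x ≠ 0 → ∃ n : ℤ, v x = b ^ n) (x₀ : k) (hx₀ : x₀ ≠ 0) (hvx₀ : v x₀ ≠ 1) :
    v.IsDiscrete := by
  have hb0 : b ≠ 0 := by positivity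
  have hbi : Function.Injective fun n : ℤ => b ^ n := zpow_right_injective₀ (by linarith) hb.ne'
  let A : AddSubgroup ℤ :=
    { carrier := {n | ∃ x, x ≠ 0 ∧ v x = b ^ n}
      zero_mem' := ⟨1, one_ne_zero, by simp⟩
      add_mem' := by
        rintro m n ⟨x, hx, hxm⟩ ⟨y, hy, hyn⟩
        exact ⟨x * y, mul_ne_zero hx hy, by rw [map_mul, hxm, hyn, zpow_add₀ hb0]⟩
      neg_mem' := by
        rintro n ⟨x, hx, hxn⟩
        exact ⟨x⁻¹, inv_ne_zero hx, by rw [map_inv₀, hxn, zpow_neg]⟩ }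
  obtain ⟨a, ha⟩ := Int.subgroup_cyclic A
  have hA : ∀ n, n ∈ A ↔ a ∣ n := by
    intro n
    rw [ha, ← AddSubgroup.zmultiples_eq_closure, Int.mem_zmultiples_iff]
  have ha0 : a ≠ 0 := by
    rintro rfl
    obtain ⟨n, hn⟩ := hv x₀ hx₀
    have : n = 0 := zero_dvd_iff.mp ((hA n).mp ⟨x₀, hx₀, hn⟩)
    rw [this, zpow_zero] at hn
    exact hvx₀ hn
  have hmem : -|a| ∈ A := (hA _).mpr ((dvd_neg.mpr ((dvd_abs a a).mpr dvd_rfl)))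
  refine ⟨hna, b ^ (-|a|), by positivity, ?_, ?_, ?_⟩
  · exact zpow_lt_one_of_neg₀ hb (by simpa using ha0)
  · obtain ⟨x, -, hx⟩ := hmem
    exact ⟨x, hx⟩
  · intro x hx
    obtain ⟨n, hn⟩ := hv x hx
    obtain ⟨m, hm⟩ : -|a| ∣ n := by
      rw [neg_dvd, abs_dvd]
      exact (hA n).mp ⟨x, hx, hn⟩
    exact ⟨m, by rw [hn, hm, zpow_mul]⟩

open Polynomial in
theorem AbsoluteValue.exists_isDiscrete (p : ℕ) [Fact p.Prime] (k : Type) [Field k] [CharP k p]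
    [Algebra (RatFunc (ZMod p)) k] [FiniteDimensional (RatFunc (ZMod p)) k] :
    ∃ v : AbsoluteValue k ℝ, v.IsDiscrete := by
  let F := RatFunc (ZMod p)
  let L := separableClosure F k
  let : Algebra (ZMod p)[X] L := ((algebraMap F L).comp (algebraMap (ZMod p)[X] F)).toAlgebra
  have : IsScalarTower (ZMod p)[X] F L := IsScalarTower.of_algebraMap_eq' rfl
  have : FunctionField (ZMod p) L := inferInstanceAs (FiniteDimensional F L)
  let B := FunctionField.ringOfIntegers (ZMod p) L
  have hB : ¬ IsField B := FunctionField.ringOfIntegers.not_isField (ZMod p) L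
  have : IsDedekindDomain B := inferInstance
  obtain ⟨M, hM⟩ := Ideal.exists_maximal B
  have hM0 : M ≠ ⊥ := Ring.ne_bot_of_isMaximal_of_not_isField hM hB
  let P : IsDedekindDomain.HeightOneSpectrum B := ⟨M, hM.isPrime, hM0⟩
  have hb : (1 : NNReal) < 2 := one_lt_two
  let u : AbsoluteValue L ℝ := P.adicAbv hb
  have hu : IsNonarchimedean u := P.isNonarchimedean_adicAbv hb
  have : IsPurelyInseparable L k := separableClosure.isPurelyInseparable F k
  have : FiniteDimensional L k := inferInstance
  have : CharP L p := (RingHom.charP_iff _ (algebraMap L k).injective p).mpr inferInstance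
  have : ExpChar L p := ExpChar.prime Fact.out
  have : IsPurelyInseparable.HasExponent L k := inferInstance
  let φ : k →+* L := IsPurelyInseparable.iterateFrobenius L k p le_rfl
  obtain ⟨a, ha, ha0⟩ := Submodule.exists_mem_ne_zero_of_ne_bot hM0
  have hua : u (algebraMap B L a) < 1 := (P.adicAbv_coe_lt_one_iff hb a).mpr ha
  let v : AbsoluteValue k ℝ := u.comp φ.injective
  have ha0' : algebraMap L k (algebraMap B L a) ≠ 0 := by
    rw [Ne, map_eq_zero_iff _ (algebraMap L k).injective,
      map_eq_zero_iff _ (IsFractionRing.injective B L)]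
    exact ha0
  refine ⟨v, v.isDiscrete_of_forall_exists_zpow (fun x y => ?_) 2 one_lt_two (fun x hx => ?_)
    _ ha0' ?_⟩
  · change u (φ (x + y)) ≤ max (u (φ x)) (u (φ y))
    rw [map_add]
    exact hu _ _
  · have hne : P.valuation L (φ x) ≠ 0 := by
      rw [Valuation.ne_zero_iff]
      exact (map_ne_zero_iff φ φ.injective).mpr hx
    refine ⟨(WithZero.unzero hne).toAdd, ?_⟩
    change ((WithZeroMulInt.toNNReal (ne_zero_of_lt hb) (P.valuation L (φ x)) : NNReal) : ℝ) = _
    rw [WithZeroMulInt.toNNReal_neg_apply _ hne]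
    simp
  · have h1 : algebraMap L k (φ (algebraMap L k (algebraMap B L a))) =
        algebraMap L k (algebraMap B L a ^ p ^ IsPurelyInseparable.exponent L k) := by
      rw [IsPurelyInseparable.algebraMap_iterateFrobenius, map_pow]
    have h2 := (algebraMap L k).injective h1
    change u (φ _) ≠ 1
    rw [h2, map_pow]
    refine (pow_lt_one₀ (apply_nonneg _ _) hua ?_).ne
    exact pow_ne_zero _ (Fact.out : p.Prime).ne_zero

/-- A homomorphism from a Galois group is smooth if it is trivial on the pointwise stabiliser of
some finite set. -/
def MonoidHom.IsSmooth {k Ω H : Type*} [Field k] [Field Ω] [Algebra k Ω] [Group H]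
    (ρ : (Ω ≃ₐ[k] Ω) →* H) : Prop :=
  ∃ T : Set Ω, T.Finite ∧ ∀ σ, (∀ x ∈ T, σ x = x) → ρ σ = 1

theorem apply_eq_of_map_eq {k Ω H : Type*} [Field k] [Field Ω] [Algebra k Ω] [Group H]
    {ρ : (Ω ≃ₐ[k] Ω) →* H} {x : Ω} (hx : ∀ τ, ρ τ = 1 → τ x = x) {σ τ : Ω ≃ₐ[k] Ω}
    (h : ρ σ = ρ τ) : σ x = τ x := by
  have := hx (τ⁻¹ * σ) (by rw [map_mul, map_inv, h, inv_mul_cancel])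
  calc σ x = τ ((τ⁻¹ * σ) x) := by rw [← AlgEquiv.mul_apply, mul_inv_cancel_left]
    _ = τ x := by rw [this]

theorem fixed_apply_of_fixed {k Ω H : Type*} [Field k] [Field Ω] [Algebra k Ω] [Group H]
    {ρ : (Ω ≃ₐ[k] Ω) →* H} {x : Ω} (hx : ∀ τ, ρ τ = 1 → τ x = x) (σ : Ω ≃ₐ[k] Ω) :
    ∀ τ, ρ τ = 1 → τ (σ x) = σ x := by
  intro τ hτ
  rw [← AlgEquiv.mul_apply]
  exact apply_eq_of_map_eq hx (by rw [map_mul, hτ, one_mul])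

section Smooth

variable {k Ω H : Type*} [Field k] [Field Ω] [Algebra k Ω] [IsGalois k Ω] [Group H]
  {ρ : (Ω ≃ₐ[k] Ω) →* H}

theorem MonoidHom.IsSmooth.isOpen_ker (h : ρ.IsSmooth) : IsOpen (ρ.ker : Set (Ω ≃ₐ[k] Ω)) := by
  obtain ⟨T, hT, hρ⟩ := h
  have : Finite T := hT
  let E := IntermediateField.adjoin k T
  have : FiniteDimensional k E := IntermediateField.finiteDimensional_adjoin
    fun x _ => Algebra.IsIntegral.isIntegral x
  refine Subgroup.isOpen_mono (H₁ := E.fixingSubgroup) (fun σ hσ => ?_) E.fixingSubgroup_isOpen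
  exact hρ σ fun x hx => hσ ⟨x, IntermediateField.subset_adjoin k T hx⟩

theorem MonoidHom.IsSmooth.fixingSubgroup_fixedField_ker (h : ρ.IsSmooth) :
    (IntermediateField.fixedField ρ.ker).fixingSubgroup = ρ.ker :=
  InfiniteGalois.fixingSubgroup_fixedField
    ⟨ρ.ker, Subgroup.isClosed_of_isOpen _ h.isOpen_ker⟩

theorem MonoidHom.IsSmooth.finiteDimensional_and_isGalois (h : ρ.IsSmooth) :
    FiniteDimensional k (IntermediateField.fixedField ρ.ker) ∧
      IsGalois k (IntermediateField.fixedField ρ.ker) := by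
  rw [← InfiniteGalois.isOpen_and_normal_iff_finite_and_isGalois, h.fixingSubgroup_fixedField_ker]
  exact ⟨h.isOpen_ker, inferInstance⟩

theorem MonoidHom.IsSmooth.map_eq_one (h : ρ.IsSmooth) (σ : Ω ≃ₐ[k] Ω)
    (hσ : ∀ x, (∀ τ, ρ τ = 1 → τ x = x) → σ x = x) : ρ σ = 1 := by
  rw [← MonoidHom.mem_ker, ← h.fixingSubgroup_fixedField_ker]
  rintro ⟨x, hx⟩
  exact hσ x fun τ hτ => hx ⟨τ, hτ⟩

/-- An element whose conjugates under the image of a smooth homomorphism sum to one. -/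
theorem MonoidHom.IsSmooth.exists_sum_eq_one [Fintype H] (h : ρ.IsSmooth) (r : H → (Ω ≃ₐ[k] Ω))
    (hr : ∀ q, ρ (r q) = q) :
    ∃ θ : Ω, (∀ τ, ρ τ = 1 → τ θ = θ) ∧ ∑ q, r q θ = 1 := by
  obtain ⟨y, hy, hs⟩ : ∃ y : Ω, (∀ τ, ρ τ = 1 → τ y = y) ∧ ∑ q, r q y ≠ 0 := by
    by_contra! hcon
    let F := IntermediateField.fixedField ρ.ker
    let χ : H → (F →* Ω) := fun q => ((r q : Ω →+* Ω).comp (algebraMap F Ω) : F →* Ω)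
    have hχ : Function.Injective χ := by
      intro q q' hqq
      have : ρ ((r q)⁻¹ * r q') = 1 := by
        refine h.map_eq_one _ fun x hx => ?_
        have h1 : r q x = r q' x :=
          DFunLike.congr_fun hqq (⟨x, fun τ => hx τ τ.2⟩ : F)
        rw [AlgEquiv.mul_apply, ← h1, ← AlgEquiv.mul_apply, inv_mul_cancel, AlgEquiv.one_apply]
      rw [map_mul, map_inv, hr, hr, inv_mul_eq_one] at this
      exact this
    have hli := (linearIndependent_monoidHom F Ω).comp χ hχ
    have := Fintype.linearIndependent_iff.mp hli (fun _ => 1) (by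
      ext x
      simpa [χ] using hcon x fun τ hτ => x.2 ⟨τ, hτ⟩) 1
    exact one_ne_zero this
  obtain ⟨a, ha⟩ : ∑ q, r q y ∈ Set.range (algebraMap k Ω) := by
    rw [InfiniteGalois.mem_range_algebraMap_iff_fixed]
    intro σ
    rw [map_sum]
    refine (Finset.sum_congr rfl fun q _ => ?_).trans (Equiv.sum_comp (Equiv.mulLeft (ρ σ)) _)
    rw [← AlgEquiv.mul_apply]
    exact apply_eq_of_map_eq hy (by simp [hr])
  have ha0 : a ≠ 0 := by
    rintro rfl
    rw [map_zero] at ha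
    exact hs ha.symm
  refine ⟨algebraMap k Ω a⁻¹ * y, fun τ hτ => by rw [map_mul, hy τ hτ, AlgEquiv.commutes], ?_⟩
  simp only [map_mul, AlgEquiv.commutes]
  rw [← Finset.mul_sum, ← ha, ← map_mul, inv_mul_cancel₀ ha0, map_one]

end Smooth

section ArtinSchreier

variable {F : Type*} [Field F] {p : ℕ} [Fact p.Prime] [CharP F p]

open Polynomial in
theorem IsSepClosed.exists_pow_sub_self_eq [IsSepClosed F] (x : F) : ∃ y : F, y ^ p - y = x := by
  have hp : 1 < p := (Fact.out : p.Prime).one_lt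
  have hdeg : (X ^ p - X - C x : F[X]).degree = p := by
    rw [sub_sub]
    have : (X + C x : F[X]).degree < (X ^ p : F[X]).degree := by
      rw [degree_X_add_C, degree_X_pow]
      exact_mod_cast hp
    rw [degree_sub_eq_left_of_degree_lt this, degree_X_pow]
  obtain ⟨y, hy⟩ := IsSepClosed.exists_root (X ^ p - X - C x : F[X])
    (by rw [hdeg]; exact_mod_cast (Fact.out : p.Prime).ne_zero)
    (by
      rw [separable_def]
      have : derivative (X ^ p - X - C x : F[X]) = -1 := by
        simp [derivative_X_pow]
      rw [this]
      exact isCoprime_one_right.neg_right)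
  refine ⟨y, ?_⟩
  simpa [IsRoot.def, sub_eq_zero] using hy

theorem exists_algebraMap_eq_of_pow_eq_self [Algebra (ZMod p) F] {x : F} (hx : x ^ p = x) :
    ∃ n : ZMod p, algebraMap (ZMod p) F n = x := by
  have h := (Subfield.mem_bot_iff_pow_eq_self F p).mpr hx
  have : (⊥ : Subfield F) ≤ (algebraMap (ZMod p) F).fieldRange := bot_le
  exact this h

end ArtinSchreier

/-- The second cohomology of an absolute Galois group in characteristic `p` with coefficients in
a finite elementary abelian `p`-group vanishes. -/
theorem MonoidHom.IsSmooth.exists_cochain_of_cocycle {p : ℕ} [Fact p.Prime] {k Ω Q V : Type*}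
    [Field k] [Field Ω] [Algebra k Ω] [IsGalois k Ω] [IsSepClosed Ω] [CharP Ω p] [Group Q]
    [Finite Q] {ρ : (Ω ≃ₐ[k] Ω) →* Q} (h : ρ.IsSmooth) (hρ : Function.Surjective ρ)
    [AddCommGroup V] [Module (ZMod p) V] [Finite V] (act : Q →* Module.End (ZMod p) V)
    (c : Q → Q → V) (hc : ∀ q r s, c q r + c (q * r) s = act q (c r s) + c q (r * s)) :
    ∃ a : (Ω ≃ₐ[k] Ω) → V,
      (∀ σ τ, c (ρ σ) (ρ τ) = act (ρ σ) (a τ) - a (σ * τ) + a σ) ∧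
      ∃ T : Set Ω, T.Finite ∧ ∀ σ, ρ σ = 1 → (∀ x ∈ T, σ x = x) → a σ = a 1 := by
  classical
  have := Fintype.ofFinite Q
  let : Algebra (ZMod p) Ω := ZMod.algebra Ω p
  let D := Module.Dual (ZMod p) V
  have : Finite D := Module.finite_of_finite (ZMod p)
  choose r hr using hρ
  obtain ⟨θ, hθ, hsum⟩ := h.exists_sum_eq_one r hr
  -- translates of the sum of conjugates
  have hsum' : ∀ σ : Ω ≃ₐ[k] Ω, ∑ q, σ (r q θ) = 1 := fun σ => by rw [← map_sum, hsum, map_one]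
  have hrθ : ∀ (σ : Ω ≃ₐ[k] Ω) q, σ (r q θ) = r (ρ σ * q) θ := by
    intro σ q
    rw [← AlgEquiv.mul_apply]
    exact apply_eq_of_map_eq hθ (by simp [hr])
  have hlin : ∀ (σ : Ω ≃ₐ[k] Ω) (n : ZMod p) (x : Ω), σ (n • x) = n • σ x := by
    intro σ n x
    exact map_smul (AddMonoidHom.toZModLinearMap p ((σ : Ω →+* Ω) : Ω →+ Ω)) n x
  -- the Artin-Schreier operator
  let f : Ω →ₗ[ZMod p] Ω :=
    AddMonoidHom.toZModLinearMap p ((frobenius Ω p).toAddMonoidHom - AddMonoidHom.id Ω)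
  have hf : ∀ x, f x = x ^ p - x := fun x => rfl
  have hfσ : ∀ (σ : Ω ≃ₐ[k] Ω) x, σ (f x) = f (σ x) := by
    intro σ x
    rw [hf, hf, map_sub, map_pow]
  obtain ⟨g, hg⟩ := f.exists_rightInverse_of_surjective
    (LinearMap.range_eq_top.mpr fun x => by
      obtain ⟨y, hy⟩ := IsSepClosed.exists_pow_sub_self_eq (p := p) x
      exact ⟨y, by rw [hf, hy]⟩)
  have hfg : ∀ x, f (g x) = x := fun x => LinearMap.congr_fun hg x
  have hfalg : ∀ n : ZMod p, f (n • (1 : Ω)) = 0 := by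
    intro n
    rw [map_smul, hf, one_pow, sub_self, smul_zero]
  -- the cochain with values in the coinduced module
  let b : (Ω ≃ₐ[k] Ω) → D →ₗ[ZMod p] Ω := fun σ =>
    ∑ q, (LinearMap.toSpanSingleton (ZMod p) Ω (σ (r q θ))).comp
      (Module.Dual.eval (ZMod p) V (c (ρ σ) q))
  have hb : ∀ (σ : Ω ≃ₐ[k] Ω) χ, b σ χ = ∑ q, χ (c (ρ σ) q) • σ (r q θ) := by
    intro σ χ
    simp only [b, LinearMap.sum_apply]
    rfl
  have hbc : ∀ σ τ χ, σ (b τ (χ.comp (act (ρ σ)))) - b (σ * τ) χ + b σ χ =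
      χ (c (ρ σ) (ρ τ)) • (1 : Ω) := by
    intro σ τ χ
    have h3 : b σ χ = ∑ q, χ (c (ρ σ) (ρ τ * q)) • (σ * τ) (r q θ) := by
      rw [hb, ← Equiv.sum_comp (Equiv.mulLeft (ρ τ))]
      refine Finset.sum_congr rfl fun q _ => ?_
      rw [Equiv.coe_mulLeft, AlgEquiv.mul_apply, hrθ τ]
    rw [h3, hb, hb, map_sum, ← Finset.sum_sub_distrib, ← Finset.sum_add_distrib,
      ← hsum' (σ * τ), Finset.smul_sum]
    refine Finset.sum_congr rfl fun q _ => ?_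
    rw [hlin, ← AlgEquiv.mul_apply, ← sub_smul, ← add_smul, LinearMap.comp_apply, map_mul]
    congr 1
    have := congrArg χ (hc (ρ σ) (ρ τ) q)
    rw [map_add, map_add] at this
    linear_combination -this
  have hb1 : ∀ σ, ρ σ = 1 → b σ = b 1 := by
    intro σ hσ
    ext χ
    rw [hb, hb, hσ, map_one]
    refine Finset.sum_congr rfl fun q _ => ?_
    rw [hrθ, hσ, one_mul, AlgEquiv.one_apply]
  -- a primitive for the coboundary of the Artin-Schreier transform
  let x : D →ₗ[ZMod p] Ω :=
    ∑ q, (LinearMap.mulRight (ZMod p) (r q θ)).comp (f.comp (b (r q)))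
  have hx : ∀ χ, x χ = ∑ q, f (b (r q) χ) * r q θ := by
    intro χ
    simp [x, LinearMap.sum_apply]
  let y : D →ₗ[ZMod p] Ω := g.comp x
  have hd : ∀ σ τ χ, σ (f (b τ (χ.comp (act (ρ σ))))) = f (b (σ * τ) χ) - f (b σ χ) := by
    intro σ τ χ
    have := congrArg f (hbc σ τ χ)
    rw [hfalg, map_add, map_sub] at this
    rw [hfσ]
    linear_combination this
  have hbρ : ∀ σ τ, ρ σ = ρ τ → b σ = b τ := by
    intro σ τ hστ
    ext χ
    rw [hb, hb, hστ]
    refine Finset.sum_congr rfl fun q _ => ?_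
    rw [hrθ, hrθ, hστ]
  have hdx : ∀ σ χ, σ (x (χ.comp (act (ρ σ)))) = x χ - f (b σ χ) := by
    intro σ χ
    rw [hx, map_sum]
    have h1 : ∀ q, σ (f (b (r q) (χ.comp (act (ρ σ)))) * r q θ) =
        f (b (r (ρ σ * q)) χ) * r (ρ σ * q) θ - f (b σ χ) * r (ρ σ * q) θ := by
      intro q
      rw [map_mul, hd, hrθ, hbρ (σ * r q) (r (ρ σ * q)) (by simp [hr])]
      ring
    simp only [h1]
    have h2 := Equiv.sum_comp (Equiv.mulLeft (ρ σ)) (fun q => f (b (r q) χ) * r q θ)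
    have h3 := Equiv.sum_comp (Equiv.mulLeft (ρ σ)) (fun q => r q θ)
    simp only [Equiv.coe_mulLeft] at h2 h3
    rw [Finset.sum_sub_distrib, ← Finset.mul_sum, h2, h3, ← hx, hsum, mul_one]
  -- the corrected cochain takes values in `V`
  have hval : ∀ σ, ∃ a : V, ∀ χ : D,
      χ a • (1 : Ω) = b σ χ - y χ + σ (y (χ.comp (act (ρ σ)))) := by
    intro σ
    let m : D →ₗ[ZMod p] Ω := b σ - y + AddMonoidHom.toZModLinearMap p
      { toFun := fun χ => σ (y (χ.comp (act (ρ σ))))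
        map_zero' := by simp
        map_add' := fun χ ψ => by rw [LinearMap.add_comp, map_add, map_add] }
    have hm : ∀ χ, m χ = b σ χ - y χ + σ (y (χ.comp (act (ρ σ)))) := fun χ => rfl
    have hfm : ∀ χ, f (m χ) = 0 := by
      intro χ
      have : ∀ χ, f (y χ) = x χ := fun χ => hfg _
      rw [hm, map_add, map_sub, ← hfσ, this, this, hdx]
      ring
    have hm' : ∀ χ, ∃ n : ZMod p, n • (1 : Ω) = m χ := by
      intro χ
      obtain ⟨n, hn⟩ := exists_algebraMap_eq_of_pow_eq_self (p := p) (x := m χ)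
        (sub_eq_zero.mp (hfm χ))
      exact ⟨n, by rw [← hn, Algebra.algebraMap_eq_smul_one]⟩
    choose n hn using hm'
    have hinj : Function.Injective fun n : ZMod p => n • (1 : Ω) :=
      smul_left_injective _ one_ne_zero
    let n' : D →ₗ[ZMod p] ZMod p :=
      { toFun := n
        map_add' := fun χ ψ => hinj (by simp only [add_smul, hn, map_add])
        map_smul' := fun t χ => hinj (by simp only [smul_eq_mul, mul_smul, hn, map_smul,
          RingHom.id_apply]) }
    obtain ⟨a, ha⟩ := (Module.evalEquiv (ZMod p) V).surjective n'
    refine ⟨a, fun χ => ?_⟩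
    rw [← hm, ← hn]
    have : χ a = n χ := LinearMap.congr_fun ha χ
    rw [this]
  choose a ha using hval
  have hV : ∀ v w : V, (∀ χ : D, χ v • (1 : Ω) = χ w • (1 : Ω)) → v = w := by
    intro v w hvw
    apply (Module.evalEquiv (ZMod p) V).injective
    ext χ
    exact smul_left_injective (ZMod p) (one_ne_zero : (1 : Ω) ≠ 0) (hvw χ)
  refine ⟨a, fun σ τ => hV _ _ fun χ => ?_, Set.range y, Set.finite_range y, fun σ hσ hfix =>
    hV _ _ fun χ => ?_⟩
  · have h1 := congrArg σ (ha τ (χ.comp (act (ρ σ))))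
    rw [LinearMap.comp_apply, hlin, map_one, map_add, map_sub, ← AlgEquiv.mul_apply] at h1
    have h2 := ha (σ * τ) χ
    have h3 := ha σ χ
    have h4 : (χ.comp (act (ρ σ))).comp (act (ρ τ)) = χ.comp (act (ρ (σ * τ))) := by
      rw [map_mul, map_mul]
      rfl
    rw [h4] at h1
    rw [← hbc σ τ χ, map_add, map_sub, add_smul, sub_smul, h1, h2, h3]
    ring
  · rw [ha, ha, hb1 σ hσ, hσ, hfix _ ⟨_, rfl⟩, map_one ρ, AlgEquiv.one_apply]

section Lifting

variable {p : ℕ} [Fact p.Prime] {k Ω : Type*} [Field k] [Field Ω] [Algebra k Ω] [IsGalois k Ω]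
  [IsSepClosed Ω] [CharP Ω p]

/-- Smooth homomorphisms lift along extensions whose kernel is the image of an elementary abelian
group. -/
theorem MonoidHom.IsSmooth.exists_lift_of_ker_eq_range {Γ Γ' V : Type*} [Group Γ] [Group Γ']
    [Finite Γ] [AddCommGroup V] [Module (ZMod p) V] (π : Γ →* Γ') (hπ : Function.Surjective π)
    (j : V → Γ) (hj : Function.Injective j) (hadd : ∀ v w, j (v + w) = j v * j w)
    (hker : ∀ γ, π γ = 1 ↔ ∃ v, j v = γ) {ρ : (Ω ≃ₐ[k] Ω) →* Γ'} (h : ρ.IsSmooth) :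
    ∃ ρ' : (Ω ≃ₐ[k] Ω) →* Γ, ρ'.IsSmooth ∧ π.comp ρ' = ρ := by
  have : Finite Γ' := Finite.of_surjective π hπ
  have : Finite V := Finite.of_injective j hj
  choose s hs using hπ
  have hrr : ρ.rangeRestrict.IsSmooth := by
    obtain ⟨T, hT, hρ⟩ := h
    exact ⟨T, hT, fun σ hσ => Subtype.ext (hρ σ hσ)⟩
  have hj0 : j 0 = 1 := by
    have := hadd 0 0
    rwa [add_zero, left_eq_mul] at this
  have hneg : ∀ v, j (-v) = (j v)⁻¹ := fun v => by
    rw [eq_inv_iff_mul_eq_one, ← hadd, neg_add_cancel, hj0]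
  have hcomm : ∀ v w, j v * j w = j w * j v := fun v w => by rw [← hadd, ← hadd, add_comm]
  have hπj : ∀ v, π (j v) = 1 := fun v => (hker _).mpr ⟨v, rfl⟩
  have hex : ∀ γ v, ∃ w, j w = γ * j v * γ⁻¹ := fun γ v => (hker _).mp (by
    rw [map_mul, map_mul, hπj, map_inv, mul_one, mul_inv_cancel])
  choose conj₀ hconj₀ using hex
  let conj : Γ → V →ₗ[ZMod p] V := fun γ => AddMonoidHom.toZModLinearMap p
    (AddMonoidHom.mk' (conj₀ γ) fun v w => hj (by rw [hadd, hconj₀, hconj₀, hconj₀, hadd]; group))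
  have hconj : ∀ γ v, j (conj γ v) = γ * j v * γ⁻¹ := hconj₀
  have hconj_eq : ∀ γ δ, π γ = π δ → conj γ = conj δ := by
    intro γ δ hγδ
    ext v
    apply hj
    rw [hconj, hconj]
    obtain ⟨u, hu⟩ := (hker (δ⁻¹ * γ)).mp (by rw [map_mul, map_inv, hγδ, inv_mul_cancel])
    have hγ : γ = δ * j u := by rw [hu, mul_inv_cancel_left]
    rw [hγ, mul_assoc δ, hcomm]
    group
  let act : ρ.range →* Module.End (ZMod p) V :=
    { toFun := fun q => conj (s q)
      map_one' := by
        rw [hconj_eq _ 1 (by rw [hs, map_one]; rfl)]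
        ext v
        apply hj
        rw [hconj, Module.End.one_apply]
        group
      map_mul' := fun q r => by
        rw [hconj_eq _ (s q * s r) (by rw [map_mul, hs, hs, hs]; rfl)]
        ext v
        apply hj
        rw [hconj, Module.End.mul_apply, hconj, hconj]
        group }
  have hcex : ∀ q r : Γ', ∃ v, j v = s q * s r * (s (q * r))⁻¹ := fun q r => (hker _).mp (by
    rw [map_mul, map_mul, map_inv, hs, hs, hs, mul_inv_cancel])
  choose c hc using hcex
  obtain ⟨a, ha, T, hT, haT⟩ := hrr.exists_cochain_of_cocycle ρ.rangeRestrict_surjective act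
    (fun q r => c q r) (by
      intro q r t
      apply hj
      change _ = j (conj (s q) _ + _)
      rw [hadd, hadd, hconj, hc, hc, hc, hc, Subgroup.coe_mul, Subgroup.coe_mul,
        mul_assoc (q : Γ')]
      group)
  have ha' : ∀ σ τ, s (ρ σ * ρ τ) = j (a (σ * τ)) * (j (a σ))⁻¹ *
      (s (ρ σ) * (j (a τ))⁻¹ * (s (ρ σ))⁻¹) * (s (ρ σ) * s (ρ τ)) := by
    intro σ τ
    have h1 : c (ρ σ) (ρ τ) = conj (s (ρ σ)) (a τ) - a (σ * τ) + a σ := ha σ τ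
    have h2 : -c (ρ σ) (ρ τ) = a (σ * τ) + -a σ + -conj (s (ρ σ)) (a τ) := by rw [h1]; abel
    have h3 := congrArg j h2
    rw [hadd, hadd, hneg, hneg, hneg, hconj, hc] at h3
    calc s (ρ σ * ρ τ) = (s (ρ σ) * s (ρ τ) * (s (ρ σ * ρ τ))⁻¹)⁻¹ * (s (ρ σ) * s (ρ τ)) := by group
      _ = _ := by rw [h3]; group
  let ρ' : (Ω ≃ₐ[k] Ω) →* Γ := MonoidHom.mk' (fun σ => (j (a σ))⁻¹ * s (ρ σ)) (by
    intro σ τ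
    rw [map_mul, ha']
    group)
  refine ⟨ρ', ?_, ?_⟩
  · obtain ⟨T', hT', hρ⟩ := h
    refine ⟨T ∪ T', hT.union hT', fun σ hσ => ?_⟩
    have h1 : ρ σ = 1 := hρ σ fun x hx => hσ x (Or.inr hx)
    have h2 : a σ = a 1 := haT σ (Subtype.ext h1) fun x hx => hσ x (Or.inl hx)
    rw [← map_one ρ']
    change (j (a σ))⁻¹ * s (ρ σ) = (j (a 1))⁻¹ * s (ρ 1)
    rw [h1, h2, map_one]
  · ext σ
    change π ((j (a σ))⁻¹ * s (ρ σ)) = _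
    rw [map_mul, map_inv, hπj, hs, inv_one, one_mul]

/-- Smooth homomorphisms lift along extensions with elementary abelian kernel. -/
theorem MonoidHom.IsSmooth.exists_lift_of_elementary {Γ Γ' : Type*} [Group Γ] [Group Γ'] [Finite Γ]
    (π : Γ →* Γ') (hπ : Function.Surjective π) (hcomm : ∀ a ∈ π.ker, ∀ b ∈ π.ker, a * b = b * a)
    (hexp : ∀ a ∈ π.ker, a ^ p = 1) {ρ : (Ω ≃ₐ[k] Ω) →* Γ'} (h : ρ.IsSmooth) :
    ∃ ρ' : (Ω ≃ₐ[k] Ω) →* Γ, ρ'.IsSmooth ∧ π.comp ρ' = ρ := by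
  let : CommGroup π.ker :=
    { mul_comm := fun a b => Subtype.ext (hcomm a a.2 b b.2) }
  let : Module (ZMod p) (Additive π.ker) := AddCommGroup.zmodModule fun x =>
    Subtype.ext (hexp _ (Additive.toMul x).2)
  exact h.exists_lift_of_ker_eq_range (V := Additive π.ker) π hπ
    (fun v => ((Additive.toMul v : π.ker) : Γ)) (fun v w hvw => Subtype.ext hvw) (fun v w => rfl)
    (fun γ => ⟨fun hγ => ⟨Additive.ofMul ⟨γ, hγ⟩, rfl⟩, fun ⟨v, hv⟩ => hv ▸ (Additive.toMul v).2⟩)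

/-- Smooth homomorphisms from absolute Galois groups in characteristic `p` lift along extensions
of finite groups whose kernel is a `p`-group. -/
theorem MonoidHom.IsSmooth.exists_lift {Γ Γ' : Type*} [Group Γ] [Group Γ'] [Finite Γ]
    (π : Γ →* Γ') (hπ : Function.Surjective π) (hker : IsPGroup p π.ker)
    {ρ : (Ω ≃ₐ[k] Ω) →* Γ'} (h : ρ.IsSmooth) :
    ∃ ρ' : (Ω ≃ₐ[k] Ω) →* Γ, ρ'.IsSmooth ∧ π.comp ρ' = ρ := by
  induction hn : Nat.card Γ using Nat.strong_induction_on generalizing Γ with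
  | _ n ih =>
  by_cases hbot : π.ker = ⊥
  · let e := MulEquiv.ofBijective π ⟨(MonoidHom.ker_eq_bot_iff π).mp hbot, hπ⟩
    refine ⟨e.symm.toMonoidHom.comp ρ, ?_, ?_⟩
    · obtain ⟨T, hT, hρ⟩ := h
      exact ⟨T, hT, fun σ hσ => by rw [MonoidHom.comp_apply, hρ σ hσ, map_one]⟩
    · ext σ
      exact e.apply_symm_apply (ρ σ)
  let A : Subgroup Γ :=
    { carrier := {a | a ∈ π.ker ∧ (∀ b ∈ π.ker, a * b = b * a) ∧ a ^ p = 1}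
      one_mem' := ⟨one_mem _, fun b _ => by rw [one_mul, mul_one], one_pow _⟩
      mul_mem' := by
        rintro a b ⟨ha, ha', hap⟩ ⟨hb, hb', hbp⟩
        refine ⟨mul_mem ha hb, fun c hc => ?_, ?_⟩
        · rw [mul_assoc, hb' c hc, ← mul_assoc, ha' c hc, mul_assoc]
        · rw [(show Commute a b from ha' b hb).mul_pow, hap, hbp, one_mul]
      inv_mem' := by
        rintro a ⟨ha, ha', hap⟩
        refine ⟨inv_mem ha, fun c hc => ?_, by rw [inv_pow, hap, inv_one]⟩
        exact ((show Commute a c from ha' c hc).inv_left).eq }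
  have hA : A.Normal := by
    refine ⟨?_⟩
    rintro a ⟨ha, ha', hap⟩ g
    have hN : π.ker.Normal := inferInstance
    refine ⟨hN.conj_mem _ ha _, fun b hb => ?_, by rw [conj_pow, hap, mul_one, mul_inv_cancel]⟩
    have := ha' (g⁻¹ * b * g) (by simpa using hN.conj_mem _ hb g⁻¹)
    calc g * a * g⁻¹ * b = g * (a * (g⁻¹ * b * g)) * g⁻¹ := by group
      _ = b * (g * a * g⁻¹) := by rw [this]; group
  have hAker : A ≤ π.ker := fun a ha => ha.1
  have hA1 : A ≠ ⊥ := by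
    have : Nontrivial π.ker := (Subgroup.nontrivial_iff_ne_bot _).mpr hbot
    have := hker.center_nontrivial
    have hd : p ∣ Nat.card (Subgroup.center π.ker) :=
      (hker.to_subgroup _).card_eq_or_dvd.resolve_left Finite.one_lt_card.ne'
    obtain ⟨z, hz⟩ := exists_prime_orderOf_dvd_card' p hd
    intro h0
    have hzA : ((z : π.ker) : Γ) ∈ A := by
      refine ⟨(z : π.ker).2, fun b hb => ?_, ?_⟩
      · exact congrArg Subtype.val ((Subgroup.mem_center_iff.mp z.2 ⟨b, hb⟩).symm)
      · rw [← hz]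
        exact congrArg (fun x : Subgroup.center π.ker => ((x : π.ker) : Γ)) (pow_orderOf_eq_one z)
    rw [h0, Subgroup.mem_bot] at hzA
    have : z = 1 := Subtype.ext (Subtype.ext hzA)
    rw [this, orderOf_one] at hz
    exact (Fact.out : p.Prime).one_lt.ne hz
  let π' : Γ ⧸ A →* Γ' := QuotientGroup.lift A π hAker
  have hcard : Nat.card (Γ ⧸ A) < n := by
    rw [← hn, Subgroup.card_eq_card_quotient_mul_card_subgroup A]
    have : 1 < Nat.card A := (Subgroup.one_lt_card_iff_ne_bot A).mpr hA1
    exact lt_mul_of_one_lt_right Nat.card_pos this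
  obtain ⟨ρ₁, hρ₁, hρ₁'⟩ := ih _ hcard π' (QuotientGroup.lift_surjective_of_surjective A π hπ hAker)
    (by
      rintro ⟨x, hx⟩
      obtain ⟨g, rfl⟩ := QuotientGroup.mk_surjective x
      obtain ⟨m, hm⟩ := hker ⟨g, hx⟩
      refine ⟨m, Subtype.ext ?_⟩
      have : g ^ p ^ m = 1 := congrArg Subtype.val hm
      change (g : Γ ⧸ A) ^ p ^ m = 1
      rw [← QuotientGroup.mk_pow, this, QuotientGroup.mk_one]) rfl
  have hkerA : ∀ a ∈ (QuotientGroup.mk' A).ker, a ∈ A := fun a ha => by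
    rwa [QuotientGroup.ker_mk'] at ha
  obtain ⟨ρ₂, hρ₂, hρ₂'⟩ := hρ₁.exists_lift_of_elementary (p := p) (QuotientGroup.mk' A)
    (QuotientGroup.mk'_surjective A)
    (fun a ha b hb => (hkerA a ha).2.1 b (hAker (hkerA b hb))) (fun a ha => (hkerA a ha).2.2)
  refine ⟨ρ₂, hρ₂, ?_⟩
  rw [← hρ₁', ← hρ₂', ← MonoidHom.comp_assoc]
  rfl

end Lifting

section ValuationRing

variable {k Ω : Type*} [Field k] [Field Ω] [Algebra k Ω]

/-- The valuation ring of a nonarchimedean absolute value. -/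
def AbsoluteValue.valuationRing (v : AbsoluteValue k ℝ) (hv : IsNonarchimedean v) :
    ValuationSubring k where
  carrier := {x | v x ≤ 1}
  mul_mem' {a b} ha hb := by
    rw [Set.mem_ofPred_eq, map_mul]
    exact mul_le_one₀ ha (v.nonneg b) hb
  one_mem' := by simp
  add_mem' {a b} ha hb := (hv a b).trans (max_le ha hb)
  zero_mem' := by simp
  neg_mem' {a} ha := by rwa [Set.mem_ofPred_eq, map_neg_eq_map]
  mem_or_inv_mem' x := by
    rw [Set.mem_ofPred_eq, Set.mem_ofPred_eq, map_inv₀]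
    by_contra! h
    exact absurd (inv_lt_one_of_one_lt₀ h.1) h.2.le.not_gt

theorem AbsoluteValue.mem_valuationRing {v : AbsoluteValue k ℝ} (hv : IsNonarchimedean v) {x : k} :
    x ∈ v.valuationRing hv ↔ v x ≤ 1 := Iff.rfl

theorem AbsoluteValue.isUnit_valuationRing_iff {v : AbsoluteValue k ℝ} (hv : IsNonarchimedean v)
    (x : v.valuationRing hv) : IsUnit x ↔ v x = 1 := by
  constructor
  · rintro ⟨u, rfl⟩
    refine le_antisymm u.1.2 ?_
    have h1 : v ((u : v.valuationRing hv) : k) * v ((↑u⁻¹ : v.valuationRing hv) : k) = 1 := by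
      rw [← map_mul]
      have := congrArg Subtype.val u.mul_inv
      exact (congrArg v this).trans (map_one v)
    rw [← h1]
    exact mul_le_of_le_one_right (v.nonneg _) (↑u⁻¹ : v.valuationRing hv).2
  · intro h
    have h0 : (x : k) ≠ 0 := fun h0 => by simp [h0] at h
    exact IsUnit.of_mul_eq_one ⟨(x : k)⁻¹, by
      rw [AbsoluteValue.mem_valuationRing, map_inv₀, h, inv_one]⟩
      (Subtype.ext (mul_inv_cancel₀ h0))

theorem AbsoluteValue.residue_eq_zero_iff {v : AbsoluteValue k ℝ} (hv : IsNonarchimedean v)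
    (x : v.valuationRing hv) :
    IsLocalRing.residue (v.valuationRing hv) x = 0 ↔ v x < 1 := by
  rw [← not_iff_not, ← ne_eq, IsLocalRing.residue_ne_zero_iff_isUnit,
    AbsoluteValue.isUnit_valuationRing_iff, not_lt]
  exact ⟨fun h => h.ge, fun h => le_antisymm x.2 h⟩

theorem AbsoluteValue.valuationRing_ne_top {v : AbsoluteValue k ℝ} (hv : IsNonarchimedean v)
    (hnt : v.IsNontrivial) : v.valuationRing hv ≠ ⊤ := by
  obtain ⟨x, hx, hx1⟩ := hnt
  intro h
  have h1 : v x ≤ 1 := by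
    rw [← AbsoluteValue.mem_valuationRing hv, h]; trivial
  have h2 : v x⁻¹ ≤ 1 := by
    rw [← AbsoluteValue.mem_valuationRing hv, h]; trivial
  rw [map_inv₀] at h2
  exact hx1 (le_antisymm h1 ((inv_le_one₀ (v.pos hx)).mp h2))

/-- The inclusion of valuation rings attached to an extension of absolute values. -/
def AbsoluteValue.valuationRingMap {v : AbsoluteValue k ℝ} (hv : IsNonarchimedean v)
    {w : AbsoluteValue Ω ℝ} (hw : IsNonarchimedean w) (h : ∀ a, w (algebraMap k Ω a) = v a) :
    v.valuationRing hv →+* w.valuationRing hw :=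
  ((algebraMap k Ω).comp (v.valuationRing hv).subtype).codRestrict _ fun x => by
    change w (algebraMap k Ω x) ≤ 1
    rw [h]; exact x.2

theorem AbsoluteValue.coe_valuationRingMap {v : AbsoluteValue k ℝ} (hv : IsNonarchimedean v)
    {w : AbsoluteValue Ω ℝ} (hw : IsNonarchimedean w) (h : ∀ a, w (algebraMap k Ω a) = v a)
    (x : v.valuationRing hv) :
    (AbsoluteValue.valuationRingMap hv hw h x : Ω) = algebraMap k Ω x := rfl

theorem AbsoluteValue.isLocalHom_valuationRingMap {v : AbsoluteValue k ℝ}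
    (hv : IsNonarchimedean v) {w : AbsoluteValue Ω ℝ} (hw : IsNonarchimedean w)
    (h : ∀ a, w (algebraMap k Ω a) = v a) :
    IsLocalHom (AbsoluteValue.valuationRingMap hv hw h) where
  map_nonunit x hx := by
    rw [AbsoluteValue.isUnit_valuationRing_iff] at hx ⊢
    rwa [AbsoluteValue.coe_valuationRingMap, h] at hx

/-- A ring homomorphism of `𝔽_p`-algebras is `𝔽_p`-linear. -/
def RingHom.toZModAlgHom (p : ℕ) {A B : Type*} [CommRing A] [CommRing B] [Algebra (ZMod p) A]
    [Algebra (ZMod p) B] (f : A →+* B) : A →ₐ[ZMod p] B :=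
  { f with
    commutes' := fun r => RingHom.congr_fun
      (RingHom.ext_zmod (f.comp (algebraMap (ZMod p) A)) (algebraMap (ZMod p) B)) r }

@[simp]
theorem RingHom.toZModAlgHom_apply (p : ℕ) {A B : Type*} [CommRing A] [CommRing B]
    [Algebra (ZMod p) A] [Algebra (ZMod p) B] (f : A →+* B) (x : A) :
    f.toZModAlgHom p x = f x := rfl

end ValuationRing

section FrobeniusModules

open scoped TensorProduct

section FrobeniusTensor

variable {p : ℕ} [Fact p.Prime] {A B E J : Type*} [CommRing A] [Algebra (ZMod p) A]
  [CommRing B] [Algebra (ZMod p) B] [Field E] [Algebra (ZMod p) E]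

/-- Base change of an algebra map to `E`. -/
noncomputable def AlgHom.tensorRight (E : Type*) [Field E] [Algebra (ZMod p) E]
    (f : A →ₐ[ZMod p] B) : A ⊗[ZMod p] E →ₐ[ZMod p] B ⊗[ZMod p] E :=
  Algebra.TensorProduct.map f (AlgHom.id (ZMod p) E)

/-- The Frobenius of `A`, extended `E`-linearly to `A ⊗ E`. -/
noncomputable def frobeniusTensor (p : ℕ) [Fact p.Prime] (A E : Type*) [CommRing A]
    [Algebra (ZMod p) A] [Field E] [Algebra (ZMod p) E] :
    A ⊗[ZMod p] E →ₐ[ZMod p] A ⊗[ZMod p] E :=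
  (FiniteField.frobeniusAlgHom (ZMod p) A).tensorRight E

@[simp]
theorem AlgHom.tensorRight_tmul (f : A →ₐ[ZMod p] B) (a : A) (x : E) :
    f.tensorRight E (a ⊗ₜ x) = f a ⊗ₜ x := by
  simp [AlgHom.tensorRight]

@[simp]
theorem frobeniusTensor_tmul (a : A) (x : E) :
    frobeniusTensor p A E (a ⊗ₜ x) = (a ^ p) ⊗ₜ x := by
  simp [frobeniusTensor, ZMod.card]

theorem AlgHom.tensorRight_smul (f : A →ₐ[ZMod p] B) (a : A) (r : A ⊗[ZMod p] E) :
    f.tensorRight E (a • r) = f a • f.tensorRight E r := by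
  induction r with
  | zero => simp
  | add x y hx hy => rw [smul_add, map_add, hx, hy, map_add, smul_add]
  | tmul x y => simp [TensorProduct.smul_tmul']

theorem frobeniusTensor_smul (a : A) (r : A ⊗[ZMod p] E) :
    frobeniusTensor p A E (a • r) = a ^ p • frobeniusTensor p A E r := by
  rw [frobeniusTensor, AlgHom.tensorRight_smul, FiniteField.coe_frobeniusAlgHom, ZMod.card]

theorem AlgHom.tensorRight_frobeniusTensor (f : A →ₐ[ZMod p] B) (r : A ⊗[ZMod p] E) :
    f.tensorRight E (frobeniusTensor p A E r) = frobeniusTensor p B E (f.tensorRight E r) := by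
  induction r with
  | zero => simp
  | add x y hx hy => simp only [map_add, hx, hy]
  | tmul x y => simp

/-- The coordinates of `A ⊗ E` attached to a basis of `E`. -/
noncomputable def tensorCoord (b : Module.Basis J (ZMod p) E) (j : J) : A ⊗[ZMod p] E →ₗ[A] A :=
  (Algebra.TensorProduct.basis A b).coord j

theorem tensorCoord_ext (b : Module.Basis J (ZMod p) E) {r s : A ⊗[ZMod p] E}
    (h : ∀ j, tensorCoord b j r = tensorCoord b j s) : r = s :=
  (Algebra.TensorProduct.basis A b).ext_elem h

theorem tensorCoord_tensorRight (b : Module.Basis J (ZMod p) E) (f : A →ₐ[ZMod p] B) (j : J)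
    (r : A ⊗[ZMod p] E) : tensorCoord b j (f.tensorRight E r) = f (tensorCoord b j r) := by
  induction r with
  | zero => simp
  | add x y hx hy => simp only [map_add, hx, hy]
  | tmul x y =>
    simp [tensorCoord, Algebra.TensorProduct.basis_repr_tmul]

theorem tensorCoord_frobeniusTensor (b : Module.Basis J (ZMod p) E) (j : J)
    (r : A ⊗[ZMod p] E) :
    tensorCoord b j (frobeniusTensor p A E r) = (tensorCoord b j r) ^ p := by
  rw [frobeniusTensor, tensorCoord_tensorRight, FiniteField.coe_frobeniusAlgHom, ZMod.card]

theorem tensorCoord_tmul (b : Module.Basis J (ZMod p) E) (j : J) (a : A) (x : E) :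
    tensorCoord b j (a ⊗ₜ[ZMod p] x) = b.repr x j • a := by
  simp [tensorCoord, Algebra.TensorProduct.basis_repr_tmul, Algebra.smul_def, mul_comm]

theorem exists_tensorCoord_eq [Finite J] (b : Module.Basis J (ZMod p) E) (c : J → A) :
    ∃ r : A ⊗[ZMod p] E, ∀ j, tensorCoord b j r = c j :=
  ⟨(Algebra.TensorProduct.basis A b).equivFun.symm c, fun j =>
    congrFun ((Algebra.TensorProduct.basis A b).equivFun.apply_symm_apply c) j⟩

theorem AlgHom.tensorRight_injective (b : Module.Basis J (ZMod p) E) {f : A →ₐ[ZMod p] B}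
    (hf : Function.Injective f) : Function.Injective (f.tensorRight E) := fun r s h =>
  tensorCoord_ext b fun j => hf (by rw [← tensorCoord_tensorRight, h, tensorCoord_tensorRight])

theorem exists_tensorRight_eq [Finite J] (b : Module.Basis J (ZMod p) E)
    {f : A →ₐ[ZMod p] B} {r : B ⊗[ZMod p] E} (h : ∀ j, ∃ a, f a = tensorCoord b j r) :
    ∃ s, f.tensorRight E s = r := by
  choose a ha using h
  obtain ⟨s, hs⟩ := exists_tensorCoord_eq b a
  exact ⟨s, tensorCoord_ext b fun j => by rw [tensorCoord_tensorRight, hs, ha]⟩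

theorem frobeniusTensor_one_tmul (x : E) :
    frobeniusTensor p A E (1 ⊗ₜ x) = 1 ⊗ₜ x := by simp

variable {F : Type*} [Field F] [Algebra (ZMod p) F]

theorem exists_one_tmul_eq_of_frobeniusTensor_eq [Finite J] (b : Module.Basis J (ZMod p) E)
    {r : F ⊗[ZMod p] E} (hr : frobeniusTensor p F E r = r) : ∃ a : E, 1 ⊗ₜ a = r := by
  cases nonempty_fintype J
  have : CharP F p := charP_of_injective_algebraMap (algebraMap (ZMod p) F).injective p
  have h : ∀ j, ∃ n : ZMod p, algebraMap (ZMod p) F n = tensorCoord b j r := fun j =>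
    exists_algebraMap_eq_of_pow_eq_self (by rw [← tensorCoord_frobeniusTensor, hr])
  choose n hn using h
  refine ⟨∑ j, n j • b j, tensorCoord_ext b fun j => ?_⟩
  rw [tensorCoord_tmul, ← hn, Algebra.algebraMap_eq_smul_one]
  congr 1
  rw [b.repr_sum_self]

end FrobeniusTensor

section Lang

open Polynomial in
theorem IsSepClosed.exists_frobenius_fixed {p : ℕ} [Fact p.Prime] {F V : Type*} [Field F]
    [CharP F p] [IsSepClosed F] [AddCommGroup V] [Module F V] [FiniteDimensional F V]
    [Nontrivial V] (ψ : V →+ V) (hψ : Function.Injective ψ)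
    (hs : ∀ (a : F) v, ψ (a • v) = a ^ p • ψ v) : ∃ r, r ≠ 0 ∧ ψ r = r := by
  classical
  have hp : p.Prime := Fact.out
  obtain ⟨v, hv⟩ := exists_ne (0 : V)
  let e : ℕ → V := fun i => ψ^[i] v
  have he : ∀ i, e (i + 1) = ψ (e i) := fun i => Function.iterate_succ_apply' ψ i v
  have hne : ∀ i, e i ≠ 0 := fun i => by
    induction i with
    | zero => exact hv
    | succ i ih => rw [he]; exact fun h => ih (hψ (h.trans (map_zero ψ).symm))
  have hind : ∀ n, (∀ m < n, e m ∉ Submodule.span F (Set.range fun i : Fin m => e i)) →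
      LinearIndependent F fun i : Fin n => e i := by
    intro n
    induction n with
    | zero => intro _; exact linearIndependent_empty_type
    | succ n ih =>
      intro h
      rw [linearIndependent_finSucc']
      refine ⟨ih fun m hm => h m (by omega), ?_⟩
      simpa [Fin.init] using! h n (by omega)
  have hex : ∃ n, e n ∈ Submodule.span F (Set.range fun i : Fin n => e i) := by
    by_contra! hcon
    have h1 := (hind (Module.finrank F V + 1) fun m _ => hcon m).fintype_card_le_finrank
    simp at h1
  obtain ⟨n, hn, hmin⟩ : ∃ n, e n ∈ Submodule.span F (Set.range fun i : Fin n => e i) ∧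
      ∀ m < n, e m ∉ Submodule.span F (Set.range fun i : Fin m => e i) :=
    ⟨Nat.find hex, Nat.find_spec hex, fun m hm => Nat.find_min hex hm⟩
  have hli := hind n hmin
  cases n with
  | zero => simp [hne] at hn
  | succ m =>
  rw [Submodule.mem_span_range_iff_exists_fun] at hn
  obtain ⟨b', hb'⟩ := hn
  obtain ⟨b, hb⟩ : ∃ b : ℕ → F, ∀ i : Fin (m + 1), b i = b' i :=
    ⟨fun i => if h : i < m + 1 then b' ⟨i, h⟩ else 0, fun i => dif_pos i.2⟩
  have hsum : ∑ i ∈ Finset.range (m + 1), b i • e i = e (m + 1) := by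
    rw [← hb', Finset.sum_range]
    exact Finset.sum_congr rfl fun i _ => by rw [hb]
  let c : ℕ → F[X] := fun i =>
    Nat.rec (C (b 0) * X ^ p) (fun i q => q ^ p + C (b (i + 1)) * X ^ p) i
  have c0 : c 0 = C (b 0) * X ^ p := rfl
  have cs : ∀ i, c (i + 1) = c i ^ p + C (b (i + 1)) * X ^ p := fun i => rfl
  have hder : ∀ i, derivative (c i) = 0 := fun i => by
    cases i <;> simp [c0, cs, derivative_pow]
  have hX : ∀ i, X ∣ c i := fun i => by
    induction i with
    | zero => exact c0 ▸ (dvd_pow_self X hp.ne_zero).mul_left _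
    | succ i ih =>
      exact cs i ▸ dvd_add (dvd_pow ih hp.ne_zero) ((dvd_pow_self X hp.ne_zero).mul_left _)
  have hdeg : ∀ i, (c i = 0 ∧ ∀ j ≤ i, b j = 0) ∨ p ≤ (c i).natDegree := fun i => by
    induction i with
    | zero =>
      by_cases h : b 0 = 0
      · exact .inl ⟨by simp [c0, h], fun j hj => by rwa [Nat.le_zero.mp hj]⟩
      · right; rw [c0, natDegree_C_mul_X_pow _ _ h]
    | succ i ih =>
      rcases ih with ⟨h0, h1⟩ | h1
      · by_cases h : b (i + 1) = 0
        · refine .inl ⟨by simp [cs, h, h0, hp.ne_zero], fun j hj => ?_⟩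
          rcases Nat.le_succ_iff.mp hj with hj | rfl
          exacts [h1 j hj, h]
        · right; rw [cs, h0, zero_pow hp.ne_zero, zero_add, natDegree_C_mul_X_pow _ _ h]
      · right
        have h2 : (C (b (i + 1)) * X ^ p).natDegree < (c i ^ p).natDegree := by
          refine (natDegree_C_mul_X_pow_le _ _).trans_lt ?_
          rw [natDegree_pow]
          have := hp.two_le
          nlinarith
        rw [cs, natDegree_add_eq_left_of_natDegree_lt h2, natDegree_pow]
        exact h1.trans (Nat.le_mul_of_pos_left _ hp.pos)
  have hcm : p ≤ (c m).natDegree := by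
    rcases hdeg m with ⟨_, h⟩ | h
    · refine absurd hsum.symm ?_
      rw [Finset.sum_eq_zero fun i hi => by
        rw [h i (by simpa [Nat.lt_succ_iff] using hi), zero_smul]]
      exact hne _
    · exact h
  have hPder : derivative (c m - X) = -1 := by simp [hder]
  have hPsep : (c m - X).Separable := by
    rw [separable_def, hPder]
    exact isCoprime_one_right.neg_right
  obtain ⟨Q, hQ⟩ : X ∣ c m - X := dvd_sub (hX m) dvd_rfl
  have hPdeg : p ≤ (c m - X).natDegree := by
    rw [natDegree_sub_eq_left_of_natDegree_lt]
    · exact hcm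
    · rw [natDegree_X]; exact hp.one_lt.trans_le hcm
  have hQ0 : Q ≠ 0 := by
    rintro rfl
    rw [hQ] at hPdeg
    simp at hPdeg
    exact hp.ne_zero hPdeg
  have hQdeg : Q.degree ≠ 0 := by
    intro h
    have h1 : Q.natDegree = 0 := natDegree_eq_of_degree_eq_some h
    rw [hQ, natDegree_mul X_ne_zero hQ0, natDegree_X, h1] at hPdeg
    have := hp.two_le
    omega
  obtain ⟨t, ht⟩ := IsSepClosed.exists_root Q hQdeg (by
    rw [hQ] at hPsep; exact hPsep.of_mul_right)
  have ht0 : t ≠ 0 := by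
    rintro rfl
    have h1 := congrArg (eval 0) hPder
    rw [hQ] at h1
    simp [ht.eq_zero] at h1
  have htm : (c m).eval t = t := by
    have := congrArg (eval t) hQ
    simp only [eval_sub, eval_X, eval_mul, ht.eq_zero, mul_zero] at this
    exact sub_eq_zero.mp this
  refine ⟨∑ i ∈ Finset.range (m + 1), (c i).eval t • e i, fun h => ht0 ?_, ?_⟩
  · rw [Finset.sum_range] at h
    have := Fintype.linearIndependent_iff.mp hli (fun i => (c i).eval t) h (Fin.last m)
    rwa [Fin.val_last, htm] at this
  · simp only [map_sum, hs, ← he]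
    rw [Finset.sum_range_succ, htm, ← hsum, Finset.smul_sum, Finset.sum_range_succ',
      Finset.sum_range_succ' (n := m) (f := fun i => (c i).eval t • e i), ← add_assoc,
      ← Finset.sum_add_distrib]
    congr 1
    · refine Finset.sum_congr rfl fun i _ => ?_
      rw [cs, smul_smul, ← add_smul, eval_add, eval_pow, eval_mul, eval_C, eval_pow, eval_X,
        mul_comm (t ^ p)]
    · rw [c0, smul_smul, eval_mul, eval_C, eval_pow, eval_X, mul_comm (t ^ p)]

end Lang

section LangTensor

variable {p : ℕ} [Fact p.Prime] {E F : Type*} [Field E] [Algebra (ZMod p) E] [Finite E]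
  [Field F] [Algebra (ZMod p) F]

theorem isUnit_of_frobeniusTensor_eq_mul {y z : F ⊗[ZMod p] E} (hz : z ≠ 0)
    (h : frobeniusTensor p F E z = y * z) : IsUnit z := by
  classical
  have hp : p.Prime := Fact.out
  let b := Module.finBasis (ZMod p) E
  have key : ∀ n, ∀ x : F ⊗[ZMod p] E, x * z ≠ 0 →
      (Finset.univ.filter fun j => tensorCoord b j (x * z) ≠ 0).card = n →
      ∃ x : F ⊗[ZMod p] E, x * z ≠ 0 ∧ frobeniusTensor p F E (x * z) = x * z := by
    intro n
    induction n using Nat.strong_induction_on with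
    | _ n ih =>
    intro x hx hn
    obtain ⟨j, hj⟩ : ∃ j, tensorCoord b j (x * z) ≠ 0 := by
      by_contra! hcon
      exact hx (tensorCoord_ext b fun j => by rw [hcon, map_zero])
    let c := tensorCoord b j (x * z)
    let x' := c⁻¹ • x
    have hx' : x' * z = c⁻¹ • (x * z) := smul_mul_assoc _ _ _
    have hx0 : x' * z ≠ 0 := by rw [hx']; exact smul_ne_zero (inv_ne_zero hj) hx
    have h1 : tensorCoord b j (x' * z) = 1 := by
      rw [hx', map_smul, smul_eq_mul]; exact inv_mul_cancel₀ hj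
    by_cases hfix : frobeniusTensor p F E (x' * z) = x' * z
    · exact ⟨x', hx0, hfix⟩
    have heq : (frobeniusTensor p F E x' * y - x') * z =
        frobeniusTensor p F E (x' * z) - x' * z := by
      rw [map_mul, h]; ring
    refine ih _ ?_ (frobeniusTensor p F E x' * y - x') (by rwa [heq, sub_ne_zero]) rfl
    rw [← hn]
    refine Finset.card_lt_card ((Finset.ssubset_iff_of_subset fun i hi => ?_).mpr ⟨j, ?_, ?_⟩)
    · simp only [Finset.mem_filter, Finset.mem_univ, true_and] at hi ⊢
      intro h0
      apply hi
      rw [heq, map_sub, tensorCoord_frobeniusTensor, hx', map_smul, h0, smul_zero,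
        zero_pow hp.ne_zero, sub_zero]
    · simpa using hj
    · simp only [Finset.mem_filter, Finset.mem_univ, true_and, not_not]
      rw [heq, map_sub, tensorCoord_frobeniusTensor, h1, one_pow, sub_self]
  obtain ⟨x, hx0, hx⟩ := key _ 1 (by rwa [one_mul]) rfl
  obtain ⟨a, ha⟩ := exists_one_tmul_eq_of_frobeniusTensor_eq b hx
  have ha0 : a ≠ 0 := by
    rintro rfl
    exact hx0 (by rw [← ha, TensorProduct.tmul_zero])
  refine IsUnit.of_mul_eq_one ((1 ⊗ₜ a⁻¹) * x) ?_
  rw [mul_comm, mul_assoc, ← ha, Algebra.TensorProduct.tmul_mul_tmul, one_mul,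
    inv_mul_cancel₀ ha0, Algebra.TensorProduct.one_def]

theorem exists_unit_frobeniusTensor_eq_mul [IsSepClosed F] (y : (F ⊗[ZMod p] E)ˣ) :
    ∃ z : (F ⊗[ZMod p] E)ˣ, frobeniusTensor p F E z = y * z := by
  have : CharP F p := charP_of_injective_algebraMap (algebraMap (ZMod p) F).injective p
  have hinj : Function.Injective (frobeniusTensor p F E) :=
    AlgHom.tensorRight_injective (Module.finBasis (ZMod p) E)
      (FiniteField.frobeniusAlgHom (ZMod p) F).toRingHom.injective
  obtain ⟨z, hz0, hz⟩ := IsSepClosed.exists_frobenius_fixed (p := p) (F := F)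
    ((AddMonoidHom.mulLeft (↑y⁻¹ : F ⊗[ZMod p] E)).comp
      (frobeniusTensor p F E : F ⊗[ZMod p] E →+ F ⊗[ZMod p] E))
    (fun a b h => hinj (y⁻¹.isUnit.mul_left_cancel h))
    (fun a v => by simp [frobeniusTensor_smul])
  have hz' : frobeniusTensor p F E z = y * z := by
    conv_rhs => rw [← hz]
    simp
  obtain ⟨u, hu⟩ := isUnit_of_frobeniusTensor_eq_mul hz0 hz'
  exact ⟨u, by rw [hu, hz']⟩

end LangTensor

section FrobeniusNorm

variable {p : ℕ} [Fact p.Prime] {A B E : Type*} [CommRing A] [Algebra (ZMod p) A]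
  [CommRing B] [Algebra (ZMod p) B] [Field E] [Algebra (ZMod p) E]

/-- The product of the first `d` Frobenius conjugates. -/
noncomputable def frobeniusNorm (p d : ℕ) [Fact p.Prime] (A E : Type*) [CommRing A]
    [Algebra (ZMod p) A] [Field E] [Algebra (ZMod p) E] : A ⊗[ZMod p] E →* A ⊗[ZMod p] E where
  toFun y := ∏ j ∈ Finset.range d, (frobeniusTensor p A E)^[j] y
  map_one' := Finset.prod_eq_one fun j _ => iterate_map_one _ j
  map_mul' x y := by simp only [iterate_map_mul, Finset.prod_mul_distrib]

theorem frobeniusNorm_apply (d : ℕ) (y : A ⊗[ZMod p] E) :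
    frobeniusNorm p d A E y = ∏ j ∈ Finset.range d, (frobeniusTensor p A E)^[j] y := rfl

theorem iterate_frobeniusTensor_eq_mul {y z : A ⊗[ZMod p] E}
    (h : frobeniusTensor p A E z = y * z) (d : ℕ) :
    (frobeniusTensor p A E)^[d] z = frobeniusNorm p d A E y * z := by
  induction d with
  | zero => simp [frobeniusNorm_apply]
  | succ d ih =>
    rw [Function.iterate_succ_apply, h, iterate_map_mul, ih, frobeniusNorm_apply,
      frobeniusNorm_apply, Finset.prod_range_succ]
    ring

theorem tensorRight_iterate_frobeniusTensor (f : A →ₐ[ZMod p] B) (d : ℕ) (y : A ⊗[ZMod p] E) :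
    f.tensorRight E ((frobeniusTensor p A E)^[d] y) =
      (frobeniusTensor p B E)^[d] (f.tensorRight E y) :=
  Function.Semiconj.iterate_right (f := f.tensorRight E)
    (fun r => AlgHom.tensorRight_frobeniusTensor f r) d y

theorem tensorRight_frobeniusNorm (f : A →ₐ[ZMod p] B) (d : ℕ) (y : A ⊗[ZMod p] E) :
    f.tensorRight E (frobeniusNorm p d A E y) = frobeniusNorm p d B E (f.tensorRight E y) := by
  simp only [frobeniusNorm_apply, map_prod, tensorRight_iterate_frobeniusTensor]

theorem tensorCoord_iterate_frobeniusTensor {J : Type*} (b : Module.Basis J (ZMod p) E) (j : J)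
    (d : ℕ) (r : A ⊗[ZMod p] E) :
    tensorCoord b j ((frobeniusTensor p A E)^[d] r) = (tensorCoord b j r) ^ p ^ d := by
  induction d with
  | zero => simp
  | succ d ih =>
    rw [Function.iterate_succ_apply', tensorCoord_frobeniusTensor, ih, pow_succ, pow_mul]

open Polynomial in
theorem FiniteField.exists_algebraMap_eq_of_pow_card_eq {κ F : Type*} [Field κ] [Finite κ]
    [Field F] [Algebra κ F] {x : F} (hx : x ^ Nat.card κ = x) : ∃ a, algebraMap κ F a = x := by
  classical
  cases nonempty_fintype κ
  by_contra! hcon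
  have h1 : Nat.card κ = Fintype.card κ := Nat.card_eq_fintype_card
  let s : Finset F := insert x (Finset.univ.image (algebraMap κ F))
  have hs : s.card = Fintype.card κ + 1 := by
    rw [Finset.card_insert_of_notMem (by simpa using hcon),
      Finset.card_image_of_injective _ (algebraMap κ F).injective, Finset.card_univ]
  have hne : (X ^ Fintype.card κ - X : F[X]) ≠ 0 :=
    FiniteField.X_pow_card_sub_X_ne_zero F Fintype.one_lt_card
  have h2 := card_le_degree_of_subset_roots (p := (X ^ Fintype.card κ - X : F[X])) (Z := s) (by
    intro a ha
    rw [mem_roots hne, IsRoot, eval_sub, eval_pow, eval_X, sub_eq_zero]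
    rcases Finset.mem_insert.mp ha with rfl | ha
    · rw [← h1, hx]
    · obtain ⟨a, -, rfl⟩ := Finset.mem_image.mp ha
      rw [← map_pow, FiniteField.pow_card])
  rw [FiniteField.X_pow_card_sub_X_natDegree_eq F Fintype.one_lt_card, hs] at h2
  omega

theorem exists_frobeniusNorm_eq {κ : Type*} [Field κ] [Finite κ] [Algebra (ZMod p) κ] [Finite E]
    {d : ℕ} (hd : Nat.card κ = p ^ d) (ν : Eˣ) :
    ∃ y : κ ⊗[ZMod p] E, frobeniusNorm p d κ E y = 1 ⊗ₜ (ν : E) := by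
  classical
  let b := Module.finBasis (ZMod p) E
  have : Finite (κ ⊗[ZMod p] E) := Module.finite_of_finite κ
  let Φ : (κ ⊗[ZMod p] E)ˣ →* (κ ⊗[ZMod p] E)ˣ := Units.map (frobeniusTensor p κ E : _ →* _)
  let D : (κ ⊗[ZMod p] E)ˣ →* (κ ⊗[ZMod p] E)ˣ := Φ / MonoidHom.id _
  let N : (κ ⊗[ZMod p] E)ˣ →* (κ ⊗[ZMod p] E)ˣ := Units.map (frobeniusNorm p d κ E)
  have hd1 : ∀ x : κ, x ^ p ^ d = x := fun x => by
    cases nonempty_fintype κ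
    rw [← hd, Nat.card_eq_fintype_card, FiniteField.pow_card]
  have hφd : ∀ r, (frobeniusTensor p κ E)^[d] r = r := fun r => tensorCoord_ext b fun j => by
    rw [tensorCoord_iterate_frobeniusTensor, hd1]
  have hker : N.ker ≤ D.range := by
    intro y hy
    have hy1 : frobeniusNorm p d κ E y = 1 := congrArg Units.val hy
    let f : κ →ₐ[ZMod p] AlgebraicClosure κ := IsScalarTower.toAlgHom _ _ _
    let y' : (AlgebraicClosure κ ⊗[ZMod p] E)ˣ := Units.map
      (f.tensorRight E : κ ⊗[ZMod p] E →* AlgebraicClosure κ ⊗[ZMod p] E) y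
    obtain ⟨z, hz⟩ := exists_unit_frobeniusTensor_eq_mul y'
    have hzd := iterate_frobeniusTensor_eq_mul hz d
    have h1 : frobeniusNorm p d (AlgebraicClosure κ) E (f.tensorRight E y) = 1 := by
      rw [← tensorRight_frobeniusNorm, hy1, map_one]
    rw [show (y' : AlgebraicClosure κ ⊗[ZMod p] E) = f.tensorRight E y from rfl] at hz hzd
    rw [h1, one_mul] at hzd
    obtain ⟨z₀, hz₀⟩ := exists_tensorRight_eq b (f := f) (r := z) fun j =>
      FiniteField.exists_algebraMap_eq_of_pow_card_eq (by
        rw [hd, ← tensorCoord_iterate_frobeniusTensor, hzd])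
    have hinj : Function.Injective (f.tensorRight E) :=
      AlgHom.tensorRight_injective b f.toRingHom.injective
    have hz₁ : frobeniusTensor p κ E z₀ = y * z₀ := hinj (by
      rw [AlgHom.tensorRight_frobeniusTensor, hz₀, hz, map_mul, hz₀])
    obtain ⟨u, hu⟩ := isUnit_of_frobeniusTensor_eq_mul (fun h => z.ne_zero (by
      rw [← hz₀, h, map_zero])) hz₁
    refine ⟨u, Units.ext ?_⟩
    have : Φ u = y * u := Units.ext (by rw [Units.val_mul, hu, ← hz₁, ← hu]; rfl)
    rw [show D u = Φ u / u from rfl, this, mul_div_cancel_right]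
  have hrange : N.range ≤ D.ker := by
    rintro _ ⟨y, rfl⟩
    rw [MonoidHom.mem_ker]
    change Φ (N y) / N y = 1
    rw [div_eq_one]
    refine Units.ext ?_
    change frobeniusTensor p κ E (frobeniusNorm p d κ E y) = frobeniusNorm p d κ E y
    rw [frobeniusNorm_apply, map_prod]
    simp only [← Function.iterate_succ_apply']
    cases d with
    | zero => rfl
    | succ d => rw [Finset.prod_range_succ, hφd, Finset.prod_range_succ' _ d]; rfl
  have heq : N.range = D.ker := by
    refine Subgroup.eq_of_le_of_card_ge hrange ?_
    have h1 := N.ker.card_mul_index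
    have h2 := D.ker.card_mul_index
    rw [Subgroup.index_ker] at h1 h2
    have h3 : Nat.card N.ker ≤ Nat.card D.range := Subgroup.card_le_of_le hker
    have h4 : 0 < Nat.card D.range := Nat.card_pos
    by_contra! h5
    have := Nat.mul_lt_mul_of_le_of_lt h3 h5 h4
    rw [h1, ← h2, mul_comm] at this
    exact lt_irrefl _ this
  have hν : Units.map (Algebra.TensorProduct.includeRight : E →ₐ[ZMod p] κ ⊗[ZMod p] E) ν ∈
      D.ker := by
    rw [MonoidHom.mem_ker]
    change Φ _ / _ = 1
    rw [div_eq_one]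
    exact Units.ext (frobeniusTensor_one_tmul _)
  rw [← heq] at hν
  obtain ⟨y, hy⟩ := hν
  exact ⟨y, congrArg Units.val hy⟩

end FrobeniusNorm

section Integral

variable {p : ℕ} [Fact p.Prime] {Ω E O l : Type*} [Field Ω] [Algebra (ZMod p) Ω] [Field E]
  [Algebra (ZMod p) E] [Finite E] {w : AbsoluteValue Ω ℝ}
  [CommRing O] [Algebra (ZMod p) O] [Field l] [Algebra (ZMod p) l]
  {inc : O →ₐ[ZMod p] Ω} {red : O →ₐ[ZMod p] l}

theorem exists_smul_tensorRight_eq (hinc : ∀ x, w x ≤ 1 → ∃ a, inc a = x)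
    (hred : ∀ a, red a = 0 → w (inc a) < 1) {x : Ω ⊗[ZMod p] E} (hx : x ≠ 0) :
    ∃ c : Ω, c ≠ 0 ∧ ∃ x₀, c • inc.tensorRight E x₀ = x ∧ red.tensorRight E x₀ ≠ 0 := by
  let b := Module.finBasis (ZMod p) E
  obtain ⟨i, hi⟩ : ∃ j, tensorCoord b j x ≠ 0 := by
    by_contra! hcon
    exact hx (tensorCoord_ext b fun j => by rw [hcon, map_zero])
  have : Nonempty (Fin (Module.finrank (ZMod p) E)) := ⟨i⟩
  obtain ⟨j, hj⟩ := Finite.exists_max fun j => w (tensorCoord b j x)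
  let c := tensorCoord b j x
  have hwc : 0 < w c := (w.pos hi).trans_le (hj i)
  have hc : c ≠ 0 := fun h => by simp [h] at hwc
  obtain ⟨x₀, hx₀⟩ := exists_tensorRight_eq b (f := inc) (r := c⁻¹ • x) fun i => hinc _ (by
    rw [map_smul, smul_eq_mul, map_mul, map_inv₀, inv_mul_le_one₀ hwc]
    exact hj i)
  refine ⟨c, hc, x₀, by rw [hx₀, smul_inv_smul₀ hc], fun h => ?_⟩
  have h1 := congrArg (tensorCoord b j) h
  rw [tensorCoord_tensorRight, map_zero] at h1
  have h2 := hred _ h1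
  rw [← tensorCoord_tensorRight, hx₀, map_smul, smul_eq_mul, inv_mul_cancel₀ hc, map_one] at h2
  exact lt_irrefl _ h2

theorem isUnit_tensorRight (hinj : Function.Injective inc) (hinc : ∀ x, w x ≤ 1 → ∃ a, inc a = x)
    (hred : ∀ a, red a = 0 ↔ w (inc a) < 1) {y : O ⊗[ZMod p] E}
    (hy : IsUnit (red.tensorRight E y)) : IsUnit (inc.tensorRight E y) := by
  have : IsArtinianRing (Ω ⊗[ZMod p] E) := IsArtinianRing.of_finite Ω _
  refine IsArtinianRing.isUnit_of_mem_nonZeroDivisors (mem_nonZeroDivisors_iff_right.mpr ?_)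
  intro x hx
  by_contra hx0
  obtain ⟨c, hc, x₀, rfl, hx₁⟩ := exists_smul_tensorRight_eq hinc (fun a => (hred a).mp) hx0
  rw [smul_mul_assoc, smul_eq_zero, ← map_mul] at hx
  have h1 : x₀ * y = 0 := AlgHom.tensorRight_injective (Module.finBasis (ZMod p) E) hinj
    ((hx.resolve_left hc).trans (map_zero _).symm)
  have h2 := congrArg (red.tensorRight E) h1
  rw [map_mul, map_zero] at h2
  exact hx₁ (hy.mul_left_eq_zero.mp h2)

theorem exists_tensorRight_eq_of_frobeniusTensor_eq_mul
    (hinj : Function.Injective inc) (hinc : ∀ x, w x ≤ 1 → ∃ a, inc a = x)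
    (hred : ∀ a, red a = 0 ↔ w (inc a) < 1) {d : ℕ} (hd : d ≠ 0)
    {y : O ⊗[ZMod p] E} (hy : IsUnit (frobeniusNorm p d _ E (red.tensorRight E y)))
    {z : Ω ⊗[ZMod p] E} (hz : z ≠ 0)
    (hzy : frobeniusTensor p Ω E z = inc.tensorRight E y * z) :
    ∃ z₀, inc.tensorRight E z₀ = z ∧ red.tensorRight E z₀ ≠ 0 := by
  have hp : p.Prime := Fact.out
  let b := Module.finBasis (ZMod p) E
  have hinjE := AlgHom.tensorRight_injective b hinj
  obtain ⟨c, hc, x, rfl, hx⟩ := exists_smul_tensorRight_eq hinc (fun a => (hred a).mp) hz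
  have h1 := iterate_frobeniusTensor_eq_mul hzy d
  have hsm : (frobeniusTensor p Ω E)^[d] (c • inc.tensorRight E x) =
      c ^ p ^ d • inc.tensorRight E ((frobeniusTensor p O E)^[d] x) :=
    tensorCoord_ext b fun j => by
      rw [map_smul, tensorCoord_iterate_frobeniusTensor, map_smul, smul_eq_mul, smul_eq_mul,
        mul_pow, tensorRight_iterate_frobeniusTensor, tensorCoord_iterate_frobeniusTensor]
  have hq : p ^ d = (p ^ d - 1) + 1 := (Nat.sub_add_cancel (Nat.pow_pos hp.pos)).symm
  have hq1 : p ^ d - 1 ≠ 0 := (Nat.sub_pos_of_lt (Nat.one_lt_pow hd hp.one_lt)).ne'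
  rw [hsm, ← tensorRight_frobeniusNorm, mul_smul_comm, ← map_mul, hq, pow_succ', mul_smul] at h1
  replace h1 := smul_right_injective _ hc h1
  have hred' : ∀ a r, red a = 0 → red.tensorRight E (a • r) = 0 := fun a r h => by
    rw [AlgHom.tensorRight_smul, h, zero_smul]
  rcases lt_trichotomy (w c) 1 with hlt | heq | hgt
  · exfalso
    obtain ⟨a, ha⟩ := hinc (c ^ (p ^ d - 1)) (by
      rw [map_pow]
      exact pow_le_one₀ (w.nonneg _) hlt.le)
    rw [← ha, ← AlgHom.tensorRight_smul] at h1
    have h2 := congrArg (red.tensorRight E) (hinjE h1)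
    rw [hred' _ _ ((hred a).mpr (by rw [ha, map_pow]; exact pow_lt_one₀ (w.nonneg _) hlt hq1)),
      map_mul, tensorRight_frobeniusNorm] at h2
    exact hx (hy.mul_right_eq_zero.mp h2.symm)
  · obtain ⟨a, ha⟩ := hinc c heq.le
    refine ⟨a • x, by rw [AlgHom.tensorRight_smul, ha], ?_⟩
    rw [AlgHom.tensorRight_smul]
    refine smul_ne_zero (fun h => ?_) hx
    rw [hred, ha] at h
    exact h.ne heq
  · exfalso
    have hlt : w (c ^ (p ^ d - 1))⁻¹ < 1 := by
      rw [map_inv₀, map_pow]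
      exact inv_lt_one_of_one_lt₀ (one_lt_pow₀ hgt hq1)
    obtain ⟨a, ha⟩ := hinc _ hlt.le
    have h2 := congrArg ((c ^ (p ^ d - 1))⁻¹ • ·) h1
    rw [inv_smul_smul₀ (pow_ne_zero _ hc), ← ha, ← AlgHom.tensorRight_smul] at h2
    have h3 := congrArg (red.tensorRight E) (hinjE h2)
    rw [hred' _ _ ((hred a).mpr (by rwa [ha])), tensorRight_iterate_frobeniusTensor] at h3
    refine hx (tensorCoord_ext b fun j => ?_)
    have h4 := congrArg (tensorCoord b j) h3
    rw [tensorCoord_iterate_frobeniusTensor, map_zero] at h4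
    rw [map_zero]
    exact pow_eq_zero_iff (Nat.pow_pos hp.pos).ne' |>.mp h4

end Integral

section Integral

variable {p : ℕ} [Fact p.Prime] {k Ω E O l κ : Type*} [Field k] [Field Ω] [Algebra k Ω]
  [Algebra (ZMod p) Ω] [Field E]
  [Algebra (ZMod p) E] [Finite E] {w : AbsoluteValue Ω ℝ}
  [CommRing O] [Algebra (ZMod p) O] [Field l] [Algebra (ZMod p) l]
  [Field κ] [Algebra (ZMod p) κ] [Finite κ]
  {inc : O →ₐ[ZMod p] Ω} {red : O →ₐ[ZMod p] l} {i : κ →ₐ[ZMod p] l}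

/-- The decomposition group of `w` has full image under the character attached to a solution of
`φ z = y z` when the norm of the reduction of `y` generates `Eˣ`, and inertia has trivial image. -/
theorem exists_decomposition_map_eq (hw : IsNonarchimedean w) (hinj : Function.Injective inc)
    (hinc : ∀ x, w x ≤ 1 → ∃ a, inc a = x) (hle : ∀ a, w (inc a) ≤ 1)
    (hred : ∀ a, red a = 0 ↔ w (inc a) < 1)
    (hi : ∀ (x : k) (a : O), inc a = algebraMap k Ω x → ∃ t, i t = red a)
    (happ : ∀ x, (∀ σ : Ω ≃ₐ[k] Ω, (∀ y, w (σ y) = w y) → σ x = x) →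
      ∀ ε > 0, ∃ a : k, w (x - algebraMap k Ω a) < ε)
    {d : ℕ} (hd : Nat.card κ = p ^ d) {ν : Eˣ} (hν : ∀ u, u ∈ Subgroup.zpowers ν)
    {y' : κ ⊗[ZMod p] E} (hy' : frobeniusNorm p d κ E y' = 1 ⊗ₜ (ν : E))
    {y : O ⊗[ZMod p] E} (hy : red.tensorRight E y = i.tensorRight E y')
    {z : Ω ⊗[ZMod p] E} (hz : z ≠ 0)
    (hzy : frobeniusTensor p Ω E z = inc.tensorRight E y * z) {ρ : (Ω ≃ₐ[k] Ω) →* Eˣ}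
    (hρ : ∀ σ : Ω ≃ₐ[k] Ω,
      ((σ : Ω →+* Ω).toZModAlgHom p).tensorRight E z = (1 ⊗ₜ (ρ σ : E)) * z)
    {J : Type*} (b : Module.Basis J (ZMod p) E) :
    (∀ h, ∃ σ : Ω ≃ₐ[k] Ω, (∀ y, w (σ y) = w y) ∧ ρ σ = h) ∧
    ∀ σ : Ω ≃ₐ[k] Ω, (∀ y, w (σ y) = w y) → ρ σ ≠ 1 → ∃ j, w (tensorCoord b j z) ≤ 1 ∧
      w (σ (tensorCoord b j z) - tensorCoord b j z) = 1 := by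
  have hp : p.Prime := Fact.out
  have hd0 : d ≠ 0 := by
    rintro rfl
    have := Finite.one_lt_card (α := κ)
    rw [hd, pow_zero] at this
    omega
  have hnorm : frobeniusNorm p d _ E (red.tensorRight E y) = 1 ⊗ₜ (ν : E) := by
    rw [hy, ← tensorRight_frobeniusNorm, hy', AlgHom.tensorRight_tmul, map_one]
  have hunit : ∀ u : Eˣ, IsUnit ((1 : l) ⊗ₜ[ZMod p] (u : E)) := fun u =>
    (u.isUnit.map (Algebra.TensorProduct.includeRight : E →ₐ[ZMod p] l ⊗[ZMod p] E))
  obtain ⟨z₀, rfl, hz₁⟩ := exists_tensorRight_eq_of_frobeniusTensor_eq_mul hinj hinc hred hd0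
    (by rw [hnorm]; exact hunit ν) hz hzy
  have hinjE := AlgHom.tensorRight_injective b hinj
  have hz₀ : frobeniusTensor p O E z₀ = y * z₀ := hinjE (by
    rw [AlgHom.tensorRight_frobeniusTensor, hzy, map_mul])
  have hz₂ : frobeniusTensor p l E (red.tensorRight E z₀) =
      red.tensorRight E y * red.tensorRight E z₀ := by
    rw [← AlgHom.tensorRight_frobeniusTensor, hz₀, map_mul]
  have hz₃ : IsUnit (red.tensorRight E z₀) := isUnit_of_frobeniusTensor_eq_mul hz₁ hz₂
  refine ⟨?_, fun σ hσ h1 => ?_⟩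
  · let D : Subgroup (Ω ≃ₐ[k] Ω) :=
      { carrier := {σ : Ω ≃ₐ[k] Ω | ∀ y, w (σ y) = w y}
        mul_mem' := fun {σ τ} hσ hτ y => by rw [AlgEquiv.mul_apply, hσ, hτ]
        one_mem' := fun y => rfl
        inv_mem' := fun {σ} hσ y => by
          conv_rhs => rw [← AlgEquiv.apply_symm_apply σ y]
          exact (hσ _).symm }
    let n := Nat.card (D.map ρ)
    have hpow : ∀ σ ∈ D, ρ σ ^ n = 1 := fun σ hσ => by
      have := pow_card_eq_one' (x := (⟨ρ σ, Subgroup.mem_map_of_mem ρ hσ⟩ : D.map ρ))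
      exact congrArg Subtype.val this
    have hfix : ∀ j, ∃ t, i t = tensorCoord b j (red.tensorRight E (z₀ ^ n)) := fun j => by
      obtain ⟨a, ha⟩ := happ (tensorCoord b j (inc.tensorRight E (z₀ ^ n))) (fun σ hσ => by
        have h1 := hρ σ
        have h2 := congrArg (tensorCoord b j) (congrArg (· ^ n) h1)
        rw [mul_pow, ← map_pow, Algebra.TensorProduct.tmul_pow, one_pow, ← Units.val_pow_eq_pow_val,
          hpow σ hσ, Units.val_one, ← Algebra.TensorProduct.one_def, one_mul, ← map_pow,
          tensorCoord_tensorRight] at h2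
        exact h2) 1 one_pos
      rw [tensorCoord_tensorRight] at ha
      have ha1 : w (algebraMap k Ω a) ≤ 1 := by
        have := hw (inc (tensorCoord b j (z₀ ^ n))) (-(inc (tensorCoord b j (z₀ ^ n)) -
          algebraMap k Ω a))
        rw [map_neg_eq_map, neg_sub, add_sub_cancel] at this
        exact this.trans (max_le (hle _) ha.le)
      obtain ⟨a', ha'⟩ := hinc _ ha1
      obtain ⟨t, ht⟩ := hi a a' ha'
      refine ⟨t, ?_⟩
      rw [tensorCoord_tensorRight, ht, ← sub_eq_zero, ← map_sub, hred, map_sub, ha',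
        AbsoluteValue.map_sub]
      exact ha
    have hd1 : (frobeniusTensor p l E)^[d] (red.tensorRight E (z₀ ^ n)) =
        red.tensorRight E (z₀ ^ n) := tensorCoord_ext b fun j => by
      obtain ⟨t, ht⟩ := hfix j
      rw [tensorCoord_iterate_frobeniusTensor, ← ht, ← map_pow]
      cases nonempty_fintype κ
      rw [← hd, Nat.card_eq_fintype_card, FiniteField.pow_card]
    have hd2 := iterate_frobeniusTensor_eq_mul hz₂ d
    rw [map_pow, iterate_map_pow, hd2, hnorm, mul_pow] at hd1
    have hd3 : ((1 : l) ⊗ₜ[ZMod p] (ν : E)) ^ n = 1 :=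
      (hz₃.pow n).mul_right_cancel (hd1.trans (one_mul _).symm)
    have hd4 : ν ^ n = 1 := by
      rw [Algebra.TensorProduct.tmul_pow, one_pow, Algebra.TensorProduct.one_def,
        ← Units.val_pow_eq_pow_val] at hd3
      have : Function.Injective (Algebra.TensorProduct.includeRight : E →ₐ[ZMod p] l ⊗[ZMod p] E) :=
        RingHom.injective (Algebra.TensorProduct.includeRight :
          E →ₐ[ZMod p] l ⊗[ZMod p] E).toRingHom
      exact Units.ext (this hd3)
    have htop : D.map ρ = ⊤ := by
      refine Subgroup.eq_top_of_le_card _ ?_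
      rw [← orderOf_eq_card_of_forall_mem_zpowers hν]
      exact Nat.le_of_dvd Nat.card_pos (orderOf_dvd_of_pow_eq_one hd4)
    intro h
    obtain ⟨σ, hσ, hσh⟩ : h ∈ D.map ρ := htop ▸ Subgroup.mem_top h
    exact ⟨σ, hσ, hσh⟩
  · have hu : ((ρ σ : E) - 1) ≠ 0 := fun h => h1 (Units.ext (sub_eq_zero.mp h))
    have h2 : red.tensorRight E ((1 ⊗ₜ ((ρ σ : E) - 1)) * z₀) ≠ 0 := by
      rw [map_mul, AlgHom.tensorRight_tmul, map_one]
      exact fun h => hz₁ ((hunit (Units.mk0 _ hu)).mul_right_eq_zero.mp h)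
    obtain ⟨j, hj⟩ :
        ∃ j, tensorCoord b j (red.tensorRight E ((1 ⊗ₜ ((ρ σ : E) - 1)) * z₀)) ≠ 0 := by
      by_contra! hcon
      exact h2 (tensorCoord_ext b fun j => by rw [hcon, map_zero])
    refine ⟨j, by rw [tensorCoord_tensorRight]; exact hle _, ?_⟩
    have h3 : σ (tensorCoord b j (inc.tensorRight E z₀)) =
        tensorCoord b j ((1 ⊗ₜ (ρ σ : E)) * inc.tensorRight E z₀) := by
      rw [← hρ]
      exact (tensorCoord_tensorRight b ((σ : Ω →+* Ω).toZModAlgHom p) j _).symm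
    have h4 : σ (tensorCoord b j (inc.tensorRight E z₀)) - tensorCoord b j (inc.tensorRight E z₀) =
        inc (tensorCoord b j ((1 ⊗ₜ ((ρ σ : E) - 1)) * z₀)) := by
      have h5 : inc.tensorRight E ((1 ⊗ₜ ((ρ σ : E) - 1)) * z₀) =
          (1 ⊗ₜ (ρ σ : E)) * inc.tensorRight E z₀ - inc.tensorRight E z₀ := by
        rw [map_mul, AlgHom.tensorRight_tmul, map_one, TensorProduct.tmul_sub, sub_mul,
          ← Algebra.TensorProduct.one_def, one_mul]
      rw [h3, ← tensorCoord_tensorRight, h5, map_sub]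
    rw [h4]
    refine le_antisymm (hle _) ?_
    rw [tensorCoord_tensorRight, ne_eq, hred, not_lt] at hj
    exact hj

end Integral

theorem exists_coords_isUnit_and_decomposition_map_eq {p : ℕ} [Fact p.Prime]
    {k Ω E O l κ : Type*} [Field k] [Field Ω]
    [Algebra k Ω] [Algebra (ZMod p) k] [Algebra (ZMod p) Ω] [Field E]
    [Algebra (ZMod p) E] [Finite E]
    {v : AbsoluteValue k ℝ} {w : AbsoluteValue Ω ℝ} (hvw : ∀ x, w (algebraMap k Ω x) = v x)
    [CommRing O] [Algebra (ZMod p) O] [Field l] [Algebra (ZMod p) l]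
    [Field κ] [Algebra (ZMod p) κ] [Finite κ]
    {inc : O →ₐ[ZMod p] Ω} {red : O →ₐ[ZMod p] l} {i : κ →ₐ[ZMod p] l}
    (hw : IsNonarchimedean w) (hinj : Function.Injective inc)
    (hinc : ∀ x, w x ≤ 1 → ∃ a, inc a = x) (hle : ∀ a, w (inc a) ≤ 1)
    (hred : ∀ a, red a = 0 ↔ w (inc a) < 1)
    (hi : ∀ (x : k) (a : O), inc a = algebraMap k Ω x → ∃ t, i t = red a)
    (hi' : ∀ t, ∃ (x : k) (a : O), inc a = algebraMap k Ω x ∧ red a = i t)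
    (happ : ∀ x, (∀ σ : Ω ≃ₐ[k] Ω, (∀ y, w (σ y) = w y) → σ x = x) →
      ∀ ε > 0, ∃ a : k, w (x - algebraMap k Ω a) < ε)
    {ν : Eˣ} (hν : ∀ u, u ∈ Subgroup.zpowers ν)
    {J : Type*} (b : Module.Basis J (ZMod p) E) :
    ∃ c : J → k, ∀ y : k ⊗[ZMod p] E, (∀ j, v (tensorCoord b j y - c j) < 1) →
      IsUnit (((algebraMap k Ω).toZModAlgHom p).tensorRight E y) ∧
      ∀ z : Ω ⊗[ZMod p] E, z ≠ 0 →
      frobeniusTensor p Ω E z = ((algebraMap k Ω).toZModAlgHom p).tensorRight E y * z →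
      ∀ ρ : (Ω ≃ₐ[k] Ω) →* Eˣ, (∀ σ : Ω ≃ₐ[k] Ω,
        ((σ : Ω →+* Ω).toZModAlgHom p).tensorRight E z = (1 ⊗ₜ (ρ σ : E)) * z) →
      (∀ h, ∃ σ : Ω ≃ₐ[k] Ω, (∀ y, w (σ y) = w y) ∧ ρ σ = h) ∧
      ∀ σ : Ω ≃ₐ[k] Ω, (∀ y, w (σ y) = w y) → ρ σ ≠ 1 → ∃ j, w (tensorCoord b j z) ≤ 1 ∧
        w (σ (tensorCoord b j z) - tensorCoord b j z) = 1 := by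
  have hp : p.Prime := Fact.out
  obtain ⟨d, hd⟩ : ∃ d, Nat.card κ = p ^ d :=
    ⟨_, by rw [Module.natCard_eq_pow_finrank (K := ZMod p), Nat.card_zmod]⟩
  have hd0 : d ≠ 0 := by
    rintro rfl
    have := Finite.one_lt_card (α := κ)
    rw [hd, pow_zero] at this
    omega
  have : Finite J := Module.Finite.finite_basis b
  obtain ⟨y', hy'⟩ := exists_frobeniusNorm_eq (κ := κ) hd ν
  choose c a hca hac using fun j => hi' (tensorCoord b j y')
  refine ⟨c, fun y hy => ?_⟩
  have hdiff : ∀ j, w (algebraMap k Ω (tensorCoord b j y) - inc (a j)) < 1 := fun j => by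
    rw [hca, ← map_sub, hvw]; exact hy j
  obtain ⟨y₀, hy₀⟩ := exists_tensorRight_eq b (f := inc)
    (r := ((algebraMap k Ω).toZModAlgHom p).tensorRight E y) fun j => hinc _ (by
      rw [tensorCoord_tensorRight, RingHom.toZModAlgHom_apply]
      have := hw (algebraMap k Ω (tensorCoord b j y) - inc (a j)) (inc (a j))
      rw [sub_add_cancel] at this
      exact this.trans (max_le (hdiff j).le (hle _)))
  have hred₀ : red.tensorRight E y₀ = i.tensorRight E y' := tensorCoord_ext b fun j => by
    rw [tensorCoord_tensorRight, tensorCoord_tensorRight, ← hac, ← sub_eq_zero, ← map_sub, hred,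
      map_sub, ← tensorCoord_tensorRight, hy₀, tensorCoord_tensorRight]
    exact hdiff j
  have hu' : IsUnit y' := by
    have h1 : IsUnit (frobeniusNorm p d κ E y') := by
      rw [hy']
      exact ν.isUnit.map (Algebra.TensorProduct.includeRight : E →ₐ[ZMod p] κ ⊗[ZMod p] E)
    obtain ⟨d, rfl⟩ := Nat.exists_eq_succ_of_ne_zero hd0
    rw [frobeniusNorm_apply, Finset.prod_range_succ'] at h1
    exact isUnit_of_mul_isUnit_right h1
  refine ⟨?_, fun z hz hzy ρ hρ => ?_⟩
  · rw [← hy₀]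
    exact isUnit_tensorRight hinj hinc hred (by rw [hred₀]; exact hu'.map _)
  · rw [← hy₀] at hzy
    exact exists_decomposition_map_eq hw hinj hinc hle hred hi happ hd hν hy' hred₀ hz hzy hρ b

/-- Given finitely many places and a finite field `E`, there is a homomorphism onto `Eˣ` which is
unramified and surjective on each decomposition group. -/
theorem exists_smooth_units_map {p : ℕ} [Fact p.Prime] {k Ω ι : Type*} [Finite ι] [Nonempty ι]
    (E : Type*) [Field k] [Field Ω]
    [Algebra k Ω] [CharP k p] [IsGalois k Ω] [IsSepClosed Ω] [Field E] [CharP E p] [Finite E]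
    {v : ι → AbsoluteValue k ℝ} {w : ι → AbsoluteValue Ω ℝ} (hv : ∀ i, IsNonarchimedean (v i))
    (hfin : ∀ i, Finite (IsLocalRing.ResidueField ((v i).valuationRing (hv i))))
    (hweak : ∀ (c : ι → k) (ε : ℝ), 0 < ε → ∃ a : k, ∀ i, v i (a - c i) < ε)
    (hvw : ∀ i x, w i (algebraMap k Ω x) = v i x) (hw : ∀ i, IsNonarchimedean (w i))
    (happ : ∀ i x, (∀ σ : Ω ≃ₐ[k] Ω, (∀ y, w i (σ y) = w i y) → σ x = x) →
      ∀ ε > 0, ∃ a : k, w i (x - algebraMap k Ω a) < ε) :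
    ∃ ρ : (Ω ≃ₐ[k] Ω) →* Eˣ, ρ.IsSmooth ∧
      ∀ i, (∀ h, ∃ σ : Ω ≃ₐ[k] Ω, (∀ y, w i (σ y) = w i y) ∧ ρ σ = h) ∧
      ∀ σ : Ω ≃ₐ[k] Ω, (∀ y, w i (σ y) = w i y) → ρ σ ≠ 1 → ∃ x, (∀ τ, ρ τ = 1 → τ x = x) ∧
        w i x ≤ 1 ∧ w i (σ x - x) = 1 := by
  classical
  have : CharP Ω p := charP_of_injective_algebraMap (algebraMap k Ω).injective p
  let : Algebra (ZMod p) k := ZMod.algebra k p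
  let : Algebra (ZMod p) Ω := ZMod.algebra Ω p
  let : Algebra (ZMod p) E := ZMod.algebra E p
  let b := Module.finBasis (ZMod p) E
  obtain ⟨ν, hν⟩ := IsCyclic.exists_generator (α := Eˣ)
  have key := fun i => by
    let O := (w i).valuationRing (hw i)
    let o := (v i).valuationRing (hv i)
    have : CharP O p := (RingHom.charP_iff O.subtype Subtype.val_injective p).mpr ‹_›
    have : CharP o p := (RingHom.charP_iff o.subtype Subtype.val_injective p).mpr ‹_›
    let : Algebra (ZMod p) O := ZMod.algebra O p
    let : Algebra (ZMod p) o := ZMod.algebra o p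
    have := hfin i
    have := AbsoluteValue.isLocalHom_valuationRingMap (hv i) (hw i) (hvw i)
    let g := AbsoluteValue.valuationRingMap (hv i) (hw i) (hvw i)
    exact exists_coords_isUnit_and_decomposition_map_eq (p := p) (hvw i) (O := O)
      (l := IsLocalRing.ResidueField O) (κ := IsLocalRing.ResidueField o)
      (inc := O.subtype.toZModAlgHom p)
      (red := (IsLocalRing.residue O).toZModAlgHom p)
      (i := (IsLocalRing.ResidueField.map g).toZModAlgHom p)
      (hw i) Subtype.val_injective (fun x hx => ⟨⟨x, hx⟩, rfl⟩) (fun a => a.2)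
      (fun a => AbsoluteValue.residue_eq_zero_iff (hw i) a)
      (fun x a h => ⟨IsLocalRing.residue o ⟨x, by
          rw [AbsoluteValue.mem_valuationRing, ← hvw, ← h]; exact a.2⟩,
        (IsLocalRing.ResidueField.map_residue g _).trans
          (congrArg (IsLocalRing.residue O) (Subtype.ext h.symm))⟩)
      (fun t => by
        obtain ⟨x, rfl⟩ := IsLocalRing.residue_surjective t
        exact ⟨x, g x, rfl, (IsLocalRing.ResidueField.map_residue g _).symm⟩)
      (happ i) hν b
  choose c hc using key
  choose yc hyc using fun j => hweak (fun i => c i j) 1 one_pos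
  obtain ⟨y, hy⟩ := exists_tensorCoord_eq b yc
  have hcy := fun i => hc i y fun j => by rw [hy]; exact hyc j i
  obtain ⟨i₀⟩ := ‹Nonempty ι›
  obtain ⟨u, hu⟩ := (hcy i₀).1
  obtain ⟨z, hz⟩ := exists_unit_frobeniusTensor_eq_mul u
  rw [hu] at hz
  let act : (Ω ≃ₐ[k] Ω) → Ω ⊗[ZMod p] E →ₐ[ZMod p] Ω ⊗[ZMod p] E :=
    fun σ => ((σ : Ω →+* Ω).toZModAlgHom p).tensorRight E
  have hact : ∀ σ, ∃ h : Eˣ,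
      act σ z = ((1 : Ω) ⊗ₜ[ZMod p] (h : E)) * (z : Ω ⊗[ZMod p] E) := fun σ => by
    have h1 : frobeniusTensor p Ω E (act σ z * ↑z⁻¹) = act σ z * ↑z⁻¹ := by
      have h2 : frobeniusTensor p Ω E (act σ z) =
          ((algebraMap k Ω).toZModAlgHom p).tensorRight E y * act σ z := by
        rw [← AlgHom.tensorRight_frobeniusTensor, hz, map_mul]
        congr 1
        refine tensorCoord_ext b fun j => ?_
        rw [tensorCoord_tensorRight, tensorCoord_tensorRight]
        exact σ.commutes _
      have h3 : frobeniusTensor p Ω E (↑z⁻¹ : Ω ⊗[ZMod p] E) *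
          (((algebraMap k Ω).toZModAlgHom p).tensorRight E y * z) = 1 := by
        rw [← hz, ← map_mul, Units.inv_mul, map_one]
      rw [map_mul, h2]
      refine z.isUnit.mul_right_cancel ?_
      rw [mul_assoc (act σ z), Units.inv_mul, mul_one]
      linear_combination (act σ z) * h3
    obtain ⟨a, ha⟩ := exists_one_tmul_eq_of_frobeniusTensor_eq b h1
    have ha' : act σ z = ((1 : Ω) ⊗ₜ[ZMod p] a) * (z : Ω ⊗[ZMod p] E) := by
      rw [ha, mul_assoc, Units.inv_mul, mul_one]
    have ha0 : a ≠ 0 := by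
      rintro rfl
      rw [TensorProduct.tmul_zero, zero_mul] at ha'
      exact (z.isUnit.map (act σ)).ne_zero ha'
    exact ⟨Units.mk0 a ha0, ha'⟩
  choose r hr using hact
  have hinjr : ∀ h h' : Eˣ, ((1 : Ω) ⊗ₜ[ZMod p] (h : E)) * (z : Ω ⊗[ZMod p] E) =
      (1 ⊗ₜ (h' : E)) * (z : Ω ⊗[ZMod p] E) → h = h' :=
    fun h h' hh => Units.ext ((Algebra.TensorProduct.includeRight :
      E →ₐ[ZMod p] Ω ⊗[ZMod p] E).toRingHom.injective (z.isUnit.mul_right_cancel hh))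
  have hactmul : ∀ σ τ x, act (σ * τ) x = act σ (act τ x) := fun σ τ x =>
    tensorCoord_ext b fun j => by
      simp only [act, tensorCoord_tensorRight]; rfl
  let ρ : (Ω ≃ₐ[k] Ω) →* Eˣ := MonoidHom.mk' r fun σ τ => hinjr _ _ (by
    rw [← hr, hactmul, hr τ, map_mul, hr σ, Units.val_mul, ← mul_assoc]
    congr 1
    rw [AlgHom.tensorRight_tmul, map_one, Algebra.TensorProduct.tmul_mul_tmul, one_mul, mul_comm])
  have hfix : ∀ σ, ρ σ = 1 ↔ ∀ j, σ (tensorCoord b j z) = tensorCoord b j z := fun σ => by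
    constructor
    · intro h j
      have h1 := hr σ
      rw [show r σ = 1 from h, Units.val_one, ← Algebra.TensorProduct.one_def, one_mul] at h1
      conv_rhs => rw [← h1]
      exact (tensorCoord_tensorRight b ((σ : Ω →+* Ω).toZModAlgHom p) j _).symm
    · intro h
      refine hinjr _ _ ((hr σ).symm.trans ?_)
      rw [Units.val_one, ← Algebra.TensorProduct.one_def, one_mul]
      exact tensorCoord_ext b fun j =>
        (tensorCoord_tensorRight b ((σ : Ω →+* Ω).toZModAlgHom p) j _).trans (h j)
  refine ⟨ρ, ⟨Set.range fun j => tensorCoord b j (z : Ω ⊗[ZMod p] E), Set.finite_range _,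
    fun σ hσ => (hfix σ).mpr fun j => hσ _ ⟨j, rfl⟩⟩, fun i => ?_⟩
  obtain ⟨h1, h2⟩ := (hcy i).2 z z.ne_zero hz ρ hr
  refine ⟨h1, fun σ hσ hne => ?_⟩
  obtain ⟨j, hj1, hj2⟩ := h2 σ hσ hne
  exact ⟨_, fun τ hτ => (hfix τ).mp hτ j, hj1, hj2⟩

end FrobeniusModules

theorem IsNonarchimedean.absoluteValue_sub_le {F : Type*} [Field F] {w : AbsoluteValue F ℝ}
    (hw : IsNonarchimedean w) (x y : F) : w (x - y) ≤ max (w x) (w y) := by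
  have := hw x (-y)
  rwa [← sub_eq_add_neg, map_neg_eq_map] at this

theorem IsNonarchimedean.absoluteValue_sum_le {F ι : Type*} [Field F] {w : AbsoluteValue F ℝ}
    (hw : IsNonarchimedean w) (s : Finset ι) (g : ι → F) {B : ℝ} (hB : 0 ≤ B)
    (h : ∀ i ∈ s, w (g i) ≤ B) : w (∑ i ∈ s, g i) ≤ B := by
  classical
  induction s using Finset.induction_on with
  | empty => simpa using hB
  | insert a s ha ih =>
    rw [Finset.sum_insert ha]
    exact (hw _ _).trans (max_le (h a (Finset.mem_insert_self a s))
      (ih fun i hi => h i (Finset.mem_insert_of_mem hi)))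

theorem IsNonarchimedean.absoluteValue_sum_lt {F ι : Type*} [Field F] {w : AbsoluteValue F ℝ}
    (hw : IsNonarchimedean w) (s : Finset ι) (g : ι → F) {B : ℝ} (hB : 0 < B)
    (h : ∀ i ∈ s, w (g i) < B) : w (∑ i ∈ s, g i) < B := by
  classical
  induction s using Finset.induction_on with
  | empty => simpa using hB
  | insert a s ha ih =>
    rw [Finset.sum_insert ha]
    exact (hw _ _).trans_lt (max_lt (h a (Finset.mem_insert_self a s))
      (ih fun i hi => h i (Finset.mem_insert_of_mem hi)))

theorem IsNonarchimedean.absoluteValue_eq_of_sub_lt {F : Type*} [Field F] {w : AbsoluteValue F ℝ}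
    (hw : IsNonarchimedean w) {x y : F} (h : w (x - y) < w y) : w x = w y := by
  refine le_antisymm ?_ ?_
  · have := hw (x - y) y
    rw [sub_add_cancel] at this
    exact this.trans (max_le h.le le_rfl)
  · by_contra! hlt
    have := hw.absoluteValue_sub_le x (x - y)
    rw [sub_sub_cancel] at this
    exact (max_lt hlt h).not_ge this

/-- A finite group acting faithfully on a local ring modulo its maximal ideal has an integral
normal basis generator. -/
theorem IsLocalRing.exists_sum_smul_residue_ne_zero {C O : Type*} [Group C] [Finite C] [CommRing O]
    [IsLocalRing O] [MulSemiringAction C O]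
    (hC : ∀ g : C, g ≠ 1 → ∃ x : O, IsLocalRing.residue O (g • x - x) ≠ 0) :
    ∃ θ : O, ∀ (s : Finset C) (a : C → O), (∀ h (g : C), g • a h = a h) →
      (∃ h ∈ s, IsLocalRing.residue O (a h) ≠ 0) →
      IsLocalRing.residue O (∑ h ∈ s, a h * h • θ) ≠ 0 := by
  let l := IsLocalRing.ResidueField O
  have : FaithfulSMul C l := ⟨fun {g₁ g₂} h => by
    by_contra hne
    obtain ⟨x, hx⟩ := hC (g₂⁻¹ * g₁) fun h1 => hne (inv_mul_eq_one.mp h1).symm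
    apply hx
    have h2 := h (IsLocalRing.residue O x)
    rw [map_sub, sub_eq_zero, IsLocalRing.ResidueField.residue_smul, mul_smul, h2, inv_smul_smul]⟩
  obtain ⟨x, hx⟩ := exists_linearIndependent_algEquiv_apply (FixedPoints.subfield C l) l
  obtain ⟨θ, rfl⟩ := IsLocalRing.residue_surjective x
  refine ⟨θ, fun s a ha ⟨h₀, hs, h₀ne⟩ h0 => ?_⟩
  have hlin : LinearIndependent (FixedPoints.subfield C l)
      fun h : C => h • IsLocalRing.residue O θ :=
    hx.comp (fun h => MulSemiringAction.toAlgAut C (FixedPoints.subfield C l) l h)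
      (FixedPoints.toAlgAut_bijective C l).1
  let a' : C → FixedPoints.subfield C l := fun h => ⟨IsLocalRing.residue O (a h), fun g => by
    rw [← IsLocalRing.ResidueField.residue_smul, ha]⟩
  refine h₀ne (congrArg Subtype.val (linearIndependent_iff'.mp hlin s a' ?_ h₀ hs))
  rw [← h0, map_sum]
  refine Finset.sum_congr rfl fun h _ => ?_
  rw [map_mul, IsLocalRing.ResidueField.residue_smul]
  rfl

section

variable {k Ω C : Type*} [Field k] [Field Ω] [Algebra k Ω] [Group C] [Finite C]
  {ρ : (Ω ≃ₐ[k] Ω) →* C} {v : AbsoluteValue k ℝ} {w : AbsoluteValue Ω ℝ}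

theorem exists_local_normalBasis_generator (hw : IsNonarchimedean w)
    (hvw : ∀ x, w (algebraMap k Ω x) = v x)
    (hsurj : ∀ h, ∃ σ : Ω ≃ₐ[k] Ω, (∀ y, w (σ y) = w y) ∧ ρ σ = h)
    (hunr : ∀ σ : Ω ≃ₐ[k] Ω, (∀ y, w (σ y) = w y) → ρ σ ≠ 1 →
      ∃ x, (∀ τ, ρ τ = 1 → τ x = x) ∧ w x ≤ 1 ∧ w (σ x - x) = 1) :
    ∃ θ : Ω, (∀ τ, ρ τ = 1 → τ θ = θ) ∧ (∀ σ : Ω ≃ₐ[k] Ω, w (σ θ) ≤ 1) ∧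
      ∀ (r : C → (Ω ≃ₐ[k] Ω)), (∀ h, ρ (r h) = h) → ∀ (s : Finset C) (a : C → k),
        (∀ h ∈ s, v (a h) ≤ 1) → (∃ h ∈ s, v (a h) = 1) →
        w (∑ h ∈ s, algebraMap k Ω (a h) * r h θ) = 1 := by
  classical
  choose s hsw hs using hsurj
  let L := IntermediateField.fixedField ρ.ker
  have hL : ∀ x, x ∈ L ↔ ∀ τ, ρ τ = 1 → τ x = x := fun x =>
    ⟨fun h τ hτ => h ⟨τ, hτ⟩, fun h τ => h τ τ.2⟩
  let wL : AbsoluteValue L ℝ := w.comp (algebraMap L Ω).injective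
  have hwL : IsNonarchimedean wL := fun x y => hw x y
  let O := wL.valuationRing hwL
  let act : C → O → O := fun h x => ⟨⟨s h x.1.1, (hL _).mpr (fixed_apply_of_fixed
    ((hL _).mp x.1.2) _)⟩, (hsw h x.1.1).trans_le x.2⟩
  have hact : ∀ h x, ((act h x).1 : Ω) = s h (x.1 : Ω) := fun h x => rfl
  have hext : ∀ x y : O, (x.1 : Ω) = (y.1 : Ω) → x = y := fun x y h => Subtype.ext (Subtype.ext h)
  let : MulSemiringAction C O :=
    { smul := act
      one_smul := fun x => hext _ _ ((hL _).mp x.1.2 _ (hs 1))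
      mul_smul := fun g h x => hext _ _ (apply_eq_of_map_eq (τ := s g * s h) ((hL _).mp x.1.2)
        (by rw [map_mul, hs, hs, hs]))
      smul_zero := fun g => hext _ _ (map_zero (s g))
      smul_add := fun g x y => hext _ _ (map_add (s g) _ _)
      smul_one := fun g => hext _ _ (map_one (s g))
      smul_mul := fun g x y => hext _ _ (map_mul (s g) _ _) }
  have hsmul : ∀ h (x : O), ((h • x).1 : Ω) = s h (x.1 : Ω) := fun h x => rfl
  obtain ⟨θ, hθ⟩ := IsLocalRing.exists_sum_smul_residue_ne_zero (C := C) (O := O) fun g hg => by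
    obtain ⟨x, hx, hx1, hgx⟩ := hunr (s g) (hsw g) (by rwa [hs])
    refine ⟨⟨⟨x, (hL x).mpr hx⟩, hx1⟩, fun h => ?_⟩
    rw [AbsoluteValue.residue_eq_zero_iff] at h
    exact h.ne hgx
  have hθf := (hL _).mp θ.1.2
  refine ⟨θ.1.1, hθf, fun σ => ?_, fun r hr t a ha hex => ?_⟩
  · rw [apply_eq_of_map_eq hθf (hs (ρ σ)).symm, hsw]
    exact θ.2
  let a' : C → O := fun h => if hh : v (a h) ≤ 1 then ⟨algebraMap k L (a h), by
    rw [AbsoluteValue.mem_valuationRing]; exact (hvw _).trans_le hh⟩ else 0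
  have ha' : ∀ h ∈ t, ((a' h).1 : Ω) = algebraMap k Ω (a h) := fun h hh => by
    simp only [a', dif_pos (ha h hh)]; rfl
  have hfix : ∀ h g, g • a' h = a' h := fun h g => by
    by_cases hh : v (a h) ≤ 1
    · refine hext _ _ ?_
      rw [hsmul]
      simp only [a', dif_pos hh]
      exact (s g).commutes _
    · simp only [a', dif_neg hh, smul_zero]
  have key := hθ t a' hfix (by
    obtain ⟨h, hh, h1⟩ := hex
    refine ⟨h, hh, fun h0 => ?_⟩
    rw [AbsoluteValue.residue_eq_zero_iff] at h0
    refine h0.ne ?_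
    change w ((a' h).1 : Ω) = 1
    rw [ha' h hh, hvw, h1])
  rw [ne_eq, AbsoluteValue.residue_eq_zero_iff, not_lt] at key
  refine le_antisymm ?_ ?_
  · refine hw.absoluteValue_sum_le _ _ zero_le_one fun h hh => ?_
    rw [map_mul, hvw, apply_eq_of_map_eq hθf ((hr h).trans (hs h).symm), hsw]
    exact mul_le_one₀ (ha h hh) (w.nonneg _) θ.2
  · refine key.trans_eq ?_
    change w ((∑ h ∈ t, a' h * h • θ : O).1 : Ω) = _
    congr 1
    have : ((∑ h ∈ t, a' h * h • θ : O).1 : Ω) =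
      ((algebraMap L Ω).comp O.subtype) (∑ h ∈ t, a' h * h • θ : O) := rfl
    rw [this, map_sum]
    refine Finset.sum_congr rfl fun h hh => ?_
    rw [map_mul]
    have h1 : (algebraMap L Ω).comp O.subtype (a' h) = algebraMap k Ω (a h) := ha' h hh
    have h2 : (algebraMap L Ω).comp O.subtype (h • θ) = s h (θ.1 : Ω) := rfl
    rw [h1, h2, apply_eq_of_map_eq hθf ((hs h).trans (hr h).symm)]

end

/-- An integral normal basis generator for finitely many places at once. -/
theorem exists_normalBasis_generator {k Ω C ι : Type*} [Field k] [Field Ω] [Algebra k Ω] [Group C]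
    [Finite C] [Finite ι] {ρ : (Ω ≃ₐ[k] Ω) →* C} {v : ι → AbsoluteValue k ℝ}
    {w : ι → AbsoluteValue Ω ℝ} (hw : ∀ i, IsNonarchimedean (w i))
    (hweak : ∀ (c : ι → k) (ε : ℝ), 0 < ε → ∃ a : k, ∀ i, v i (a - c i) < ε)
    (hvw : ∀ i x, w i (algebraMap k Ω x) = v i x)
    (hsurj : ∀ i h, ∃ σ : Ω ≃ₐ[k] Ω, (∀ y, w i (σ y) = w i y) ∧ ρ σ = h)
    (hunr : ∀ i, ∀ σ : Ω ≃ₐ[k] Ω, (∀ y, w i (σ y) = w i y) → ρ σ ≠ 1 →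
      ∃ x, (∀ τ, ρ τ = 1 → τ x = x) ∧ w i x ≤ 1 ∧ w i (σ x - x) = 1)
    {r : C → (Ω ≃ₐ[k] Ω)} (hr : ∀ h, ρ (r h) = h) :
    ∃ θ : Ω, (∀ τ, ρ τ = 1 → τ θ = θ) ∧ ∀ i, (∀ σ : Ω ≃ₐ[k] Ω, w i (σ θ) ≤ 1) ∧
      ∀ (s : Finset C) (a : C → k), ∀ h ∈ s,
        v i (a h) ≤ w i (∑ h ∈ s, algebraMap k Ω (a h) * r h θ) := by
  classical
  have := Fintype.ofFinite ι
  choose θ hθf hθ1 hθ using fun i =>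
    exists_local_normalBasis_generator (hw i) (hvw i) (hsurj i) (hunr i)
  obtain ⟨M, hM⟩ := (Set.finite_range fun q : ι × ι × C => w q.1 (r q.2.2 (θ q.2.1))).bddAbove
  have hM' : ∀ j i h, w j (r h (θ i)) < max M 0 + 1 := fun j i h =>
    (hM ⟨(j, i, h), rfl⟩).trans_lt (by linarith [le_max_left M 0])
  have hM0 : 0 < max M 0 + 1 := by linarith [le_max_right M 0]
  choose ε hε using fun i => hweak (fun j => if i = j then 1 else 0) (max M 0 + 1)⁻¹ (by positivity)
  let Θ := ∑ i, algebraMap k Ω (ε i) * θ i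
  have hΘf : ∀ τ, ρ τ = 1 → τ Θ = Θ := fun τ hτ => by
    simp only [Θ, map_sum, map_mul, AlgEquiv.commutes, hθf _ τ hτ]
  have hclose : ∀ j h, w j (r h Θ - r h (θ j)) < 1 := fun j h => by
    have : r h Θ - r h (θ j) =
        ∑ i, algebraMap k Ω (ε i - if i = j then 1 else 0) * r h (θ i) := by
      simp only [Θ, map_sum, map_mul, AlgEquiv.commutes, map_sub, sub_mul, Finset.sum_sub_distrib]
      congr 1
      rw [Finset.sum_eq_single j (fun i _ hi => by rw [if_neg hi, map_zero, zero_mul])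
        (fun hj => absurd (Finset.mem_univ j) hj), if_pos rfl, map_one, one_mul]
    rw [this]
    refine (hw j).absoluteValue_sum_lt _ _ one_pos fun i _ => ?_
    rw [map_mul, hvw]
    calc _ ≤ v j (ε i - if i = j then 1 else 0) * (max M 0 + 1) :=
          mul_le_mul_of_nonneg_left (hM' j i h).le ((v j).nonneg _)
      _ < (max M 0 + 1)⁻¹ * (max M 0 + 1) := mul_lt_mul_of_pos_right (hε i j) hM0
      _ = 1 := inv_mul_cancel₀ hM0.ne'
  refine ⟨Θ, hΘf, fun j => ⟨fun σ => ?_, fun s a h hh => ?_⟩⟩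
  · rw [apply_eq_of_map_eq hΘf (hr (ρ σ)).symm]
    have := hw j (r (ρ σ) Θ - r (ρ σ) (θ j)) (r (ρ σ) (θ j))
    rw [sub_add_cancel] at this
    exact this.trans (max_le (hclose j _).le (hθ1 j _))
  · obtain ⟨h₀, hh₀, hmax⟩ := s.exists_max_image (fun h => v j (a h)) ⟨h, hh⟩
    refine (hmax h hh).trans ?_
    rcases eq_or_ne (a h₀) 0 with h0 | h0
    · rw [h0, map_zero]; exact (w j).nonneg _
    let b : C → k := fun h => (a h₀)⁻¹ * a h
    have hb : ∀ h ∈ s, v j (b h) ≤ 1 := fun h hh => by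
      simp only [b, map_mul, map_inv₀]
      rw [inv_mul_le_one₀ ((v j).pos h0)]
      exact hmax h hh
    have hb₀ : v j (b h₀) = 1 := by simp only [b, inv_mul_cancel₀ h0, map_one]
    have h1 := hθ j r hr s b hb ⟨h₀, hh₀, hb₀⟩
    have h2 : w j (∑ h ∈ s, algebraMap k Ω (b h) * r h Θ) = 1 := by
      rw [← h1]
      refine (hw j).absoluteValue_eq_of_sub_lt ?_
      rw [h1, ← Finset.sum_sub_distrib]
      refine (hw j).absoluteValue_sum_lt _ _ one_pos fun h hh => ?_
      rw [← mul_sub, map_mul, hvw]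
      exact (mul_le_of_le_one_left ((w j).nonneg _) (hb h hh)).trans_lt (hclose j h)
    have h3 : ∑ h ∈ s, algebraMap k Ω (a h) * r h Θ =
        algebraMap k Ω (a h₀) * ∑ h ∈ s, algebraMap k Ω (b h) * r h Θ := by
      rw [Finset.mul_sum]
      refine Finset.sum_congr rfl fun h _ => ?_
      rw [← mul_assoc, ← map_mul]
      simp only [b, mul_inv_cancel_left₀ h0]
    rw [h3, map_mul, h2, mul_one, hvw]

section Kummer

variable {k Ω C : Type*} [Field k] [Field Ω] [Algebra k Ω] {e : ℕ}

theorem exists_rootsOfUnity_hom [NeZero e] {ζ : k} (hζ : IsPrimitiveRoot ζ e) {a : k}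
    (ha : a ≠ 0) {α : Ω} (hα : α ^ e = algebraMap k Ω a) :
    ∃ ρ : (Ω ≃ₐ[k] Ω) →* rootsOfUnity e k, ρ.IsSmooth ∧
      ∀ σ, σ α = algebraMap k Ω ((ρ σ : kˣ) : k) * α := by
  have hα0 : α ≠ 0 := by
    rintro rfl
    rw [zero_pow (NeZero.ne e)] at hα
    exact ha ((algebraMap k Ω).injective (by rw [← hα, map_zero]))
  have hex : ∀ σ : Ω ≃ₐ[k] Ω, ∃ u : rootsOfUnity e k, σ α = algebraMap k Ω ((u : kˣ) : k) * α := by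
    intro σ
    have h1 : (σ α / α) ^ e = 1 := by
      rw [div_pow, ← map_pow, hα, AlgEquiv.commutes, div_self]
      exact (map_ne_zero (algebraMap k Ω)).mpr ha
    obtain ⟨j, -, hj⟩ := (hζ.map_of_injective (algebraMap k Ω).injective).eq_pow_of_pow_eq_one h1
    refine ⟨hζ.toRootsOfUnity ^ j, ?_⟩
    rw [← div_eq_iff hα0, ← hj, ← map_pow]
    simp
  choose r hr using hex
  have hinj : ∀ u u' : rootsOfUnity e k, algebraMap k Ω ((u : kˣ) : k) * α =
      algebraMap k Ω ((u' : kˣ) : k) * α → u = u' := fun u u' h =>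
    Subtype.ext (Units.ext ((algebraMap k Ω).injective (mul_right_cancel₀ hα0 h)))
  refine ⟨MonoidHom.mk' r fun σ τ => hinj _ _ ?_, ⟨{α}, Set.finite_singleton α,
    fun σ hσ => hinj _ _ ?_⟩, hr⟩
  · rw [← hr, AlgEquiv.mul_apply, hr τ, map_mul, hr σ, AlgEquiv.commutes]
    rw [MulMemClass.coe_mul, Units.val_mul, map_mul]
    ring
  · rw [MonoidHom.mk'_apply, ← hr, hσ α rfl]
    simp

variable {v : AbsoluteValue k ℝ} {w : AbsoluteValue Ω ℝ}

/-- An element fixed by the decomposition group has the value of an element of the base field. -/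
theorem exists_zpow_eq_of_decomposition_fixed (hw : IsNonarchimedean w)
    (hvw : ∀ x, w (algebraMap k Ω x) = v x)
    (happ : ∀ x, (∀ σ : Ω ≃ₐ[k] Ω, (∀ y, w (σ y) = w y) → σ x = x) →
      ∀ ε > 0, ∃ a : k, w (x - algebraMap k Ω a) < ε)
    {c : ℝ} (hval : ∀ x : k, x ≠ 0 → ∃ n : ℤ, v x = c ^ n) {x : Ω} (hx0 : x ≠ 0)
    (hx : ∀ σ : Ω ≃ₐ[k] Ω, (∀ y, w (σ y) = w y) → σ x = x) : ∃ n : ℤ, w x = c ^ n := by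
  obtain ⟨a, ha⟩ := happ x hx (w x) (w.pos hx0)
  rw [← map_neg_eq_map, neg_sub] at ha
  have h1 := hw.absoluteValue_eq_of_sub_lt ha
  rw [hvw] at h1
  obtain ⟨n, hn⟩ := hval a fun h => by
    rw [h, map_zero] at h1
    exact hx0 (w.eq_zero.mp h1.symm)
  exact ⟨n, by rw [← h1, hn]⟩

/-- A totally ramified Kummer extension is independent of an unramified extension, locally. -/
theorem exists_decomposition_kummer_eq [Group C] [Finite C] [NeZero e] {ζ : k}
    (hζ : IsPrimitiveRoot ζ e) (hw : IsNonarchimedean w) (hvw : ∀ x, w (algebraMap k Ω x) = v x)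
    (happ : ∀ x, (∀ σ : Ω ≃ₐ[k] Ω, (∀ y, w (σ y) = w y) → σ x = x) →
      ∀ ε > 0, ∃ a : k, w (x - algebraMap k Ω a) < ε)
    {c : ℝ} (hc0 : 0 < c) (hc1 : c < 1) (hval : ∀ x : k, x ≠ 0 → ∃ n : ℤ, v x = c ^ n)
    {ρ : (Ω ≃ₐ[k] Ω) →* C}
    (hsurj : ∀ h, ∃ σ : Ω ≃ₐ[k] Ω, (∀ y, w (σ y) = w y) ∧ ρ σ = h)
    {r : C → (Ω ≃ₐ[k] Ω)} (hr : ∀ h, ρ (r h) = h) {θ : Ω} (hθ : ∀ τ, ρ τ = 1 → τ θ = θ)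
    (hθ1 : ∀ σ : Ω ≃ₐ[k] Ω, w (σ θ) ≤ 1)
    (hθa : ∀ (s : Finset C) (a : C → k), ∀ h ∈ s,
      v (a h) ≤ w (∑ h ∈ s, algebraMap k Ω (a h) * r h θ))
    {a : k} (ha : v a = c) {α : Ω} (hα : α ^ e = algebraMap k Ω a)
    {ρe : (Ω ≃ₐ[k] Ω) →* rootsOfUnity e k}
    (hρe : ∀ σ, σ α = algebraMap k Ω ((ρe σ : kˣ) : k) * α) (u : rootsOfUnity e k) (h : C) :
    ∃ σ : Ω ≃ₐ[k] Ω, (∀ y, w (σ y) = w y) ∧ ρe σ = u ∧ ρ σ = h := by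
  classical
  have := Fintype.ofFinite C
  let D : Subgroup (Ω ≃ₐ[k] Ω) :=
    { carrier := {σ | ∀ y, w (σ y) = w y}
      mul_mem' := fun {σ τ} hσ hτ y => (hσ (τ y)).trans (hτ y)
      one_mem' := fun y => rfl
      inv_mem' := fun {σ} hσ y => by
        rw [← hσ, ← AlgEquiv.mul_apply, mul_inv_cancel, AlgEquiv.one_apply] }
  let U : Subgroup (rootsOfUnity e k) := (D ⊓ ρ.ker).map ρe
  let d := Nat.card U
  have hα0 : α ≠ 0 := by
    rintro rfl
    rw [zero_pow (NeZero.ne e)] at hα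
    rw [← hvw, ← hα, map_zero] at ha
    exact hc0.ne ha
  choose s hsD hs using hsurj
  have hwu : ∀ u : rootsOfUnity e k, v ((u : kˣ) : k) = 1 := fun u => by
    have h1 : ((u : kˣ) : k) ^ e = 1 := by
      have := (mem_rootsOfUnity e (u : kˣ)).mp u.2
      rw [← Units.val_pow_eq_pow_val, this, Units.val_one]
    have h2 : v ((u : kˣ) : k) ^ e = 1 := by rw [← map_pow, h1, map_one]
    exact (pow_eq_one_iff_of_nonneg (v.nonneg _) (NeZero.ne e)).mp h2
  have hχ : ∀ σ ∈ D, ∀ τ ∈ D, ρ σ = ρ τ → (ρe σ) ^ d = (ρe τ) ^ d := fun σ hσ τ hτ h => by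
    have h1 : ρe (τ⁻¹ * σ) ∈ U := ⟨τ⁻¹ * σ, ⟨D.mul_mem (D.inv_mem hτ) hσ,
      MonoidHom.mem_ker.mpr (by rw [map_mul, map_inv, h, inv_mul_cancel])⟩, rfl⟩
    have h2 := congrArg Subtype.val (pow_card_eq_one' (x := (⟨_, h1⟩ : U)))
    have h3 : (ρe (τ⁻¹ * σ)) ^ d = 1 := h2
    rw [map_mul, map_inv, mul_pow, inv_pow, inv_mul_eq_one] at h3
    exact h3.symm
  let κ : C → k := fun h => ((((ρe (s h)) ^ d)⁻¹ : rootsOfUnity e k) : kˣ)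
  let z := ∑ h, algebraMap k Ω (κ h) * r h θ
  have hwz : w z = 1 := by
    refine le_antisymm (hw.absoluteValue_sum_le _ _ zero_le_one fun h _ => ?_) ?_
    · rw [map_mul, hvw, hwu, one_mul]; exact hθ1 _
    · exact (hwu _).symm.trans_le (hθa Finset.univ κ 1 (Finset.mem_univ _))
  have hz0 : z ≠ 0 := fun h => by rw [h, map_zero] at hwz; exact zero_ne_one hwz
  have hσz : ∀ σ ∈ D, σ z = algebraMap k Ω (((ρe σ ^ d : rootsOfUnity e k) : kˣ) : k) * z := by
    intro σ hσ
    simp only [z, map_sum, Finset.mul_sum]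
    refine Finset.sum_equiv (Equiv.mulLeft (ρ σ)) (by simp) fun h _ => ?_
    rw [map_mul, AlgEquiv.commutes, Equiv.coe_mulLeft, ← mul_assoc, ← map_mul,
      ← AlgEquiv.mul_apply]
    congr 1
    · congr 1
      have h1 := hχ (s (ρ σ * h)) (hsD _) (σ * s h) (D.mul_mem hσ (hsD h))
        (by rw [hs, map_mul, hs])
      simp only [κ]
      rw [h1, map_mul, mul_pow, mul_inv, ← Units.val_mul, ← Subgroup.coe_mul, mul_inv_cancel_left]
    · exact apply_eq_of_map_eq hθ (by rw [map_mul, hr, hr])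
  have hβ : ∀ σ : Ω ≃ₐ[k] Ω, (∀ y, w (σ y) = w y) → σ (α ^ d / z) = α ^ d / z := fun σ hσ => by
    have hne : algebraMap k Ω (((ρe σ ^ d : rootsOfUnity e k) : kˣ) : k) ≠ 0 :=
      (map_ne_zero _).mpr (Units.ne_zero _)
    rw [map_div₀, hσz σ hσ, map_pow, hρe, mul_pow, ← map_pow]
    have : (((ρe σ : rootsOfUnity e k) : kˣ) : k) ^ d =
      (((ρe σ ^ d : rootsOfUnity e k) : kˣ) : k) := by simp
    rw [this]
    exact mul_div_mul_left _ _ hne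
  obtain ⟨m, hm⟩ := exists_zpow_eq_of_decomposition_fixed hw hvw happ hval
    (div_ne_zero (pow_ne_zero d hα0) hz0) hβ
  rw [map_div₀, hwz, div_one, map_pow] at hm
  have h1 : c ^ (d : ℤ) = c ^ (m * e) := by
    rw [zpow_mul, ← hm, zpow_natCast, zpow_natCast, ← ha, ← hvw, ← hα, map_pow, ← pow_mul,
      ← pow_mul, mul_comm]
  have h2 := zpow_right_injective₀ hc0 hc1.ne h1
  have hcard : Nat.card (rootsOfUnity e k) = e := hζ.card_rootsOfUnity
  have hU : U = ⊤ := by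
    have hfin : Finite (rootsOfUnity e k) := inferInstance
    refine Subgroup.eq_top_of_le_card _ ?_
    rw [hcard]
    exact Nat.le_of_dvd Nat.card_pos (Int.natCast_dvd_natCast.mp ⟨m, by rw [h2, mul_comm]⟩)
  obtain ⟨τ, ⟨hτD, hτ⟩, hτu⟩ : u * (ρe (s h))⁻¹ ∈ U := by rw [hU]; trivial
  refine ⟨τ * s h, D.mul_mem hτD (hsD h), ?_, ?_⟩
  · rw [map_mul, hτu, inv_mul_cancel_right]
  · rw [map_mul, hs, MonoidHom.mem_ker.mp hτ, one_mul]

end Kummer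

theorem AbsoluteValue.eq_one_of_pow_eq_self {k : Type*} [Field k] (v : AbsoluteValue k ℝ) {x : k}
    (hx : x ≠ 0) {q : ℕ} (hq : 1 < q) (h : x ^ q = x) : v x = 1 := by
  obtain ⟨q, rfl⟩ := Nat.exists_eq_succ_of_ne_zero (by omega : q ≠ 0)
  have h1 : x ^ q = 1 := mul_right_cancel₀ hx (by rw [← pow_succ, h, one_mul])
  exact (pow_eq_one_iff_of_nonneg (n := q) (v.nonneg _) (by omega)).mp
    (by rw [← map_pow, h1, map_one])

/-- In a sum of terms with distinct values the largest one dominates. -/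
theorem IsNonarchimedean.exists_absoluteValue_sum_eq {F ι : Type*} [Field F]
    {w : AbsoluteValue F ℝ} (hw : IsNonarchimedean w) (s : Finset ι) (g : ι → F)
    (hdist : ∀ i ∈ s, ∀ j ∈ s, g i ≠ 0 → w (g i) = w (g j) → i = j) (hne : ∃ i ∈ s, g i ≠ 0) :
    ∃ i ∈ s, g i ≠ 0 ∧ w (∑ i ∈ s, g i) = w (g i) := by
  classical
  obtain ⟨i₀, hi₀, hg₀⟩ := hne
  obtain ⟨i, hi, hmax⟩ := s.exists_max_image (fun i => w (g i)) ⟨i₀, hi₀⟩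
  have hgi : g i ≠ 0 := fun h => by
    have := hmax i₀ hi₀
    rw [h, map_zero] at this
    exact this.not_gt (w.pos hg₀)
  refine ⟨i, hi, hgi, hw.absoluteValue_eq_of_sub_lt ?_⟩
  rw [← Finset.sum_erase_eq_sub hi]
  refine hw.absoluteValue_sum_lt _ _ (w.pos hgi) fun j hj => ?_
  rw [Finset.mem_erase] at hj
  exact lt_of_le_of_ne (hmax j hj.2) fun h => hj.1 (hdist i hi j hj.2 hgi h.symm).symm

section Pole

variable {k : Type*} [Field k] {e : ℕ} [NeZero e]

theorem exists_sum_mul_pow_ne_zero {p : ℕ} {ζ : k} (hζ : IsPrimitiveRoot ζ e) (hp : p.Coprime e)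
    [Fintype (rootsOfUnity e k)] {n : rootsOfUnity e k → k} {u₀ : rootsOfUnity e k} (hn : n u₀ ≠ 0)
    (l : ℕ) : ∃ t : Fin e, ∑ u, n u * (((u⁻¹ : rootsOfUnity e k) : kˣ) : k) ^
      (1 + p * (l * e + t)) ≠ 0 := by
  by_contra! hcon
  have hcard : Fintype.card (rootsOfUnity e k) = e := by
    rw [← Nat.card_eq_fintype_card, hζ.card_rootsOfUnity]
  let φ : Fin e ≃ rootsOfUnity e k := (Fintype.equivFinOfCardEq hcard).symm
  let nd : rootsOfUnity e k → k := fun u => (((u⁻¹ : rootsOfUnity e k) : kˣ) : k) ^ p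
  have hnd : Function.Injective nd := fun u u' h => by
    have h1 : (u⁻¹) ^ p = (u'⁻¹) ^ p := Subtype.ext (Units.ext (by simpa [nd] using h))
    have h2 := (powCoprime (G := rootsOfUnity e k) (n := p)
      (by rw [Nat.card_eq_fintype_card, hcard]; exact hp.symm)).injective h1
    exact inv_injective h2
  have h0 := Matrix.eq_zero_of_forall_pow_sum_mul_pow_eq_zero
    (f := fun j => nd (φ j))
    (v := fun j => n (φ j) * ((((φ j)⁻¹ : rootsOfUnity e k) : kˣ) : k) ^ (1 + p * (l * e)))
    (hnd.comp φ.injective) fun t => by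
      rw [← hcon t, ← φ.sum_comp]
      refine Finset.sum_congr rfl fun j _ => ?_
      simp only [nd]
      rw [mul_assoc, ← pow_mul, ← pow_add]
      ring_nf
  have := congrFun h0 (φ.symm u₀)
  simp only [Equiv.apply_symm_apply, Pi.zero_apply, mul_eq_zero, hn, false_or] at this
  exact pow_ne_zero _ (Units.ne_zero _) this

theorem AbsoluteValue.eq_one_of_sum_algebraMap_mul_rootsOfUnity {p : ℕ} [Fact p.Prime]
    [CharP k p] [Algebra (ZMod p) k] (hp : p.Coprime e) (v : AbsoluteValue k ℝ)
    [Fintype (rootsOfUnity e k)] (n : rootsOfUnity e k → ZMod p) (N : ℕ)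
    (h : ∑ u, algebraMap (ZMod p) k (n u) * (((u⁻¹ : rootsOfUnity e k) : kˣ) : k) ^ N ≠ 0) :
    v (∑ u, algebraMap (ZMod p) k (n u) * (((u⁻¹ : rootsOfUnity e k) : kˣ) : k) ^ N) = 1 := by
  have hpp : p.Prime := Fact.out
  refine v.eq_one_of_pow_eq_self h
    (Nat.one_lt_pow (Nat.totient_pos.mpr (NeZero.pos e)).ne' hpp.one_lt) ?_
  rw [sum_pow_char_pow]
  refine Finset.sum_congr rfl fun u _ => ?_
  rw [mul_pow, ← map_pow, ZMod.pow_card_pow, ← pow_mul, mul_comm N, pow_mul]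
  congr 2
  rw [← Units.val_pow_eq_pow_val, ← Subgroup.coe_pow]
  congr 2
  have h1 : (u⁻¹) ^ e = 1 := by
    refine Subtype.ext ?_
    rw [Subgroup.coe_pow]
    exact (mem_rootsOfUnity e _).mp (u⁻¹).2
  have h2 : p ^ e.totient ≡ 1 [MOD e] := Nat.ModEq.pow_totient hp
  conv_rhs => rw [← pow_one u⁻¹]
  rw [pow_eq_pow_iff_modEq]
  exact h2.of_dvd (orderOf_dvd_of_pow_eq_one h1)

/-- The generic combination of conjugates of the elements `θ ∑ α⁻ᴺ` has a pole whose order,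
measured by `α`, is prime to `p`. -/
theorem exists_absoluteValue_sum_conj_eq {p : ℕ} [Fact p.Prime] {Ω C J : Type*} [Field Ω]
    [Algebra k Ω] [Group C] [Fintype C] [Fintype J] [CharP k p] [Algebra (ZMod p) k]
    [Fintype (rootsOfUnity e k)]
    (hp : p.Coprime e) {ζ : k} (hζ : IsPrimitiveRoot ζ e)
    {v : AbsoluteValue k ℝ} {w : AbsoluteValue Ω ℝ} (hw : IsNonarchimedean w)
    {ρ : (Ω ≃ₐ[k] Ω) →* C} {r : C → (Ω ≃ₐ[k] Ω)} (hr : ∀ h, ρ (r h) = h)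
    {θ : Ω} (hθ : ∀ τ, ρ τ = 1 → τ θ = θ) (hvw : ∀ x, w (algebraMap k Ω x) = v x)
    (hθ1 : ∀ σ : Ω ≃ₐ[k] Ω, w (σ θ) ≤ 1)
    (hθa : ∀ (s : Finset C) (a : C → k), ∀ h ∈ s,
      v (a h) ≤ w (∑ h ∈ s, algebraMap k Ω (a h) * r h θ))
    {α : Ω} (hα0 : 0 < w α) (hα1 : w α < 1) {ρe : (Ω ≃ₐ[k] Ω) →* rootsOfUnity e k}
    (hρe : ∀ σ, σ α = algebraMap k Ω ((ρe σ : kˣ) : k) * α)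
    {s : rootsOfUnity e k × C → (Ω ≃ₐ[k] Ω)} (hs : ∀ q, ρe (s q) = q.1 ∧ ρ (s q) = q.2)
    {ν : J → ℕ} (hν : Function.Injective ν) (n : J × (rootsOfUnity e k × C) → ZMod p)
    (hn : n ≠ 0) :
    ∃ N : ℕ, w (∑ q, algebraMap k Ω (algebraMap (ZMod p) k (n q)) *
      s q.2 (θ * ∑ t : Fin e, (α⁻¹) ^ (1 + p * (ν q.1 * e + t)))) * w α ^ (1 + p * N) = 1 := by
  classical
  have hpp : p.Prime := Fact.out
  have hα : α ≠ 0 := w.pos_iff.mp hα0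
  let A : J → Fin e → C → k := fun l t h => ∑ u : rootsOfUnity e k,
    algebraMap (ZMod p) k (n (l, u, h)) *
      (((u⁻¹ : rootsOfUnity e k) : kˣ) : k) ^ (1 + p * (ν l * e + t))
  let g : J × Fin e → Ω := fun i =>
    (α⁻¹) ^ (1 + p * (ν i.1 * e + i.2)) * ∑ h, algebraMap k Ω (A i.1 i.2 h) * r h θ
  have hsum : ∑ q, algebraMap k Ω (algebraMap (ZMod p) k (n q)) *
      s q.2 (θ * ∑ t : Fin e, (α⁻¹) ^ (1 + p * (ν q.1 * e + t))) = ∑ i, g i := by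
    rw [Fintype.sum_prod_type, Fintype.sum_prod_type]
    refine Finset.sum_congr rfl fun l _ => ?_
    rw [Fintype.sum_prod_type]
    simp only [g, A, map_sum, map_mul, Finset.mul_sum, Finset.sum_mul, map_pow, map_inv₀]
    rw [Finset.sum_comm_cycle]
    refine Finset.sum_congr rfl fun t _ => ?_
    rw [Finset.sum_comm]
    refine Finset.sum_congr rfl fun h _ => Finset.sum_congr rfl fun u _ => ?_
    rw [hρe, (hs _).1, apply_eq_of_map_eq hθ ((hs (u, h)).2.trans (hr h).symm), mul_inv, mul_pow,
      Subgroup.coe_inv, Units.val_inv_eq_inv_val, map_inv₀]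
    ring
  have hgw : ∀ i, g i ≠ 0 → w (g i) = (w α)⁻¹ ^ (1 + p * (ν i.1 * e + i.2)) := by
    rintro ⟨l, t⟩ hg
    obtain ⟨h₀, -, hh⟩ := Finset.exists_ne_zero_of_sum_ne_zero (right_ne_zero_of_mul hg)
    have hA : A l t h₀ ≠ 0 := fun h0 => hh (by
      change algebraMap k Ω (A l t h₀) * _ = 0
      rw [h0, map_zero, zero_mul])
    have hA1 : ∀ h, v (A l t h) ≤ 1 := fun h => by
      by_cases h0 : A l t h = 0
      · rw [h0, map_zero]; exact zero_le_one
      · exact (AbsoluteValue.eq_one_of_sum_algebraMap_mul_rootsOfUnity hp v _ _ h0).le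
    simp only [g]
    rw [map_mul, map_pow, map_inv₀]
    refine mul_eq_left₀ (pow_ne_zero _ (inv_ne_zero hα0.ne')) |>.mpr (le_antisymm ?_ ?_)
    · refine hw.absoluteValue_sum_le _ _ zero_le_one fun h _ => ?_
      rw [map_mul, hvw]
      exact mul_le_one₀ (hA1 h) (w.nonneg _) (hθ1 _)
    · exact (AbsoluteValue.eq_one_of_sum_algebraMap_mul_rootsOfUnity hp v _ _ hA).symm.trans_le
        (hθa Finset.univ (A l t) h₀ (Finset.mem_univ _))
  have hinv1 : 1 < (w α)⁻¹ := (one_lt_inv₀ hα0).mpr hα1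
  obtain ⟨⟨l₀, u₀, h₀⟩, hn₀⟩ := Function.ne_iff.mp hn
  obtain ⟨t₀, ht₀⟩ := exists_sum_mul_pow_ne_zero hζ hp
    (n := fun u => algebraMap (ZMod p) k (n (l₀, u, h₀))) (u₀ := u₀)
    ((map_ne_zero (algebraMap (ZMod p) k)).mpr hn₀) (ν l₀)
  have hne : g (l₀, t₀) ≠ 0 := by
    refine mul_ne_zero (pow_ne_zero _ (inv_ne_zero hα)) fun h0 => ?_
    have h1 := hθa Finset.univ (A l₀ t₀) h₀ (Finset.mem_univ _)
    rw [h0, map_zero, AbsoluteValue.eq_one_of_sum_algebraMap_mul_rootsOfUnity hp v _ _ ht₀] at h1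
    exact absurd h1 (by norm_num)
  obtain ⟨⟨l, t⟩, -, hg0, hg⟩ := hw.exists_absoluteValue_sum_eq Finset.univ g (by
    rintro ⟨l, t⟩ - ⟨l', t'⟩ - hg heq
    have hg' : g (l', t') ≠ 0 := fun h0 => by
      rw [h0, map_zero] at heq
      exact hg (w.eq_zero.mp heq)
    rw [hgw _ hg, hgw _ hg'] at heq
    have h1 := pow_right_injective₀ (inv_pos.mpr hα0) hinv1.ne' heq
    simp only [add_right_inj, mul_eq_mul_left_iff, hpp.ne_zero, or_false] at h1
    have h2 : ν l = ν l' := by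
      have h3 := congrArg (· / e) h1
      simp only [add_comm _ (t : ℕ), add_comm _ (t' : ℕ)] at h3
      rwa [Nat.add_mul_div_right _ _ (NeZero.pos e), Nat.add_mul_div_right _ _ (NeZero.pos e),
        Nat.div_eq_of_lt t.2, Nat.div_eq_of_lt t'.2, zero_add, zero_add] at h3
    rw [h2, add_right_inj] at h1
    rw [hν h2, Fin.ext h1]) ⟨_, Finset.mem_univ _, hne⟩
  refine ⟨ν l * e + t, ?_⟩
  rw [hsum, hg, hgw _ hg0, ← mul_pow, inv_mul_cancel₀ hα0.ne', one_pow]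

end Pole

/-- The Artin–Schreier extension attached to elements whose combinations all have poles of order
prime to `p` is locally as large as possible. -/
theorem exists_decomposition_artinSchreier_eq {p : ℕ} [Fact p.Prime] {k Ω H J : Type*} [Field k]
    [Field Ω] [Algebra k Ω] [Group H] [Fintype H] [Fintype J] [CharP Ω p] [Algebra (ZMod p) Ω]
    {v : AbsoluteValue k ℝ} {w : AbsoluteValue Ω ℝ} (hw : IsNonarchimedean w)
    (hvw : ∀ x, w (algebraMap k Ω x) = v x)
    (happ : ∀ x, (∀ σ : Ω ≃ₐ[k] Ω, (∀ y, w (σ y) = w y) → σ x = x) →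
      ∀ ε > 0, ∃ a : k, w (x - algebraMap k Ω a) < ε)
    {c : ℝ} (hc0 : 0 < c) (hc1 : c < 1) (hval : ∀ x : k, x ≠ 0 → ∃ n : ℤ, v x = c ^ n)
    {ρ : (Ω ≃ₐ[k] Ω) →* H}
    (hsurj : ∀ h, ∃ σ : Ω ≃ₐ[k] Ω, (∀ y, w (σ y) = w y) ∧ ρ σ = h)
    (hH : ¬ p ∣ Nat.card H) {e : ℕ} (X : J → H → Ω)
    (hX : ∀ n : J × H → ZMod p, n ≠ 0 → ∃ N : ℕ, 0 < N ∧ ¬ p ∣ N ∧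
      w (∑ q, algebraMap (ZMod p) Ω (n q) * X q.1 q.2) ^ e * c ^ N = 1)
    {y : J → H → Ω} (hy : ∀ l τ, y l τ ^ p - y l τ = X l τ)
    {b : (Ω ≃ₐ[k] Ω) → J × H → ZMod p}
    (hb : ∀ σ l τ, algebraMap (ZMod p) Ω (b σ (l, τ)) = σ (y l ((ρ σ)⁻¹ * τ)) - y l τ)
    (g : J × H → ZMod p) : ∃ σ : Ω ≃ₐ[k] Ω, (∀ y, w (σ y) = w y) ∧ ρ σ = 1 ∧ b σ = g := by
  classical
  have hpp : p.Prime := Fact.out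
  choose s hsD hs using hsurj
  have hinj := (algebraMap (ZMod p) Ω).injective
  have hfix : ∀ (σ : Ω ≃ₐ[k] Ω) (x : ZMod p),
      σ (algebraMap (ZMod p) Ω x) = algebraMap (ZMod p) Ω x :=
    fun σ x => RingHom.congr_fun (RingHom.ext_zmod
      ((σ : Ω →+* Ω).comp (algebraMap (ZMod p) Ω)) (algebraMap (ZMod p) Ω)) x
  have hb1 : ∀ σ, ρ σ = 1 → ∀ l τ, σ (y l τ) = y l τ + algebraMap (ZMod p) Ω (b σ (l, τ)) :=
    fun σ hσ l τ => by rw [hb, hσ, inv_one, one_mul, add_sub_cancel]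
  let W : AddSubgroup (J × H → ZMod p) :=
    { carrier := {g | ∃ σ : Ω ≃ₐ[k] Ω, (∀ y, w (σ y) = w y) ∧ ρ σ = 1 ∧ b σ = g}
      zero_mem' := ⟨1, fun _ => rfl, map_one ρ, funext fun q => hinj (by
        rw [hb, map_one, inv_one, one_mul, AlgEquiv.one_apply, sub_self, Pi.zero_apply, map_zero])⟩
      add_mem' := by
        rintro _ _ ⟨σ, hσ, hρσ, rfl⟩ ⟨τ, hτ, hρτ, rfl⟩
        have h1 : ρ (σ * τ) = 1 := by rw [map_mul, hρσ, hρτ, one_mul]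
        refine ⟨σ * τ, fun y => (hσ _).trans (hτ y), h1, funext fun q => hinj ?_⟩
        have h2 := hb1 _ h1 q.1 q.2
        rw [AlgEquiv.mul_apply, hb1 _ hρτ, map_add, hfix, hb1 _ hρσ, add_assoc] at h2
        rw [Pi.add_apply, map_add]
        exact (add_left_cancel h2).symm
      neg_mem' := by
        rintro _ ⟨σ, hσ, hρσ, rfl⟩
        have h1 : ρ σ⁻¹ = 1 := by rw [map_inv, hρσ, inv_one]
        refine ⟨σ⁻¹, fun y => ?_, h1, funext fun q => hinj ?_⟩
        · rw [← hσ, ← AlgEquiv.mul_apply, mul_inv_cancel, AlgEquiv.one_apply]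
        have h2 := congrArg (fun z => (σ⁻¹ : Ω ≃ₐ[k] Ω) z) (hb1 _ hρσ q.1 q.2)
        rw [← AlgEquiv.mul_apply, inv_mul_cancel, AlgEquiv.one_apply, map_add, hfix,
          hb1 _ h1] at h2
        rw [Pi.neg_apply, map_neg]
        linear_combination -h2 }
  by_contra hcon
  have hlt : AddSubgroup.toZModSubmodule p W < ⊤ := lt_top_iff_ne_top.mpr fun h => hcon (by
    have : g ∈ AddSubgroup.toZModSubmodule p W := by rw [h]; trivial
    exact this)
  obtain ⟨φ, hφ0, hφ⟩ := Submodule.exists_le_ker_of_lt_top _ hlt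
  let n : J × H → ZMod p := fun q => φ (Pi.single q 1)
  have hφn : ∀ g, φ g = ∑ q, g q * n q := fun g => by
    conv_lhs => rw [← Finset.univ_sum_single g]
    rw [map_sum]
    refine Finset.sum_congr rfl fun q _ => ?_
    rw [← smul_eq_mul, ← map_smul, ← Pi.single_smul', smul_eq_mul, mul_one]
  have hn : n ≠ 0 := fun h => hφ0 (LinearMap.ext fun g => by rw [hφn, h]; simp)
  obtain ⟨N, hN0, hpN, hwX⟩ := hX n hn
  set x := ∑ q, algebraMap (ZMod p) Ω (n q) * X q.1 q.2 with hx
  let Y := ∑ q, algebraMap (ZMod p) Ω (n q) * y q.1 q.2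
  have hYX : Y ^ p - Y = x := by
    simp only [Y]
    rw [sum_pow_char, ← Finset.sum_sub_distrib]
    refine Finset.sum_congr rfl fun q _ => ?_
    rw [mul_pow, ← map_pow, ZMod.pow_card, ← hy]
    ring
  have hx0 : 0 < w x := w.pos fun h => by
    rw [h, map_zero] at hwX
    rcases Nat.eq_zero_or_pos e with he | he
    · rw [he, pow_zero, one_mul] at hwX
      exact (pow_lt_one₀ hc0.le hc1 hN0.ne').ne hwX
    · rw [zero_pow he.ne', zero_mul] at hwX
      exact zero_ne_one hwX
  have hx1 : 1 < w x := by
    by_contra! h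
    have h1 := mul_lt_mul_of_pos_left (pow_lt_one₀ hc0.le hc1 hN0.ne') (pow_pos hx0 e)
    rw [hwX, mul_one] at h1
    exact (pow_le_one₀ hx0.le h).not_gt h1
  have hY1 : 1 < w Y := by
    by_contra! h
    have h1 := hw.absoluteValue_sub_le (Y ^ p) Y
    rw [hYX, map_pow] at h1
    exact (h1.trans (max_le (pow_le_one₀ (w.nonneg _) h) h)).not_gt hx1
  have hYp : w x = w Y ^ p := by
    rw [← map_pow]
    refine hw.absoluteValue_eq_of_sub_lt ?_
    rw [← hYX, sub_sub_cancel_left, map_neg_eq_map, map_pow]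
    exact lt_self_pow₀ hY1 hpp.one_lt
  have hYfix : ∀ σ : Ω ≃ₐ[k] Ω, (∀ y, w (σ y) = w y) → ρ σ = 1 → σ Y = Y := by
    intro σ hσ hρ
    have h1 : φ (b σ) = 0 := hφ (show b σ ∈ W from ⟨σ, hσ, hρ, rfl⟩)
    rw [hφn] at h1
    simp only [Y, map_sum, map_mul, hfix, hb1 σ hρ, mul_add, Finset.sum_add_distrib]
    rw [add_eq_left, ← map_zero (algebraMap (ZMod p) Ω), ← h1, map_sum]
    refine Finset.sum_congr rfl fun q _ => ?_
    rw [map_mul, mul_comm]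
  let Z := ∏ τ : H, s τ Y
  have hZ : ∀ σ : Ω ≃ₐ[k] Ω, (∀ y, w (σ y) = w y) → σ Z = Z := by
    intro σ hσ
    simp only [Z, map_prod]
    refine Fintype.prod_equiv (Equiv.mulLeft (ρ σ)) _ _ fun τ => ?_
    rw [Equiv.coe_mulLeft, ← AlgEquiv.mul_apply]
    have h1 := hYfix ((s (ρ σ * τ))⁻¹ * (σ * s τ)) (fun y => by
      rw [← hsD (ρ σ * τ), ← AlgEquiv.mul_apply, mul_inv_cancel_left]
      exact (hσ _).trans (hsD _ _)) (by
      rw [map_mul, map_inv, hs, map_mul, hs, inv_mul_cancel])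
    conv_rhs => rw [← h1]
    rw [← AlgEquiv.mul_apply, mul_inv_cancel_left]
  have hwZ : w Z = w Y ^ Nat.card H := by
    simp only [Z, map_prod, hsD]
    rw [Finset.prod_const, Finset.card_univ, Nat.card_eq_fintype_card]
  have hZ0 : Z ≠ 0 := fun h => by
    rw [h, map_zero] at hwZ
    exact (pow_pos (one_pos.trans hY1) _).ne hwZ
  obtain ⟨m, hm⟩ := exists_zpow_eq_of_decomposition_fixed hw hvw happ hval hZ0 hZ
  have h1 : c ^ ((N * Nat.card H : ℕ) : ℤ) = c ^ (-(m * (p * e : ℕ))) := by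
    rw [zpow_neg, zpow_mul, ← hm, hwZ, zpow_natCast, zpow_natCast, eq_comm, inv_eq_iff_eq_inv,
      ← pow_mul, mul_comm (Nat.card H), mul_assoc, pow_mul, ← hYp, pow_mul, pow_mul,
      ← inv_pow, eq_inv_of_mul_eq_one_left hwX]
  have h2 := zpow_right_injective₀ hc0 hc1.ne h1
  have h3 : p ∣ N * Nat.card H := Int.natCast_dvd_natCast.mp
    ⟨-(m * e), by rw [h2]; push_cast; ring⟩
  exact (hpp.dvd_mul.mp h3).elim hpN hH

/-- The arithmetic input: a tame abelian extension together with a generic Artin–Schreier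
extension of it, both as large as possible at finitely many given places. -/
theorem exists_smooth_hom_and_cocycle {p : ℕ} [Fact p.Prime] {k Ω ι : Type*} [Finite ι]
    [Nonempty ι] (E J : Type*) [Finite J] [Field k] [Field Ω] [Algebra k Ω] [CharP k p]
    [IsGalois k Ω] [IsSepClosed Ω] [Field E] [CharP E p] [Finite E]
    {v : ι → AbsoluteValue k ℝ} {w : ι → AbsoluteValue Ω ℝ} (hv : ∀ i, IsNonarchimedean (v i))
    (hfin : ∀ i, Finite (IsLocalRing.ResidueField ((v i).valuationRing (hv i))))
    (hweak : ∀ (c : ι → k) (ε : ℝ), 0 < ε → ∃ a : k, ∀ i, v i (a - c i) < ε)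
    (hvw : ∀ i x, w i (algebraMap k Ω x) = v i x) (hw : ∀ i, IsNonarchimedean (w i))
    (happ : ∀ i x, (∀ σ : Ω ≃ₐ[k] Ω, (∀ y, w i (σ y) = w i y) → σ x = x) →
      ∀ ε > 0, ∃ a : k, w i (x - algebraMap k Ω a) < ε)
    {c : ι → ℝ} (hc0 : ∀ i, 0 < c i) (hc1 : ∀ i, c i < 1) (hc : ∀ i, ∃ x, v i x = c i)
    (hval : ∀ i, ∀ x : k, x ≠ 0 → ∃ n : ℤ, v i x = c i ^ n)
    {e : ℕ} [NeZero e] (hp : p.Coprime e) {ζ : k} (hζ : IsPrimitiveRoot ζ e) :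
    ∃ (ρ : (Ω ≃ₐ[k] Ω) →* rootsOfUnity e k × Eˣ)
      (b : (Ω ≃ₐ[k] Ω) → J × (rootsOfUnity e k × Eˣ) → ZMod p),
      (∃ T : Set Ω, T.Finite ∧ ∀ σ : Ω ≃ₐ[k] Ω, (∀ x ∈ T, σ x = x) → ρ σ = 1 ∧ b σ = 0) ∧
      (∀ σ τ l h, b (σ * τ) (l, h) = b σ (l, h) + b τ (l, (ρ σ)⁻¹ * h)) ∧
      ∀ i h g, ∃ σ : Ω ≃ₐ[k] Ω, (∀ y, w i (σ y) = w i y) ∧ ρ σ = h ∧ b σ = g := by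
  classical
  have hpp : p.Prime := Fact.out
  have : CharP Ω p := charP_of_injective_algebraMap (algebraMap k Ω).injective p
  let : Algebra (ZMod p) k := ZMod.algebra k p
  let : Algebra (ZMod p) Ω := ZMod.algebra Ω p
  have := Fintype.ofFinite J
  have := Fintype.ofFinite Eˣ
  have := Fintype.ofFinite (rootsOfUnity e k)
  obtain ⟨ρC, hρC, hρCi⟩ := exists_smooth_units_map (p := p) E hv hfin hweak hvw hw happ
  have hi₀ : Nonempty ι := inferInstance
  obtain ⟨i₀⟩ := hi₀
  choose r hrw hr using (hρCi i₀).1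
  obtain ⟨θ, hθ, hθi⟩ := exists_normalBasis_generator hw hweak hvw (fun i => (hρCi i).1)
    (fun i => (hρCi i).2) hr
  obtain ⟨a, ha⟩ : ∃ a, ∀ i, v i a = c i := by
    choose x hx using hc
    obtain ⟨i₁, hi₁⟩ := Finite.exists_min c
    obtain ⟨a, ha⟩ := hweak x (c i₁) (hc0 i₁)
    refine ⟨a, fun i => ?_⟩
    rw [(hv i).absoluteValue_eq_of_sub_lt ((ha i).trans_le ((hi₁ i).trans_eq (hx i).symm)), hx]
  have ha0 : a ≠ 0 := fun h => by
    have := ha i₀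
    rw [h, map_zero] at this
    exact (hc0 i₀).ne this
  have : NeZero (e : Ω) := ⟨fun h => by
    rw [CharP.cast_eq_zero_iff Ω p] at h
    exact hpp.one_lt.ne' (hp.eq_one_of_dvd h)⟩
  obtain ⟨α, hα⟩ := IsSepClosed.exists_pow_nat_eq (algebraMap k Ω a) e
  obtain ⟨ρe, hρe, hρeα⟩ := exists_rootsOfUnity_hom hζ ha0 hα
  have hjoint := fun i u h => exists_decomposition_kummer_eq hζ (hw i) (hvw i) (happ i) (hc0 i)
    (hc1 i) (hval i) (hρCi i).1 hr hθ (hθi i).1 (hθi i).2 (ha i) hα hρeα u h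
  let ρ := ρe.prod ρC
  have hsurj : ∀ i h, ∃ σ : Ω ≃ₐ[k] Ω, (∀ y, w i (σ y) = w i y) ∧ ρ σ = h := fun i h => by
    obtain ⟨σ, hσ, h1, h2⟩ := hjoint i h.1 h.2
    exact ⟨σ, hσ, Prod.ext h1 h2⟩
  choose s hsw hs using hsurj i₀
  let ν : J → ℕ := fun l => Fintype.equivFin J l
  have hν : Function.Injective ν := Fin.val_injective.comp (Fintype.equivFin J).injective
  let x : J → Ω := fun l => θ * ∑ t : Fin e, (α⁻¹) ^ (1 + p * (ν l * e + t))
  have hx : ∀ l τ, ρ τ = 1 → τ (x l) = x l := fun l τ hτ => by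
    have h1 : τ α = α := by
      rw [hρeα, show ρe τ = 1 from congrArg Prod.fst hτ]
      simp
    simp only [x, map_mul, map_sum, map_pow, map_inv₀, h1, hθ τ (congrArg Prod.snd hτ)]
  choose y hy using fun l τ => IsSepClosed.exists_pow_sub_self_eq (p := p) (s τ (x l))
  have hbex : ∀ σ : Ω ≃ₐ[k] Ω, ∀ q : J × (rootsOfUnity e k × Eˣ), ∃ n : ZMod p,
      algebraMap (ZMod p) Ω n = σ (y q.1 ((ρ σ)⁻¹ * q.2)) - y q.1 q.2 := fun σ q => by
    refine exists_algebraMap_eq_of_pow_eq_self ?_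
    have h1 : σ (s ((ρ σ)⁻¹ * q.2) (x q.1)) = s q.2 (x q.1) := by
      rw [← AlgEquiv.mul_apply]
      exact apply_eq_of_map_eq (hx q.1) (by rw [map_mul, hs, hs, mul_inv_cancel_left])
    rw [← hy, ← hy, map_sub, map_pow] at h1
    rw [sub_pow_char]
    linear_combination h1
  choose b hb using hbex
  have hinj := (algebraMap (ZMod p) Ω).injective
  have hfix : ∀ (σ : Ω ≃ₐ[k] Ω) (x : ZMod p),
      σ (algebraMap (ZMod p) Ω x) = algebraMap (ZMod p) Ω x :=
    fun σ x => RingHom.congr_fun (RingHom.ext_zmod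
      ((σ : Ω →+* Ω).comp (algebraMap (ZMod p) Ω)) (algebraMap (ZMod p) Ω)) x
  have hcoc : ∀ σ τ l h, b (σ * τ) (l, h) = b σ (l, h) + b τ (l, (ρ σ)⁻¹ * h) := by
    intro σ τ l h
    refine hinj ?_
    have h1 := congrArg (fun z => σ z) (hb τ (l, (ρ σ)⁻¹ * h))
    simp only [hfix, map_sub] at h1
    rw [map_add, h1, hb, hb, map_mul, mul_inv_rev, AlgEquiv.mul_apply, ← mul_assoc]
    ring
  refine ⟨ρ, b, ?_, hcoc, fun i h g => ?_⟩
  · obtain ⟨T₁, hT₁, h₁⟩ := hρe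
    obtain ⟨T₂, hT₂, h₂⟩ := hρC
    refine ⟨T₁ ∪ T₂ ∪ Set.range fun q : J × (rootsOfUnity e k × Eˣ) => y q.1 q.2,
      (hT₁.union hT₂).union (Set.finite_range _), fun σ hσ => ?_⟩
    have hρ1 : ρ σ = 1 := Prod.ext (h₁ σ fun x hx => hσ x (Or.inl (Or.inl hx)))
      (h₂ σ fun x hx => hσ x (Or.inl (Or.inr hx)))
    refine ⟨hρ1, funext fun q => hinj ?_⟩
    rw [hb, hρ1, inv_one, one_mul, hσ _ (Or.inr ⟨q, rfl⟩), sub_self, Pi.zero_apply, map_zero]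
  · have hwα : w i α ^ e = c i := by rw [← map_pow, hα, hvw, ha]
    have hα0 : 0 < w i α := (w i).pos fun h => by
      rw [h, map_zero, zero_pow (NeZero.ne e)] at hwα
      exact (hc0 i).ne hwα
    have hα1 : w i α < 1 := by
      by_contra! h
      exact (hc1 i).not_ge (hwα ▸ one_le_pow₀ h)
    have hcard : ¬ p ∣ Nat.card (rootsOfUnity e k × Eˣ) := by
      rw [Nat.card_prod, hζ.card_rootsOfUnity, hpp.dvd_mul, not_or]
      refine ⟨fun h => hpp.one_lt.ne' (hp.eq_one_of_dvd h), fun h => ?_⟩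
      let : Algebra (ZMod p) E := ZMod.algebra E p
      have h1 : Nat.card Eˣ = Nat.card E - 1 := Nat.card_units E
      have h2 : p ∣ Nat.card E := by
        rw [Module.natCard_eq_pow_finrank (K := ZMod p), Nat.card_zmod]
        exact dvd_pow_self p Module.finrank_pos.ne'
      have h3 : 1 < Nat.card E := Finite.one_lt_card
      have h4 := (Nat.dvd_sub_iff_right h3.le h2).mp (h1 ▸ h)
      exact hpp.one_lt.ne' (Nat.dvd_one.mp h4)
    obtain ⟨σ, hσ, hρσ⟩ := hsurj i h
    obtain ⟨τ, hτ, hρτ, hbτ⟩ := exists_decomposition_artinSchreier_eq (hw i) (hvw i) (happ i)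
      (hc0 i) (hc1 i) (hval i) (hsurj i) hcard (e := e) (fun l τ => s τ (x l)) (fun n hn => by
        obtain ⟨N, hN⟩ := exists_absoluteValue_sum_conj_eq hp hζ (hw i) hr hθ (hvw i) (hθi i).1
          (hθi i).2 hα0 hα1 hρeα (s := s) (fun q => ⟨congrArg Prod.fst (hs q),
            congrArg Prod.snd (hs q)⟩) hν n hn
        refine ⟨1 + p * N, by omega, fun h => ?_, ?_⟩
        · rw [Nat.dvd_add_left (dvd_mul_right p N)] at h
          exact hpp.one_lt.ne' (Nat.dvd_one.mp h)
        · rw [← hwα, ← pow_mul, mul_comm e, pow_mul, ← mul_pow]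
          refine (congrArg (· ^ e) ?_).trans (one_pow e)
          refine Eq.trans ?_ hN
          congr 2
          refine Finset.sum_congr rfl fun q _ => ?_
          congr 1
          exact RingHom.congr_fun (RingHom.ext_zmod (algebraMap (ZMod p) Ω)
            ((algebraMap k Ω).comp (algebraMap (ZMod p) k))) _) hy (fun σ l τ => hb σ (l, τ))
      (g - b σ)
    refine ⟨τ * σ, fun y => (hτ _).trans (hσ y), by rw [map_mul, hρτ, hρσ, one_mul],
      funext fun q => ?_⟩
    rw [hcoc, hρτ, inv_one, one_mul, hbτ, Pi.sub_apply, sub_add_cancel]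

theorem IsCyclic.exists_surjective_zmod {C : Type*} [Group C] [Finite C] (hC : IsCyclic C) {m : ℕ}
    (hm : m ∣ Nat.card C) : ∃ φ : C →* Multiplicative (ZMod m), Function.Surjective φ :=
  ⟨(AddMonoidHom.toMultiplicative (ZMod.castHom hm (ZMod m)).toAddMonoidHom).comp
    (zmodCyclicMulEquiv hC).symm.toMonoidHom,
    (ZMod.castHom_surjective hm).comp (zmodCyclicMulEquiv hC).symm.surjective⟩

/-- A proper subgroup of a finite `p`-group is killed by a nontrivial character of order `p`. -/
theorem IsPGroup.exists_hom_zmod_ne_one {p : ℕ} [Fact p.Prime] {P : Type*} [Group P] [Finite P]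
    (hP : IsPGroup p P) {Y : Subgroup P} (hY : Y ≠ ⊤) :
    ∃ φ : P →* Multiplicative (ZMod p), φ ≠ 1 ∧ ∀ y ∈ Y, φ y = 1 := by
  have hpp : p.Prime := Fact.out
  have := hP.isNilpotent
  obtain ⟨M, hM, hYM⟩ := (eq_top_or_exists_le_coatom Y).resolve_left hY
  have hMn : M.Normal := Subgroup.NormalizerCondition.normal_of_coatom M
    Group.normalizerCondition_of_isNilpotent hM
  obtain ⟨x, hx⟩ : ∃ x, x ∉ M := by
    by_contra! h
    exact hM.1 (top_le_iff.mp fun x _ => h x)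
  have hcyc : IsCyclic (P ⧸ M) := ⟨⟨(x : P ⧸ M), fun q => by
    have h1 : (Subgroup.zpowers (x : P ⧸ M)).comap (QuotientGroup.mk' M) = ⊤ := by
      refine hM.2 _ (lt_of_le_of_ne (fun m hm => ?_) fun h => hx ?_)
      · rw [Subgroup.mem_comap, QuotientGroup.mk'_apply, (QuotientGroup.eq_one_iff m).mpr hm]
        exact Subgroup.one_mem _
      · rw [h]
        exact Subgroup.mem_zpowers (x : P ⧸ M)
    obtain ⟨y, rfl⟩ := QuotientGroup.mk'_surjective M q
    have : y ∈ (Subgroup.zpowers (x : P ⧸ M)).comap (QuotientGroup.mk' M) := by rw [h1]; trivial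
    exact this⟩⟩
  have hx1 : (x : P ⧸ M) ≠ 1 := fun h => hx ((QuotientGroup.eq_one_iff x).mp h)
  have hcard : p ∣ Nat.card (P ⧸ M) := by
    obtain ⟨n, hn⟩ := (hP.to_quotient M).exists_card_eq
    rw [hn]
    refine dvd_pow_self p ?_
    rintro rfl
    rw [pow_zero, Nat.card_eq_one_iff_unique] at hn
    exact hx1 (hn.1.elim _ _)
  obtain ⟨φ, hφ⟩ := hcyc.exists_surjective_zmod hcard
  refine ⟨φ.comp (QuotientGroup.mk' M), fun h => ?_, fun y hy => ?_⟩
  · have : Fact (1 < p) := ⟨hpp.one_lt⟩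
    obtain ⟨q, hq⟩ := hφ (Multiplicative.ofAdd 1)
    obtain ⟨y, rfl⟩ := QuotientGroup.mk'_surjective M q
    have h1 : φ (QuotientGroup.mk' M y) = 1 := DFunLike.congr_fun h y
    rw [hq] at h1
    exact one_ne_zero (α := ZMod p) h1
  · rw [MonoidHom.comp_apply, QuotientGroup.mk'_apply, (QuotientGroup.eq_one_iff y).mpr (hYM hy),
      map_one]

section Residual

variable {Γ : Type*} [Group Γ] {p : ℕ}

/-- The intersection of the kernels of all characters of order `p` of a subgroup. -/
def Subgroup.zmodResidual (p : ℕ) (P : Subgroup Γ) : Subgroup Γ :=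
  (⨅ φ : P →* Multiplicative (ZMod p), φ.ker).map P.subtype

theorem Subgroup.mem_zmodResidual {P : Subgroup Γ} {x : Γ} :
    x ∈ P.zmodResidual p ↔ ∃ h : x ∈ P, ∀ φ : P →* Multiplicative (ZMod p), φ ⟨x, h⟩ = 1 := by
  simp only [Subgroup.zmodResidual, Subgroup.mem_map, Subgroup.mem_iInf, MonoidHom.mem_ker]
  constructor
  · rintro ⟨y, hy, rfl⟩
    exact ⟨y.2, hy⟩
  · rintro ⟨h, hx⟩
    exact ⟨⟨x, h⟩, hx, rfl⟩

theorem Subgroup.zmodResidual_le (P : Subgroup Γ) : P.zmodResidual p ≤ P :=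
  fun _ h => (Subgroup.mem_zmodResidual.mp h).1

instance Subgroup.zmodResidual_normal (P : Subgroup Γ) [P.Normal] : (P.zmodResidual p).Normal where
  conj_mem x hx γ := by
    obtain ⟨h, hφ⟩ := Subgroup.mem_zmodResidual.mp hx
    exact Subgroup.mem_zmodResidual.mpr ⟨‹P.Normal›.conj_mem x h γ, fun φ =>
      hφ (φ.comp (MulEquiv.toMonoidHom (MulAut.conjNormal (H := P) γ)))⟩

theorem Subgroup.commute_mk_zmodResidual (P : Subgroup Γ) [(P.zmodResidual p).Normal] {x y : Γ}
    (hx : x ∈ P) (hy : y ∈ P) :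
    (x : Γ ⧸ P.zmodResidual p) * y = (y : Γ ⧸ P.zmodResidual p) * x := by
  rw [← QuotientGroup.mk_mul, ← QuotientGroup.mk_mul, QuotientGroup.eq]
  refine Subgroup.mem_zmodResidual.mpr
    ⟨P.mul_mem (P.inv_mem (P.mul_mem hx hy)) (P.mul_mem hy hx), fun φ => ?_⟩
  have : φ ((⟨x, hx⟩ * ⟨y, hy⟩)⁻¹ * (⟨y, hy⟩ * ⟨x, hx⟩)) = 1 := by
    simp only [map_mul, map_inv]
    rw [mul_comm (φ ⟨y, hy⟩), inv_mul_cancel]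
  exact this

theorem Subgroup.mk_pow_zmodResidual (P : Subgroup Γ) [(P.zmodResidual p).Normal] {x : Γ}
    (hx : x ∈ P) : (x : Γ ⧸ P.zmodResidual p) ^ p = 1 := by
  rw [← QuotientGroup.mk_pow, QuotientGroup.eq_one_iff]
  refine Subgroup.mem_zmodResidual.mpr ⟨P.pow_mem hx p, fun φ => ?_⟩
  have : φ (⟨x, hx⟩ ^ p) = 1 := by
    rw [map_pow]
    change p • (φ ⟨x, hx⟩).toAdd = 0
    rw [nsmul_eq_mul, CharP.cast_eq_zero, zero_mul]
  exact this

/-- A subgroup which generates a finite group modulo the residual of a normal `p`-subgroup is the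
whole group. -/
theorem Subgroup.eq_top_of_zmodResidual [Fact p.Prime] [Finite Γ] {P : Subgroup Γ}
    (hP : IsPGroup p P) {X : Subgroup Γ}
    (hX : ∀ γ, ∃ x ∈ X, x⁻¹ * γ ∈ P.zmodResidual p) : X = ⊤ := by
  have hPX : X.subgroupOf P = ⊤ := by
    by_contra hne
    obtain ⟨φ, hφ1, hφ⟩ := hP.exists_hom_zmod_ne_one hne
    refine hφ1 (MonoidHom.ext fun γ => ?_)
    obtain ⟨x, hx, hxγ⟩ := hX γ
    obtain ⟨h1, h2⟩ := Subgroup.mem_zmodResidual.mp hxγ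
    have hxP : x ∈ P := by
      have := P.mul_mem γ.2 (P.inv_mem h1)
      rwa [mul_inv_rev, inv_inv, mul_inv_cancel_left] at this
    have h3 : γ = ⟨x, hxP⟩ * ⟨x⁻¹ * γ, h1⟩ := Subtype.ext (mul_inv_cancel_left x (γ : Γ)).symm
    rw [h3, map_mul, h2, hφ ⟨x, hxP⟩ hx, MonoidHom.one_apply, mul_one]
  refine top_le_iff.mp fun γ _ => ?_
  obtain ⟨x, hx, hxγ⟩ := hX γ
  have h1 : x⁻¹ * γ ∈ X := (Subgroup.subgroupOf_eq_top.mp hPX) (P.zmodResidual_le hxγ)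
  have := X.mul_mem hx h1
  rwa [mul_inv_cancel_left] at this

end Residual

theorem Sylow.exists_section_of_normal {Γ : Type*} [Group Γ] [Finite Γ] {p : ℕ} [Fact p.Prime]
    (P : Sylow p Γ) [(P : Subgroup Γ).Normal] :
    ∃ s : Γ ⧸ (P : Subgroup Γ) →* Γ, ∀ q, (s q : Γ ⧸ (P : Subgroup Γ)) = q := by
  obtain ⟨K, hK⟩ := Subgroup.exists_right_complement'_of_coprime P.card_coprime_index
  refine ⟨K.subtype.comp hK.symm.QuotientMulEquiv.toMonoidHom, fun q => ?_⟩
  obtain ⟨x, rfl⟩ := hK.symm.QuotientMulEquiv.symm.surjective q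
  simp
  rfl

/-- A cocycle with values in a sum of copies of the regular representation gives a homomorphism
into a semidirect product. -/
theorem exists_semidirectProduct_hom {G H A : Type*} [Group G] [Group H] [Finite H] [CommGroup A]
    [Finite A] {p : ℕ} [NeZero p] (hA : ∀ a : A, a ^ p = 1) (φ : H →* MulAut A) (ρ : G →* H)
    (b : G → A × H → ZMod p)
    (hb : ∀ σ τ l h, b (σ * τ) (l, h) = b σ (l, h) + b τ (l, (ρ σ)⁻¹ * h)) :
    ∃ ρ' : G →* A ⋊[φ] H, (∀ σ, ρ σ = 1 → b σ = 0 → ρ' σ = 1) ∧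
      ∀ a h, ∃ g, ∀ σ, ρ σ = h → b σ = g → ρ' σ = ⟨a, h⟩ := by
  classical
  have := Fintype.ofFinite H
  have := Fintype.ofFinite A
  let c : (A × H → ZMod p) → A := fun g => ∏ x, φ x.2 x.1 ^ (g x).val
  have hadd : ∀ (a : A) (m n : ZMod p), a ^ (m + n).val = a ^ m.val * a ^ n.val := fun a m n => by
    rw [ZMod.val_add, ← pow_eq_pow_mod _ (hA a), pow_add]
  have hc : ∀ σ τ, c (b (σ * τ)) = c (b σ) * φ (ρ σ) (c (b τ)) := fun σ τ => by
    simp only [c, map_prod, map_pow]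
    rw [← Equiv.prod_comp ((Equiv.refl A).prodCongr (Equiv.mulLeft (ρ σ)))
      (fun x => φ x.2 x.1 ^ (b σ x).val), ← Finset.prod_mul_distrib,
      ← Equiv.prod_comp ((Equiv.refl A).prodCongr (Equiv.mulLeft (ρ σ)))]
    refine Finset.prod_congr rfl fun x _ => ?_
    simp [hb, hadd, Prod.map]
  have hc0 : c 0 = 1 := by simp [c]
  refine ⟨MonoidHom.mk' (fun σ => ⟨c (b σ), ρ σ⟩) fun σ τ => ?_, fun σ h1 h2 => ?_, fun a h => ?_⟩
  · ext <;> simp [hc]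
  · ext <;> simp [h1, h2, hc0]
  · refine ⟨Pi.single (a, 1) 1, fun σ h1 h2 => ?_⟩
    have : c (Pi.single (a, 1) 1) = a := by
      simp only [c]
      rw [Finset.prod_eq_single (a, 1)]
      · rw [Pi.single_eq_same, map_one, MulAut.one_apply, ZMod.val_one_eq_one_mod,
          ← pow_eq_pow_mod _ (hA a), pow_one]
      · intro x _ hx
        rw [Pi.single_eq_of_ne hx, ZMod.val_zero, pow_zero]
      · simp
    ext <;> simp [h1, h2, this]

/-- A smooth homomorphism to a complement together with sufficiently many Artin–Schreier cocycles
yields a smooth homomorphism to the whole group, surjective on each given subgroup. -/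
theorem Sylow.exists_smooth_hom_map_eq_top {k Ω ι Γ H : Type*} [Field k] [Field Ω] [Algebra k Ω]
    [IsGalois k Ω] [IsSepClosed Ω] [Group Γ] [Finite Γ] [Group H] [Finite H] {p : ℕ}
    [Fact p.Prime] [CharP Ω p] (P : Sylow p Γ) [(P : Subgroup Γ).Normal] (s : H →* Γ)
    (hs : ∀ γ, ∃ h, γ * (s h)⁻¹ ∈ P) (D : ι → Subgroup (Ω ≃ₐ[k] Ω))
    (hρ : ∃ (ρ : (Ω ≃ₐ[k] Ω) →* H) (b : (Ω ≃ₐ[k] Ω) →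
      (P : Subgroup Γ).map (QuotientGroup.mk' ((P : Subgroup Γ).zmodResidual p)) × H → ZMod p),
      (∃ T : Set Ω, T.Finite ∧ ∀ σ : Ω ≃ₐ[k] Ω, (∀ x ∈ T, σ x = x) → ρ σ = 1 ∧ b σ = 0) ∧
      (∀ σ τ l h, b (σ * τ) (l, h) = b σ (l, h) + b τ (l, (ρ σ)⁻¹ * h)) ∧
      ∀ i h g, ∃ σ ∈ D i, ρ σ = h ∧ b σ = g) :
    ∃ ρ : (Ω ≃ₐ[k] Ω) →* Γ, ρ.IsSmooth ∧ ∀ i, (D i).map ρ = ⊤ := by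
  obtain ⟨ρ, b, ⟨T, hT, hTb⟩, hb, hD⟩ := hρ
  let π := QuotientGroup.mk' ((P : Subgroup Γ).zmodResidual p)
  have hπ : Function.Surjective π := QuotientGroup.mk'_surjective _
  let A := (P : Subgroup Γ).map π
  have : A.Normal := Subgroup.Normal.map inferInstance π hπ
  have : IsMulCommutative A := ⟨⟨by
    rintro ⟨_, x, hx, rfl⟩ ⟨_, y, hy, rfl⟩
    exact Subtype.ext (Subgroup.commute_mk_zmodResidual _ hx hy)⟩⟩
  let _ : CommGroup A := { mul_comm := this.is_comm.comm }
  have hA : ∀ a : A, a ^ p = 1 := by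
    rintro ⟨_, x, hx, rfl⟩
    exact Subtype.ext (Subgroup.mk_pow_zmodResidual _ hx)
  let φ : H →* MulAut A := (MulAut.conjNormal (H := A)).comp (π.comp s)
  obtain ⟨ρ₁, hρ₁, hρ₁'⟩ := exists_semidirectProduct_hom hA φ ρ b hb
  let ψ : A ⋊[φ] H →* _ := SemidirectProduct.lift A.subtype (π.comp s) (by
    intro h; ext x; simp [φ])
  have hsm : (ψ.comp ρ₁).IsSmooth := ⟨T, hT, fun σ hσ => by
    rw [MonoidHom.comp_apply, hρ₁ σ (hTb σ hσ).1 (hTb σ hσ).2, map_one]⟩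
  obtain ⟨ρ₂, hρ₂, hρ₂'⟩ := hsm.exists_lift (p := p) π hπ (by
    rw [QuotientGroup.ker_mk']
    exact P.isPGroup'.to_le (Subgroup.zmodResidual_le _))
  refine ⟨ρ₂, hρ₂, fun i => Subgroup.eq_top_of_zmodResidual P.isPGroup' fun γ => ?_⟩
  obtain ⟨h, hh⟩ := hs γ
  obtain ⟨g, hg⟩ := hρ₁' ⟨π (γ * (s h)⁻¹), Subgroup.mem_map_of_mem π hh⟩ h
  obtain ⟨σ, hσ, h1, h2⟩ := hD i h g
  refine ⟨ρ₂ σ, Subgroup.mem_map_of_mem ρ₂ hσ, ?_⟩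
  rw [← QuotientGroup.eq]
  change π (ρ₂ σ) = π γ
  rw [← MonoidHom.comp_apply, hρ₂', MonoidHom.comp_apply, hg σ h1 h2]
  simp [ψ, SemidirectProduct.lift]

theorem exists_finite_field_dvd_card_units (p : ℕ) [Fact p.Prime] {f : ℕ} (hf : 0 < f)
    (hpf : p.Coprime f) :
    ∃ (E : Type) (_ : Field E) (_ : CharP E p) (_ : Finite E), f ∣ Nat.card Eˣ := by
  have hφ : f.totient ≠ 0 := (Nat.totient_pos.mpr hf).ne'
  refine ⟨GaloisField p f.totient, inferInstance, inferInstance, inferInstance, ?_⟩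
  rw [Nat.card_units, GaloisField.card p _ hφ]
  exact (Nat.modEq_iff_dvd' (Nat.one_le_pow _ _ (Fact.out : p.Prime).pos)).mp
    (Nat.ModEq.pow_totient hpf).symm

theorem Sylow.exists_hom_from_prod {Γ C C' : Type*} [Group Γ] [Finite Γ] [Group C] [Finite C]
    [Group C'] [Finite C'] {p e f : ℕ} [Fact p.Prime] (P : Sylow p Γ)
    [(P : Subgroup Γ).Normal] (hC : IsCyclic C) (hC' : IsCyclic C') (he : e ∣ Nat.card C)
    (hf : f ∣ Nat.card C') (E : (Γ ⧸ (P : Subgroup Γ)) ≃* Multiplicative (ZMod e × ZMod f)) :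
    ∃ s : C × C' →* Γ, ∀ γ, ∃ h, γ * (s h)⁻¹ ∈ P := by
  obtain ⟨t, ht⟩ := P.exists_section_of_normal
  obtain ⟨φ, hφ⟩ := IsCyclic.exists_surjective_zmod hC he
  obtain ⟨ψ, hψ⟩ := IsCyclic.exists_surjective_zmod hC' hf
  let μ : C × C' →* Multiplicative (ZMod e × ZMod f) :=
    MonoidHom.mk' (fun x => Multiplicative.ofAdd ((φ x.1).toAdd, (ψ x.2).toAdd)) fun x y => by
      simp [← ofAdd_add]
  refine ⟨t.comp (E.symm.toMonoidHom.comp μ), fun γ => ?_⟩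
  obtain ⟨x, hx⟩ := hφ (Multiplicative.ofAdd (E γ).toAdd.1)
  obtain ⟨y, hy⟩ := hψ (Multiplicative.ofAdd (E γ).toAdd.2)
  refine ⟨(x, y), ?_⟩
  have h1 : E.symm (μ (x, y)) = γ := by
    rw [MulEquiv.symm_apply_eq]
    simp [μ, hx, hy]
  have h2 : (t (E.symm (μ (x, y))) : Γ ⧸ (P : Subgroup Γ)) = γ := by rw [ht, h1]
  rw [QuotientGroup.eq] at h2
  have h3 := ‹(P : Subgroup Γ).Normal›.mem_comm h2
  exact h3

section Uniqueness

variable {k K : Type*} [Field k] [Field K] [Algebra k K]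

theorem IsNonarchimedean.of_extends {v : AbsoluteValue k ℝ} (hv : IsNonarchimedean v)
    {w : AbsoluteValue K ℝ} (h : ∀ x, w (algebraMap k K x) = v x) : IsNonarchimedean w := by
  have := IsUltrametricDist.isUltrametricDist_of_forall_norm_natCast_le_one
    (R := WithAbs w) fun n => by
      change w (n : K) ≤ 1
      rw [← map_natCast (algebraMap k K), h]
      exact hv.apply_natCast_le_one
  intro x y
  exact IsUltrametricDist.norm_add_le_max (WithAbs.toAbs w x) (WithAbs.toAbs w y)

open Polynomial in
theorem AbsoluteValue.le_one_of_forall_invariant [FiniteDimensional k K] [IsGalois k K]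
    {w w' : AbsoluteValue K ℝ} (hw : IsNonarchimedean w) (hw' : IsNonarchimedean w')
    (hinv : ∀ (σ : K ≃ₐ[k] K) y, w (σ y) = w y)
    (h : ∀ x : k, w' (algebraMap k K x) = w (algebraMap k K x)) {x : K} (hx : w x ≤ 1) :
    w' x ≤ 1 := by
  let f := MulSemiringAction.charpoly (K ≃ₐ[k] K) x
  let O := w.valuationRing hw
  let O' := w'.valuationRing hw'
  have hf : f ∈ lifts O.subtype := by
    refine prod_mem fun σ _ => (lifts_iff_liftsRing _ _).mpr (sub_mem ?_ ?_)
    · exact (lifts_iff_liftsRing _ _).mp (X_mem_lifts _)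
    · exact (lifts_iff_liftsRing _ _).mp (C_mem_lifts O.subtype ⟨σ x, (hinv σ x).trans_le hx⟩)
  have hf' : f ∈ lifts (algebraMap O' K) := by
    rw [lifts_iff_coeff_lifts] at hf ⊢
    intro n
    obtain ⟨a, ha⟩ : f.coeff n ∈ Set.range (algebraMap k K) := by
      rw [InfiniteGalois.mem_range_algebraMap_iff_fixed]
      intro σ
      exact MulSemiringAction.smul_coeff_charpoly x n σ
    obtain ⟨c, hc⟩ := hf n
    refine ⟨⟨f.coeff n, ?_⟩, rfl⟩
    rw [AbsoluteValue.mem_valuationRing, ← ha, h, ha, ← hc]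
    exact c.2
  obtain ⟨g, hg, -, hgm⟩ := lifts_and_natDegree_eq_and_monic hf'
    (MulSemiringAction.monic_charpoly _ _)
  have hxO : IsIntegral O' x := ⟨g, hgm, by
    rw [← eval_map, hg]
    exact MulSemiringAction.eval_charpoly _ _⟩
  obtain ⟨y, rfl⟩ := (IsIntegrallyClosed.isIntegral_iff (K := K)).mp hxO
  exact y.2

theorem AbsoluteValue.eq_of_forall_invariant [FiniteDimensional k K] [IsGalois k K]
    {w w' : AbsoluteValue K ℝ} (hw : IsNonarchimedean w) (hw' : IsNonarchimedean w')
    (hinv : ∀ (σ : K ≃ₐ[k] K) y, w (σ y) = w y)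
    (h : ∀ x : k, w' (algebraMap k K x) = w (algebraMap k K x)) : w' = w := by
  have hle : ∀ x, w x = 1 → w' x = 1 := fun x hx => by
    refine le_antisymm (AbsoluteValue.le_one_of_forall_invariant hw hw' hinv h hx.le) ?_
    have h0 : x ≠ 0 := fun h0 => by simp [h0] at hx
    have := AbsoluteValue.le_one_of_forall_invariant hw hw' hinv h (x := x⁻¹)
      (by rw [map_inv₀, hx, inv_one])
    rw [map_inv₀] at this
    exact (inv_le_one₀ (w'.pos h0)).mp this
  ext x
  by_cases hx : x = 0
  · simp [hx]
  have hN : w (algebraMap k K (Algebra.norm k x)) = w x ^ Nat.card (K ≃ₐ[k] K) := by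
    rw [Algebra.norm_eq_prod_automorphisms, map_prod, Finset.prod_congr rfl fun σ _ => hinv σ x,
      Finset.prod_const, Finset.card_univ, Nat.card_eq_fintype_card]
  have h1 := hle (x ^ Nat.card (K ≃ₐ[k] K) / algebraMap k K (Algebra.norm k x)) (by
    rw [map_div₀, map_pow, hN, div_self (pow_ne_zero _ (w.ne_zero hx))])
  rw [map_div₀, map_pow, h, hN, div_eq_one_iff_eq (pow_ne_zero _ (w.ne_zero hx))] at h1
  exact (pow_left_inj₀ (w'.nonneg x) (w.nonneg x) Nat.card_pos.ne').mp h1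

end Uniqueness

section FixedField

variable {k Ω H : Type*} [Field k] [Field Ω] [Algebra k Ω] [IsGalois k Ω] [Group H]
  {ρ : (Ω ≃ₐ[k] Ω) →* H}

theorem MonoidHom.IsSmooth.nonempty_mulEquiv (h : ρ.IsSmooth) (hρ : Function.Surjective ρ) :
    Nonempty ((IntermediateField.fixedField ρ.ker ≃ₐ[k] IntermediateField.fixedField ρ.ker) ≃*
      H) := by
  let N : ClosedSubgroup (Ω ≃ₐ[k] Ω) := ⟨ρ.ker, Subgroup.isClosed_of_isOpen _ h.isOpen_ker⟩
  have : N.Normal := inferInstanceAs ρ.ker.Normal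
  exact ⟨(InfiniteGalois.normalAutEquivQuotient N).symm.trans
    (QuotientGroup.quotientKerEquivOfSurjective ρ hρ)⟩

theorem MonoidHom.IsSmooth.existsUnique_absoluteValue (h : ρ.IsSmooth) {v : AbsoluteValue k ℝ}
    {w : AbsoluteValue Ω ℝ} (hv : IsNonarchimedean v) (hvw : ∀ x, w (algebraMap k Ω x) = v x)
    (hρ : ∀ q, ∃ σ : Ω ≃ₐ[k] Ω, (∀ y, w (σ y) = w y) ∧ ρ σ = q) :
    ∃! u : AbsoluteValue (IntermediateField.fixedField ρ.ker) ℝ,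
      ∀ x : k, u (algebraMap k (IntermediateField.fixedField ρ.ker) x) = v x := by
  let K := IntermediateField.fixedField ρ.ker
  obtain ⟨_, _⟩ := h.finiteDimensional_and_isGalois
  let u : AbsoluteValue K ℝ := w.comp (algebraMap K Ω).injective
  have hu : ∀ x : k, u (algebraMap k K x) = v x := hvw
  refine ⟨u, hu, fun u' hu' => ?_⟩
  refine AbsoluteValue.eq_of_forall_invariant (k := k) (hv.of_extends hu) (hv.of_extends hu')
    (fun σ y => ?_) fun x => (hu' x).trans (hu x).symm
  obtain ⟨τ, rfl⟩ := AlgEquiv.restrictNormalHom_surjective (F := k) (K₁ := K) Ω σ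
  obtain ⟨τ', hτ', h'⟩ := hρ (ρ τ)
  have h1 : τ' y = τ (y : Ω) := apply_eq_of_map_eq (fun μ hμ => y.2 ⟨μ, hμ⟩) h'
  change w (AlgEquiv.restrictNormalHom K τ y : Ω) = w y
  have h2 : (AlgEquiv.restrictNormalHom K τ y : Ω) = τ y := AlgEquiv.restrictNormal_commutes τ K y
  rw [h2, ← h1, hτ']

end FixedField

theorem AbsoluteValue.exists_sub_lt {k ι : Type*} [Field k] [Finite ι] {v : ι → AbsoluteValue k ℝ}
    (hnt : ∀ i, (v i).IsNontrivial) (hv : Pairwise fun i j => ¬ (v i).IsEquiv (v j)) (c : ι → k)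
    {ε : ℝ} (hε : 0 < ε) : ∃ a : k, ∀ i, v i (a - c i) < ε := by
  have := Fintype.ofFinite ι
  obtain ⟨a, ha⟩ := Metric.denseRange_iff.mp (AbsoluteValue.denseRange_algebraMap_pi hnt hv)
    (fun i => WithAbs.toAbs (v i) (c i)) ε hε
  refine ⟨a, fun i => ?_⟩
  rw [dist_comm] at ha
  exact ((dist_pi_lt_iff hε).mp ha i).trans_eq' (dist_eq_norm _ _)

theorem AbsoluteValue.IsDiscrete.isNontrivial {k : Type} [Field k] {v : AbsoluteValue k ℝ}
    (hv : v.IsDiscrete) : v.IsNontrivial := by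
  obtain ⟨-, c, hc0, hc1, ⟨x, hx⟩, -⟩ := hv
  exact ⟨x, fun h => by simp [h, hc0.ne] at hx, fun h => hc1.ne (hx.symm.trans h)⟩

theorem exists_smooth_hom_of_isDiscrete (p : ℕ) [Fact p.Prime] {k : Type} [Field k] [CharP k p]
    [Algebra (RatFunc (ZMod p)) k] [FiniteDimensional (RatFunc (ZMod p)) k] {e f : ℕ} (he : 0 < e)
    (hf : 0 < f) (hep : ¬ p ∣ e) (hfp : ¬ p ∣ f) (hroot : ∃ ζ : k, IsPrimitiveRoot ζ e)
    {Γ : Type} [Group Γ] [Finite Γ] (P : Sylow p Γ) [(P : Subgroup Γ).Normal]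
    (E : (Γ ⧸ (P : Subgroup Γ)) ≃* Multiplicative (ZMod e × ZMod f)) {ι : Type} [Finite ι]
    [Nonempty ι] {v : ι → AbsoluteValue k ℝ} (hdisc : ∀ i, (v i).IsDiscrete)
    (hpairwise : ∀ i j, i ≠ j → ¬ (v i).IsEquivalent (v j)) :
    ∃ ρ : (SeparableClosure k ≃ₐ[k] SeparableClosure k) →* Γ, ρ.IsSmooth ∧
      ∀ i, ∃ w : AbsoluteValue (SeparableClosure k) ℝ,
        (∀ x, w (algebraMap k _ x) = v i x) ∧
        ∀ q, ∃ σ : SeparableClosure k ≃ₐ[k] SeparableClosure k,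
          (∀ y, w (σ y) = w y) ∧ ρ σ = q := by
  have hpp : p.Prime := Fact.out
  have : NeZero e := ⟨he.ne'⟩
  have : CharP (SeparableClosure k) p :=
    charP_of_injective_algebraMap (algebraMap k (SeparableClosure k)).injective p
  obtain ⟨ζ, hζ⟩ := hroot
  obtain ⟨F, _, _, _, hF⟩ :=
    exists_finite_field_dvd_card_units p hf (hpp.coprime_iff_not_dvd.mpr hfp)
  have hv : ∀ i, IsNonarchimedean (v i) := fun i => (hdisc i).1
  have hnt := fun i => (hdisc i).isNontrivial
  choose w hw hvw happ using fun i =>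
    (v i).exists_extension_fixed_mem_closure (Ω := SeparableClosure k) (hv i) (hnt i)
  choose c hc0 hc1 hc hval using fun i => (hdisc i).2
  obtain ⟨s, hs⟩ := P.exists_hom_from_prod (C := rootsOfUnity e k) (C' := Fˣ) inferInstance
    inferInstance hζ.card_rootsOfUnity.symm.dvd hF E
  let D : ι → Subgroup (SeparableClosure k ≃ₐ[k] SeparableClosure k) := fun i =>
    { carrier := {σ | ∀ y, w i (σ y) = w i y}
      one_mem' := fun y => rfl
      mul_mem' := fun {σ τ} hσ hτ y => (hσ (τ y)).trans (hτ y)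
      inv_mem' := fun {σ} hσ y => by
        rw [← hσ, ← AlgEquiv.mul_apply, mul_inv_cancel, AlgEquiv.one_apply] }
  obtain ⟨ρ, hρ, hρD⟩ := P.exists_smooth_hom_map_eq_top s hs D
    (exists_smooth_hom_and_cocycle F _ hv
      (fun i => ValuationSubring.finite_residueField p k _
        (AbsoluteValue.valuationRing_ne_top (hv i) (hnt i)))
      (fun c _ => AbsoluteValue.exists_sub_lt hnt (fun i j hij h => hpairwise i j hij (by
        obtain ⟨r, hr, hr'⟩ := AbsoluteValue.isEquiv_iff_exists_rpow_eq.mp h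
        exact ⟨r, hr, fun x => (congrFun hr' x).symm⟩)) c) hvw hw happ hc0 hc1 hc hval
      (hpp.coprime_iff_not_dvd.mpr hep) hζ)
  refine ⟨ρ, hρ, fun i => ⟨w i, hvw i, fun q => ?_⟩⟩
  have : q ∈ (D i).map ρ := by rw [hρD]; trivial
  exact this

/-- (Sonn) Let `k` be a global field of characteristic `p > 0` (a finite extension of
`𝔽_p(t)`), let `e, f` be positive integers prime to `p` and assume `k` contains a
primitive `e`-th root of unity.  Let `Γ` be a finite group whose `p`-Sylow subgroup `P`
is normal with `Γ/P ≅ ℤ/eℤ × ℤ/fℤ`.  For every finite set `v 1, …, v n` of pairwise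
inequivalent discrete valuations of `k` there is a Galois extension `K/k` with
`Gal(K/k) ≅ Γ` such that each `v i` extends uniquely to `K` (equivalently,
`K ⊗_k k_{v i}` is a field, so `Gal(K_{v i}/k_{v i}) ≅ Γ`). -/
theorem sonn_realization_with_local_conditions
    (p : ℕ) [Fact p.Prime] (k : Type) [Field k] [CharP k p]
    [Algebra (RatFunc (ZMod p)) k] [FiniteDimensional (RatFunc (ZMod p)) k]
    (e f : ℕ) (he : 0 < e) (hf : 0 < f) (hep : ¬ p ∣ e) (hfp : ¬ p ∣ f)
    (hroot : ∃ ζ : k, IsPrimitiveRoot ζ e)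
    (Γ : Type) [Group Γ] [Finite Γ]
    (P : Sylow p Γ) (hPnormal : (P : Subgroup Γ).Normal)
    (hquot : Nonempty ((Γ ⧸ (P : Subgroup Γ)) ≃* Multiplicative (ZMod e × ZMod f)))
    (n : ℕ) (v : Fin n → AbsoluteValue k ℝ)
    (hdisc : ∀ i, (v i).IsDiscrete)
    (hpairwise : ∀ i j, i ≠ j → ¬ (v i).IsEquivalent (v j)) :
    ∃ (K : Type) (_ : Field K) (_ : Algebra k K)
      (_ : FiniteDimensional k K) (_ : IsGalois k K),
      Nonempty ((K ≃ₐ[k] K) ≃* Γ) ∧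
      ∀ i, ∃! w : AbsoluteValue K ℝ, ∀ x : k, w (algebraMap k K x) = v i x := by
  obtain ⟨E⟩ := hquot
  have key : ∀ {ι : Type} [Finite ι] [Nonempty ι] (u : ι → AbsoluteValue k ℝ),
      (∀ i, (u i).IsDiscrete) → (∀ i j, i ≠ j → ¬ (u i).IsEquivalent (u j)) →
      ∃ (K : Type) (_ : Field K) (_ : Algebra k K)
        (_ : FiniteDimensional k K) (_ : IsGalois k K),
        Nonempty ((K ≃ₐ[k] K) ≃* Γ) ∧
        ∀ i, ∃! w : AbsoluteValue K ℝ, ∀ x : k, w (algebraMap k K x) = u i x := by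
    intro ι _ _ u hu hne
    obtain ⟨ρ, hρ, hρu⟩ :=
      exists_smooth_hom_of_isDiscrete p he hf hep hfp hroot P E hu hne
    obtain ⟨h1, h2⟩ := hρ.finiteDimensional_and_isGalois
    refine ⟨IntermediateField.fixedField ρ.ker, inferInstance, inferInstance, h1, h2,
      hρ.nonempty_mulEquiv fun q => ?_, fun i => ?_⟩
    · obtain ⟨w, -, hw⟩ := hρu (Classical.arbitrary ι)
      obtain ⟨σ, -, hσ⟩ := hw q
      exact ⟨σ, hσ⟩
    · obtain ⟨w, hw, hq⟩ := hρu i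
      exact hρ.existsUnique_absoluteValue (hu i).1 hw hq
  rcases isEmpty_or_nonempty (Fin n) with hn | hn
  · obtain ⟨u, hu⟩ := AbsoluteValue.exists_isDiscrete p k
    obtain ⟨K, h1, h2, h3, h4, h5, -⟩ := key (fun _ : Unit => u) (fun _ => hu)
      fun i j hij => absurd (Subsingleton.elim i j) hij
    exact ⟨K, h1, h2, h3, h4, h5, fun i => hn.elim i⟩
  · exact key v hdisc hpairwise
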